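/- arXiv:1103.5619 — 2 statements merged into one kernel-verified Lean document; each statement's English description precedes it below -/
import Mathlib

section
/- Let Λ be a full-rank lattice (a discrete subgroup of rank d) in Euclidean space ℝ^d, d ≥ 1, and let m > 0 be the minimal Euclidean norm of a nonzero element of Λ. Suppose v₁,…,v_d ∈ Λ are linearly independent over ℝ and each has norm exactly m. Then the index of the subgroup ℤv₁ + ⋯ + ℤv_d in Λ is at most 2^d / vol(B_d), where vol(B_d) is the Lebesgue volume of the unit ball in ℝ^d. -/
open MeasureTheory

open Module

section

variable {E : Type*} [NormedAddCommGroup E] [InnerProductSpace ℝ E] [FiniteDimensional ℝ E]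
  [MeasurableSpace E] [BorelSpace E]

/-- **Hadamard's inequality** for the volume of a fundamental domain. -/
theorem ZSpan.volume_real_fundamentalDomain_le_prod_norm {n : ℕ} (b : Basis (Fin n) ℝ E) :
    volume.real (ZSpan.fundamentalDomain b) ≤ ∏ i, ‖b i‖ := by
  have hn : finrank ℝ E = n := by simp [finrank_eq_card_basis b]
  have : Fact (finrank ℝ E = n) := ⟨hn⟩
  let e : OrthonormalBasis (Fin n) ℝ E := (stdOrthonormalBasis ℝ E).reindex (finCongr hn)
  have he : volume.real (ZSpan.fundamentalDomain e.toBasis) = 1 := by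
    rw [measureReal_congr (ZSpan.fundamentalDomain_ae_parallelepiped e.toBasis volume),
      measureReal_def, e.coe_toBasis, e.volume_parallelepiped, ENNReal.toReal_one]
  rw [ZSpan.measureReal_fundamentalDomain _ _ e.toBasis, he, mul_one]
  have h := e.toBasis.orientation.abs_volumeForm_apply_le b
  rwa [e.toBasis.orientation.volumeForm_robust e rfl] at h

/-- A ball containing no nonzero lattice point has volume at most `2 ^ n` times the covolume. -/
theorem ZLattice.volume_real_ball_le_covolume_mul_two_pow (L : Submodule ℤ E) [DiscreteTopology L]
    [IsZLattice ℝ L] {r : ℝ} (hr : ∀ x ∈ L, x ≠ 0 → r ≤ ‖x‖) :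
    volume.real (Metric.ball (0 : E) r) ≤ ZLattice.covolume L * 2 ^ finrank ℝ E := by
  let b := Free.chooseBasis ℤ L
  have fund := ZLattice.isAddFundamentalDomain b volume
  have hfin : volume (ZSpan.fundamentalDomain (b.ofZLatticeBasis ℝ)) ≠ ⊤ :=
    (ZSpan.fundamentalDomain_isBounded _).measure_lt_top.ne
  rw [ZLattice.covolume_eq_measure_fundamentalDomain L volume fund]
  have : Countable L.toAddSubgroup := inferInstanceAs (Countable L)
  by_contra! h
  obtain ⟨x, hx0, hx⟩ := exists_ne_zero_mem_lattice_of_measure_mul_two_pow_lt_measure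
    (L := L.toAddSubgroup) (s := Metric.ball 0 r) fund (by simp) (convex_ball 0 r) (by
      rw [← ENNReal.toReal_lt_toReal (by finiteness) measure_ball_lt_top.ne]
      simpa [measureReal_def] using h)
  exact (hr x x.2 (by simpa using hx0)).not_gt (by simpa using hx)

end

/-- Inside the proof of Theorem 2.1: if `Λ` is a full-rank discrete subgroup of `ℝ^d`
(`d ≥ 1`), `m > 0` is the minimal norm of a nonzero element of `Λ`, and `v₁, …, v_d ∈ Λ`
are linearly independent vectors each of norm exactly `m`, then the index of
`ℤv₁ + ⋯ + ℤv_d` in `Λ` is at most `2^d / vol(B_d)`, where `vol(B_d)` is the volume of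
the unit ball in `ℝ^d`. -/
theorem index_of_minimal_vectors_le
    (d : ℕ) (hd : 1 ≤ d) (Λ : AddSubgroup (EuclideanSpace ℝ (Fin d)))
    (hdisc : DiscreteTopology Λ)
    (hfull : Submodule.span ℝ (Λ : Set (EuclideanSpace ℝ (Fin d))) = ⊤)
    (m : ℝ) (hm : 0 < m)
    (hmin : ∀ x ∈ Λ, x ≠ 0 → m ≤ ‖x‖)
    (hex : ∃ x ∈ Λ, x ≠ 0 ∧ ‖x‖ = m)
    (v : Fin d → EuclideanSpace ℝ (Fin d))
    (hvΛ : ∀ i, v i ∈ Λ)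
    (hli : LinearIndependent ℝ v)
    (hnorm : ∀ i, ‖v i‖ = m) :
    ((AddSubgroup.closure (Set.range v)).relIndex Λ : ℝ)
      ≤ 2 ^ d / (volume (Metric.ball (0 : EuclideanSpace ℝ (Fin d)) 1)).toReal := by
  let L : Submodule ℤ (EuclideanSpace ℝ (Fin d)) := AddSubgroup.toIntSubmodule Λ
  have : DiscreteTopology L := hdisc
  have : IsZLattice ℝ L := ⟨hfull⟩
  let b : Basis (Fin d) ℝ (EuclideanSpace ℝ (Fin d)) :=
    basisOfLinearIndependentOfCardEqFinrank' v hli (by simp)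
  have hb : ⇑b = v := by simp [b]
  let M : Submodule ℤ (EuclideanSpace ℝ (Fin d)) := Submodule.span ℤ (Set.range b)
  have hML : M ≤ L := Submodule.span_le.2 (by rintro _ ⟨i, rfl⟩; rw [hb]; exact hvΛ i)
  have hM : M.toAddSubgroup = AddSubgroup.closure (Set.range v) := by
    rw [Submodule.span_int_eq_addSubgroupClosure, hb]
  have hidx := ZLattice.covolume_div_covolume_eq_relIndex' M L hML
  rw [hM] at hidx
  change _ = ((AddSubgroup.closure (Set.range v)).relIndex Λ : ℝ) at hidx
  have hcovM : ZLattice.covolume M ≤ m ^ d := by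
    rw [ZLattice.covolume_eq_measure_fundamentalDomain M volume
      (ZSpan.isAddFundamentalDomain b volume)]
    simpa [hb, hnorm] using ZSpan.volume_real_fundamentalDomain_le_prod_norm b
  have hball := ZLattice.volume_real_ball_le_covolume_mul_two_pow L (r := m) hmin
  rw [measureReal_def, Measure.addHaar_ball_of_pos _ _ hm, ENNReal.toReal_mul,
    ENNReal.toReal_ofReal (by positivity), finrank_euclideanSpace_fin] at hball
  have hvol : 0 < (volume (Metric.ball (0 : EuclideanSpace ℝ (Fin d)) 1)).toReal :=
    ENNReal.toReal_pos (Metric.measure_ball_pos _ _ one_pos).ne' measure_ball_lt_top.ne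
  rw [← hidx, div_le_div_iff₀ (ZLattice.covolume_pos L volume) hvol]
  calc ZLattice.covolume M * (volume (Metric.ball (0 : EuclideanSpace ℝ (Fin d)) 1)).toReal
      ≤ m ^ d * (volume (Metric.ball (0 : EuclideanSpace ℝ (Fin d)) 1)).toReal := by gcongr
    _ ≤ 2 ^ d * ZLattice.covolume L := by rwa [mul_comm (2 ^ d)]
end

section
/- For every ε > 0 there exists a constant C ≥ 1 such that the following holds. Let K be a cubic number field ([K:ℚ] = 3) which is not Galois over ℚ, let L be a Galois (normal) closure of K over ℚ, and let k be an intermediate field of L/ℚ with [k:ℚ] = 2 (the quadratic resolvent of K). Then C⁻¹·|D_K|^{−ε} ≤ |Cl(K)[3]| / |Cl(k)[3]| ≤ C·|D_K|^{ε}, where |Cl(K)[3]| denotes the number of elements of order dividing 3 in the ideal class group of the ring of integers of K, and D_K is the discriminant of K. -/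
section GroupTheory

variable {X Y Z : Type*} [CommGroup X] [CommGroup Y] [CommGroup Z]

theorem Subgroup.card_inf_mul_relIndex {G : Type*} [Group G] (H K : Subgroup G) :
    Nat.card (H ⊓ K : Subgroup G) * H.relIndex K = Nat.card K := by
  have h := Subgroup.relIndex_mul_relIndex (H := ⊥) (K := H ⊓ K) (L := K) bot_le inf_le_right
  rwa [relIndex_bot_left, relIndex_bot_left, inf_relIndex_right] at h

theorem Subgroup.card_map_mul_card_ker_inf {G G' : Type*} [Group G] [Group G'] (f : G →* G')
    (K : Subgroup G) : Nat.card (K.map f) * Nat.card (f.ker ⊓ K : Subgroup G) = Nat.card K := by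
  rw [← relIndex_ker, mul_comm, card_inf_mul_relIndex]

theorem Subgroup.relIndex_map_powMonoidHom [Finite X] (n : ℕ) (D : Subgroup X) :
    (D.map (powMonoidHom n)).relIndex D = Nat.card ((powMonoidHom n).ker ⊓ D : Subgroup X) := by
  have hle : D.map (powMonoidHom n) ≤ D := by
    rintro _ ⟨x, hx, rfl⟩
    exact D.pow_mem hx n
  have h1 := card_inf_mul_relIndex (D.map (powMonoidHom n)) D
  rw [inf_eq_left.mpr hle] at h1
  have h2 := card_map_mul_card_ker_inf (powMonoidHom n) D
  exact Nat.eq_of_mul_eq_mul_left Nat.card_pos (h1.trans h2.symm)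

theorem Subgroup.relIndex_ne_zero_of_finite [Finite X] (H K : Subgroup X) : H.relIndex K ≠ 0 :=
  index_ne_zero_of_finite

theorem Subgroup.card_le_card_inf_mul_relIndex [Finite X] {R S T : Subgroup X} (h : S ≤ T) :
    Nat.card S ≤ Nat.card (R ⊓ S : Subgroup X) * R.relIndex T := by
  rw [← card_inf_mul_relIndex R S]
  exact Nat.mul_le_mul_left _ (relIndex_le_of_le_right h (relIndex_ne_zero_of_finite _ _))

/-- If `e : Y → X` and `N : X → Y` behave like extension and norm of ideal classes in a cyclic
cubic extension with group `⟨σ⟩`, and `τ` is an involution inverting `σ`, then the `τ`-invariant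
`3`-torsion of `X` is controlled by the `3`-torsion of `Y`. -/
theorem card_invariant_torsion_le [Finite X] [Finite Y] (σ τ : X →* X) (e : Y →* X) (N : X →* Y)
    (hσ : ∀ x, σ (σ (σ x)) = x)
    (hNe : ∀ y, N (e y) = y ^ 3) (hNσ : ∀ x, N (σ x) = N x)
    (heN : ∀ x, e (N x) = x * σ x * σ (σ x)) (hNτ : ∀ x, N (τ x) = (N x)⁻¹)
    (hτe : ∀ y, τ (e y) = (e y)⁻¹) :
    Nat.card {x : X // x ^ 3 = 1 ∧ τ x = x} ≤
      (e.range.relIndex (σ.eqLocus (MonoidHom.id X))) ^ 2 * Nat.card {y : Y // y ^ 3 = 1} := by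
  set B := e.range.relIndex (σ.eqLocus (MonoidHom.id X)) with hB
  let A : Subgroup X := (powMonoidHom 3).ker ⊓ τ.eqLocus (MonoidHom.id X)
  have hA : ∀ x, x ∈ A ↔ x ^ 3 = 1 ∧ τ x = x := fun x => Iff.rfl
  let d : X →* X := σ / σ.comp σ
  have hd : ∀ x, d x = σ x / σ (σ x) := fun x => rfl
  have hNA : ∀ x ∈ A, N x = 1 := by
    intro x hx
    obtain ⟨h3, hτx⟩ := (hA x).1 hx
    have h1 := hNτ x
    rw [hτx, eq_inv_iff_mul_eq_one] at h1
    have h2 : N x ^ 3 = 1 := by rw [← map_pow, h3, map_one]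
    calc N x = N x ^ 3 / (N x * N x) := by rw [eq_div_iff_mul_eq', pow_three]
      _ = 1 := by rw [h1, h2, div_one]
  have hcard : Nat.card {x : X // x ^ 3 = 1 ∧ τ x = x} = Nat.card A := rfl
  have hker : Nat.card (d.ker ⊓ A : Subgroup X) ≤ B := by
    have hS : d.ker ⊓ A ≤ σ.eqLocus (MonoidHom.id X) := by
      rintro x ⟨hx, -⟩
      have h1 : σ x / σ (σ x) = 1 := hx
      rw [div_eq_one] at h1
      have h2 := congrArg (fun y => σ (σ y)) h1
      simp only [hσ] at h2
      exact h2.symm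
    have hR : e.range ⊓ (d.ker ⊓ A) = ⊥ := by
      rw [eq_bot_iff]
      rintro x ⟨⟨y, rfl⟩, -, hx⟩
      have hτ := ((hA _).1 hx).2
      have h3 := ((hA _).1 hx).1
      rw [hτe, inv_eq_iff_mul_eq_one] at hτ
      rw [Subgroup.mem_bot]
      calc e y = e y ^ 3 / (e y * e y) := by rw [eq_div_iff_mul_eq', pow_three]
        _ = 1 := by rw [h3, hτ, div_one]
    have := Subgroup.card_le_card_inf_mul_relIndex (R := e.range) hS
    rwa [hR, Subgroup.card_bot, one_mul] at this
  have himg : Nat.card (A.map d) ≤ Nat.card {y : Y // y ^ 3 = 1} * B := by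
    have hS : A.map d ≤ σ.eqLocus (MonoidHom.id X) := by
      rintro _ ⟨x, hx, rfl⟩
      have h1 := heN x
      rw [hNA x hx, map_one] at h1
      have h3 : σ (σ x) ^ 3 = 1 := by rw [← map_pow, ← map_pow, ((hA x).1 hx).1]; simp
      change σ (σ x / σ (σ x)) = σ x / σ (σ x)
      rw [map_div, hσ, div_eq_div_iff_mul_eq_mul]
      calc σ (σ x) * σ (σ x) = σ (σ x) ^ 3 * (x * σ x) / (x * σ x * σ (σ x)) := by
            rw [eq_div_iff_mul_eq', pow_three]
            simp only [mul_comm, mul_left_comm]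
        _ = σ x * x := by rw [h3, ← h1, one_mul, div_one, mul_comm]
    refine (Subgroup.card_le_card_inf_mul_relIndex (R := e.range) hS).trans
      (Nat.mul_le_mul_right _ ?_)
    have : ∀ x : (e.range ⊓ A.map d : Subgroup X), ∃ y : {y : Y // y ^ 3 = 1}, e y = x := by
      rintro ⟨_, ⟨y, rfl⟩, x, hx, hxy⟩
      refine ⟨⟨y, ?_⟩, rfl⟩
      rw [← hNe, ← hxy, hd, map_div, hNσ, hNσ, hNσ, div_self']
    choose f hf using this
    refine Nat.card_le_card_of_injective f fun a b hab => Subtype.ext ?_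
    rw [← hf, ← hf, hab]
  rw [hcard, ← Subgroup.card_map_mul_card_ker_inf d A]
  calc _ ≤ Nat.card {y : Y // y ^ 3 = 1} * B * B := Nat.mul_le_mul himg hker
    _ = _ := by ring

/-- If `e : Y → X` and `N : X → Y` behave like extension and norm of ideal classes in a cyclic
cubic extension with group `⟨σ⟩`, and `τ` is an involution inverting `σ`, then the `3`-torsion of
`Y` is controlled by the `τ`-invariant `3`-torsion of `X` and the index of the norms. -/
theorem card_torsion_le_invariant [Finite X] [Finite Y] (σ τ : X →* X) (e : Y →* X) (N : X →* Y)
    (hσ : ∀ x, σ (σ (σ x)) = x) (hτ : ∀ x, τ (τ x) = x) (hτσ : ∀ x, τ (σ x) = σ (σ (τ x)))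
    (hNe : ∀ y, N (e y) = y ^ 3) (hNτ : ∀ x, N (τ x) = (N x)⁻¹) :
    Nat.card {y : Y // y ^ 3 = 1} ≤ N.range.index *
      (e.range.relIndex (σ.eqLocus (MonoidHom.id X)) *
        Nat.card {x : X // x ^ 3 = 1 ∧ τ x = x}) := by
  let C : Subgroup Y := (powMonoidHom 3).range
  have hC : ∀ y, y ∈ C ↔ ∃ z, z ^ 3 = y := fun y => Iff.rfl
  let φ : X →* Y ⧸ C := (QuotientGroup.mk' C).comp N
  let d : X →* X := σ / σ.comp σ
  have hd : ∀ x, d x = σ x / σ (σ x) := fun x => rfl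
  let M : Subgroup X := (MonoidHom.id X / τ).range
  have hφker : ∀ x, x ∈ φ.ker ↔ N x ∈ C := fun x => by
    rw [MonoidHom.mem_ker]
    exact QuotientGroup.eq_one_iff _
  have hcube : ∀ x, x ^ 3 ∈ φ.ker := fun x => by
    rw [hφker, map_pow, hC]; exact ⟨_, rfl⟩
  have h0 : Nat.card {y : Y // y ^ 3 = 1} = C.index := by
    have h1 : Nat.card {y : Y // y ^ 3 = 1} = Nat.card (powMonoidHom 3 : Y →* Y).ker := rfl
    have h2 := (powMonoidHom 3 : Y →* Y).ker.card_mul_index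
    rw [Subgroup.index_ker, ← C.card_mul_index, mul_comm] at h2
    rw [h1]
    exact Nat.eq_of_mul_eq_mul_left Nat.card_pos h2
  have hτd : ∀ x, x ∈ M → τ (d x) = d x := by
    rintro _ ⟨x, rfl⟩
    change τ (σ (x / τ x) / σ (σ (x / τ x))) = σ (x / τ x) / σ (σ (x / τ x))
    simp only [map_div, hτσ, hτ, hσ]
    simp only [div_eq_mul_inv, mul_inv, inv_inv, mul_comm, mul_left_comm]
  have hφM : M.map φ = φ.range := by
    refine le_antisymm (by rintro _ ⟨x, -, rfl⟩; exact ⟨x, rfl⟩) ?_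
    rintro _ ⟨x, rfl⟩
    refine ⟨x⁻¹ / τ x⁻¹, ⟨x⁻¹, rfl⟩, ?_⟩
    rw [eq_comm, ← div_eq_one, ← map_div, ← MonoidHom.mem_ker, hφker]
    refine ⟨N x, ?_⟩
    simp only [map_div, map_inv, hNτ, powMonoidHom_apply]
    simp only [div_eq_mul_inv, mul_inv, inv_inv, pow_three]
  have h1 : C.index ≤ N.range.index * Nat.card φ.range := by
    have h2 := φ.range.card_mul_index
    have h3 : φ.range.index ∣ N.range.index := by
      have : φ.range = N.range.map (QuotientGroup.mk' C) := by
        rw [MonoidHom.range_eq_map, MonoidHom.range_eq_map, Subgroup.map_map]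
      rw [this]
      exact Subgroup.index_map_dvd _ (QuotientGroup.mk'_surjective C)
    rw [Subgroup.index, ← h2, mul_comm]
    exact Nat.mul_le_mul_right _ (Nat.le_of_dvd (Nat.pos_of_ne_zero Subgroup.index_ne_zero_of_finite) h3)
  rw [h0]
  refine h1.trans (Nat.mul_le_mul_left _ ?_)
  rw [← hφM, ← Subgroup.relIndex_ker]
  let F := φ.ker ⊓ M
  let E := M ⊓ σ.eqLocus (MonoidHom.id X)
  have h2 : F.relIndex (E ⊔ F) * (E ⊔ F).relIndex M = φ.ker.relIndex M := by
    rw [Subgroup.relIndex_mul_relIndex _ _ _ le_sup_right (sup_le inf_le_left inf_le_right),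
      Subgroup.inf_relIndex_right]
  rw [← h2]
  refine Nat.mul_le_mul ?_ ?_
  · rw [Subgroup.relIndex_sup_right]
    refine (Subgroup.relIndex_le_of_le_left (H := e.range ⊓ E) ?_ (Subgroup.relIndex_ne_zero_of_finite _ _)).trans ?_
    · rintro _ ⟨⟨y, rfl⟩, hy⟩
      refine ⟨?_, hy.1⟩
      exact (hφker _).2 ⟨y, (hNe y).symm⟩
    · rw [Subgroup.inf_relIndex_right]
      exact Subgroup.relIndex_le_of_le_right inf_le_right (Subgroup.relIndex_ne_zero_of_finite _ _)
  · let D := M.map d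
    refine (Subgroup.relIndex_le_of_le_left (H := (D.map (powMonoidHom 3)).comap d ⊓ M) ?_
      (Subgroup.relIndex_ne_zero_of_finite _ _)).trans ?_
    · rintro x ⟨⟨_, ⟨z, hz, rfl⟩, hzx⟩, hx⟩
      have hzx' : d (x / z ^ 3) = 1 := by
        rw [map_div, map_pow, div_eq_one, ← hzx]; rfl
      have hmem : x / z ^ 3 ∈ E := by
        refine ⟨M.div_mem hx (M.pow_mem hz 3), ?_⟩
        rw [hd, div_eq_one] at hzx'
        have := congrArg (fun y => σ (σ y)) hzx'
        simp only [hσ] at this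
        exact this.symm
      have hz3 : z ^ 3 ∈ F := ⟨hcube z, M.pow_mem hz 3⟩
      have := Subgroup.mul_mem_sup hmem hz3
      rwa [div_mul_cancel] at this
    · rw [Subgroup.inf_relIndex_right, Subgroup.relIndex_comap, Subgroup.relIndex_map_powMonoidHom]
      refine Nat.card_le_card_of_injective
        (fun x => (⟨x.1, x.2.1, ?_⟩ : {x : X // x ^ 3 = 1 ∧ τ x = x}))
        fun a b hab => Subtype.ext (Subtype.mk.inj hab)
      obtain ⟨z, hz, hzx⟩ := x.2.2
      rw [← hzx, hτd z hz]

/-- Extension and norm of classes identify the odd-order torsion of `Z` with the `τ`-invariants. -/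
theorem card_torsion_eq_invariant [Finite X] [Finite Z] (τ : X →* X) (e : Z →* X) (N : X →* Z)
    (hNe : ∀ z, N (e z) = z ^ 2) (heN : ∀ x, e (N x) = x * τ x) (hτe : ∀ z, τ (e z) = e z) :
    Nat.card {z : Z // z ^ 3 = 1} = Nat.card {x : X // x ^ 3 = 1 ∧ τ x = x} := by
  refine le_antisymm ?_ ?_
  · refine Nat.card_le_card_of_injective
      (fun z => (⟨e z, by rw [← map_pow, z.2, map_one], hτe _⟩ : {x : X // x ^ 3 = 1 ∧ τ x = x}))
      fun a b hab => Subtype.ext ?_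
    have h : e a = e b := congrArg Subtype.val hab
    have h2 := congrArg N h
    rw [hNe, hNe] at h2
    have ha : (a : Z) ^ 2 * a = 1 := by rw [← pow_succ, a.2]
    have hb : (b : Z) ^ 2 * b = 1 := by rw [← pow_succ, b.2]
    rw [h2] at ha
    exact mul_left_cancel (ha.trans hb.symm)
  · refine Nat.card_le_card_of_injective
      (fun x => (⟨N x, by rw [← map_pow, x.2.1, map_one]⟩ : {z : Z // z ^ 3 = 1}))
      fun a b hab => Subtype.ext ?_
    have h : N a = N b := congrArg Subtype.val hab
    have h2 := congrArg e h
    rw [heN, heN, a.2.2, b.2.2, ← pow_two, ← pow_two] at h2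
    have ha : (a : X) ^ 2 * a = 1 := by rw [← pow_succ, a.2.1]
    have hb : (b : X) ^ 2 * b = 1 := by rw [← pow_succ, b.2.1]
    rw [h2] at ha
    exact mul_left_cancel (ha.trans hb.symm)

end GroupTheory

theorem Nat.exists_pow_card_primeFactors_le (A : ℝ) (hA : 1 ≤ A) (ε : ℝ) (hε : 0 < ε) :
    ∃ C : ℝ, 1 ≤ C ∧ ∀ n : ℕ, n ≠ 0 → A ^ n.primeFactors.card ≤ C * (n : ℝ) ^ ε := by
  obtain ⟨B, hB⟩ := exists_nat_ge (A ^ (1 / ε))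
  refine ⟨A ^ (B + 1), one_le_pow₀ hA, fun n hn => ?_⟩
  have hp : ∀ p ∈ n.primeFactors, A ≤ (if p ≤ B then A else 1) * (p : ℝ) ^ ε := by
    intro p hp
    have hp1 : (1 : ℝ) ≤ p := mod_cast (Nat.prime_of_mem_primeFactors hp).one_lt.le
    split_ifs with h
    · exact le_mul_of_one_le_right (by linarith) (Real.one_le_rpow hp1 hε.le)
    · rw [one_mul]
      have h1 : A ^ (1 / ε) ≤ p := hB.trans (by exact_mod_cast (not_le.mp h).le)
      calc A = (A ^ (1 / ε)) ^ ε := by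
            rw [← Real.rpow_mul (by linarith), one_div_mul_cancel hε.ne', Real.rpow_one]
        _ ≤ _ := by gcongr
  calc A ^ n.primeFactors.card = ∏ p ∈ n.primeFactors, A := by simp
    _ ≤ ∏ p ∈ n.primeFactors, ((if p ≤ B then A else 1) * (p : ℝ) ^ ε) :=
        Finset.prod_le_prod (fun _ _ => by linarith) hp
    _ = A ^ (n.primeFactors.filter (· ≤ B)).card * ((∏ p ∈ n.primeFactors, p : ℕ) : ℝ) ^ ε := by
        rw [Finset.prod_mul_distrib, Finset.prod_ite, Finset.prod_const, Finset.prod_const_one,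
          mul_one, Nat.cast_prod, Real.finsetProd_rpow _ _ (fun _ _ => by positivity)]
    _ ≤ A ^ (B + 1) * (n : ℝ) ^ ε := by
        gcongr
        · have h : n.primeFactors.filter (· ≤ B) ⊆ Finset.range (B + 1) := fun p hp => by
            simpa [Nat.lt_succ_iff] using (Finset.mem_filter.mp hp).2
          simpa using Finset.card_le_card h
        · exact Nat.le_of_dvd (Nat.pos_of_ne_zero hn) (Nat.prod_primeFactors_dvd n)

open IsDedekindDomain in
theorem Ideal.tsum_indicator_not_dvd_eq {R : Type*} [CommRing R] [IsDedekindDomain R]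
    (g : Ideal R →*₀ ℂ) (hg : Summable fun I => ‖g I‖) (S : Finset (HeightOneSpectrum R)) :
    ∑' I, {I : Ideal R | ∀ p ∈ S, ¬ p.asIdeal ∣ I}.indicator g I =
      (∏ p ∈ S, (1 - g p.asIdeal)) * ∑' I, g I := by
  classical
  induction S using Finset.induction_on with
  | empty => simp
  | insert q S hq ih =>
    have hs : Summable g := hg.of_norm
    rw [Finset.prod_insert hq, mul_assoc, ← ih, sub_mul, one_mul, ← tsum_mul_left]
    have hinj : Function.Injective (fun J : Ideal R => q.asIdeal * J) :=
      mul_right_injective₀ q.ne_bot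
    have h1 : ∑' J, g q.asIdeal * {I : Ideal R | ∀ p ∈ S, ¬ p.asIdeal ∣ I}.indicator g J =
        ∑' I, ({I : Ideal R | ∀ p ∈ S, ¬ p.asIdeal ∣ I} ∩ {I | q.asIdeal ∣ I}).indicator g I := by
      symm
      rw [← hinj.tsum_eq]
      · refine tsum_congr fun J => ?_
        have h2 : (∀ p ∈ S, ¬ p.asIdeal ∣ q.asIdeal * J) ↔ ∀ p ∈ S, ¬ p.asIdeal ∣ J := by
          refine forall₂_congr fun p hp => not_congr ?_
          rw [p.prime.dvd_mul, or_iff_right_iff_imp]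
          intro h
          have := (p.prime.associated_of_dvd q.prime h)
          rw [associated_iff_eq] at this
          exact absurd (HeightOneSpectrum.ext this ▸ hp) hq
        by_cases h3 : ∀ p ∈ S, ¬ p.asIdeal ∣ J
        · rw [Set.indicator_of_mem, Set.indicator_of_mem, map_mul]
          · exact h3
          · exact ⟨h2.mpr h3, dvd_mul_right _ _⟩
        · rw [Set.indicator_of_notMem, Set.indicator_of_notMem, mul_zero]
          · exact fun h => h3 h
          · exact fun h => h3 (h2.mp h.1)
      · intro I hI
        obtain ⟨J, rfl⟩ := (Set.mem_of_indicator_ne_zero hI).2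
        exact ⟨J, rfl⟩
    rw [h1, ← (hs.indicator _).tsum_sub (hs.indicator _)]
    refine tsum_congr fun I => ?_
    by_cases h3 : ∀ p ∈ S, ¬ p.asIdeal ∣ I <;> by_cases h4 : q.asIdeal ∣ I <;>
      simp only [Set.indicator, Set.mem_ofPred_eq, Finset.mem_insert, forall_eq_or_imp, h3, h4,
        Set.mem_inter_iff, not_true, not_false_iff, and_true, and_false, true_and, false_and,
        if_false, sub_self, sub_zero] <;> split_ifs <;> simp

open IsDedekindDomain in
theorem Ideal.tendsto_prod_one_sub_mul_tsum {R : Type*} [CommRing R] [IsDedekindDomain R]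
    (g : Ideal R →*₀ ℂ) (hg : Summable fun I => ‖g I‖) :
    Filter.Tendsto (fun S : Finset (HeightOneSpectrum R) =>
      (∏ p ∈ S, (1 - g p.asIdeal)) * ∑' I, g I) Filter.atTop (nhds 1) := by
  classical
  simp_rw [← Ideal.tsum_indicator_not_dvd_eq g hg]
  have h1 : ∑' I : Ideal R, (if I = 1 then (1 : ℂ) else 0) = 1 := tsum_ite_eq 1 _
  rw [← h1]
  refine tendsto_tsum_of_dominated_convergence hg (fun I => ?_) (.of_forall fun S I => ?_)
  · by_cases hI : I = 1
    · subst hI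
      refine tendsto_const_nhds.congr fun S => ?_
      rw [Set.indicator_of_mem, map_one, if_pos rfl]
      intro p hp h
      exact p.prime.not_isUnit (isUnit_of_dvd_one h)
    · rw [if_neg hI]
      by_cases h0 : I = ⊥
      · subst h0
        refine tendsto_const_nhds.congr fun S => ?_
        rw [← Ideal.zero_eq_bot, Set.indicator_apply, map_zero, ite_self]
      obtain ⟨P, hP, hIP⟩ := Ideal.exists_le_maximal I (by rwa [← Ideal.one_eq_top])
      have hPb : P ≠ ⊥ := fun h => h0 (le_bot_iff.mp (h ▸ hIP))
      refine tendsto_const_nhds.congr' ?_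
      filter_upwards [Filter.eventually_ge_atTop {⟨P, hP.isPrime, hPb⟩}] with S hS
      rw [Set.indicator_of_notMem]
      exact fun h => h _ (hS (Finset.mem_singleton_self _)) (Ideal.dvd_iff_le.mpr hIP)
  · exact norm_indicator_le_norm_self _ _

theorem Complex.abs_neg_log_norm_one_sub_sub_re_le {z : ℂ} (hz : ‖z‖ ≤ 1 / 2) :
    |-Real.log ‖1 - z‖ - z.re| ≤ ‖z‖ ^ 2 := by
  have h1 := Complex.norm_log_one_sub_inv_sub_self_le (z := z) (by linarith)
  have h2 : (Complex.log (1 - z)⁻¹ - z).re = -Real.log ‖1 - z‖ - z.re := by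
    simp [Complex.log_re]
  rw [← h2]
  refine (Complex.abs_re_le_norm _).trans (h1.trans ?_)
  have h3 : (1 - ‖z‖)⁻¹ ≤ 2 := by
    rw [inv_le_comm₀] <;> linarith
  nlinarith [sq_nonneg ‖z‖]

open IsDedekindDomain in
theorem Ideal.abs_tsum_re_sub_log_norm_tsum_le {R : Type*} [CommRing R] [IsDedekindDomain R]
    (g : Ideal R →*₀ ℂ) (hg : Summable fun I => ‖g I‖)
    (hp : ∀ p : HeightOneSpectrum R, ‖g p.asIdeal‖ ≤ 1 / 2) :
    (∑' I, g I) ≠ 0 ∧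
    |∑' p : HeightOneSpectrum R, (g p.asIdeal).re - Real.log ‖∑' I, g I‖| ≤
      ∑' p : HeightOneSpectrum R, ‖g p.asIdeal‖ ^ 2 := by
  have hlim := Ideal.tendsto_prod_one_sub_mul_tsum g hg
  have hL : (∑' I, g I) ≠ 0 := by
    intro h
    simp only [h, mul_zero] at hlim
    exact zero_ne_one (tendsto_nhds_unique tendsto_const_nhds hlim)
  refine ⟨hL, ?_⟩
  have hinj : Function.Injective (fun p : HeightOneSpectrum R => p.asIdeal) :=
    fun p q h => HeightOneSpectrum.ext h
  have hs : Summable fun p : HeightOneSpectrum R => ‖g p.asIdeal‖ := hg.comp_injective hinj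
  have hsre : Summable fun p : HeightOneSpectrum R => (g p.asIdeal).re :=
    Complex.reCLM.summable hs.of_norm
  have hsq : Summable fun p : HeightOneSpectrum R => ‖g p.asIdeal‖ ^ 2 :=
    Summable.of_nonneg_of_le (fun _ => by positivity)
      (fun p => by nlinarith [norm_nonneg (g p.asIdeal), hp p]) hs
  have hne : ∀ p : HeightOneSpectrum R, ‖1 - g p.asIdeal‖ ≠ 0 := fun p h => by
    have h1 : g p.asIdeal = 1 := (sub_eq_zero.mp (norm_eq_zero.mp h)).symm
    have := hp p
    rw [h1] at this
    norm_num at this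
  have hlog : Filter.Tendsto (fun S : Finset (HeightOneSpectrum R) =>
      ∑ p ∈ S, ((g p.asIdeal).re - (-Real.log ‖1 - g p.asIdeal‖))) Filter.atTop
      (nhds (∑' p : HeightOneSpectrum R, (g p.asIdeal).re - Real.log ‖∑' I, g I‖)) := by
    have h1 := ((Real.continuousAt_log (x := ‖(1 : ℂ)‖) (by simp)).tendsto.comp hlim.norm)
    have h2 := Filter.Tendsto.add (show Filter.Tendsto _ Filter.atTop _ from hsre.hasSum) (h1.sub_const (Real.log ‖∑' I, g I‖))
    have h3 : ∑' p : HeightOneSpectrum R, (g p.asIdeal).re - Real.log ‖∑' I, g I‖ =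
      ∑' p : HeightOneSpectrum R, (g p.asIdeal).re + (Real.log ‖(1 : ℂ)‖ -
        Real.log ‖∑' I, g I‖) := by simp; ring
    rw [h3]
    refine h2.congr fun S => ?_
    simp only [Function.comp, sub_neg_eq_add]
    rw [norm_mul, norm_prod, Real.log_mul (Finset.prod_ne_zero_iff.mpr fun p _ => hne p)
      (norm_ne_zero_iff.mpr hL), Real.log_prod (fun p _ => hne p), Finset.sum_add_distrib]
    ring
  refine le_of_tendsto hlog.abs (.of_forall fun S => ?_)
  refine (Finset.abs_sum_le_sum_abs _ _).trans ((Finset.sum_le_sum fun p _ => ?_).trans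
    (hsq.sum_le_tsum S fun _ _ => by positivity))
  rw [abs_sub_comm]
  exact Complex.abs_neg_log_norm_one_sub_sub_re_le (hp p)

open NumberField

noncomputable section

/-- The tent function, whose integer translates form a partition of unity of `ℝ`. -/
def tent (t : ℝ) : ℝ := max 0 (1 - |t|)

theorem tent_nonneg (t : ℝ) : 0 ≤ tent t := le_max_left _ _

theorem tent_le_one (t : ℝ) : tent t ≤ 1 := max_le zero_le_one (by linarith [abs_nonneg t])

theorem abs_lt_one_of_tent_ne_zero {t : ℝ} (h : tent t ≠ 0) : |t| < 1 := by
  contrapose! h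
  exact max_eq_left (by linarith)

theorem abs_tent_sub_tent_le (t t' : ℝ) : |tent t - tent t'| ≤ |t - t'| := by
  refine (abs_max_sub_max_le_max _ _ _ _).trans ?_
  rw [sub_self, abs_zero, sub_sub_sub_cancel_left]
  exact max_le (abs_nonneg _) ((abs_abs_sub_abs_le _ _).trans (abs_sub_comm _ _).le)

theorem exists_finset_sum_tent_eq_one (t : ℝ) :
    ∃ S : Finset ℤ, (∀ n ∉ S, tent (t + n) = 0) ∧ ∑ n ∈ S, tent (t + n) = 1 := by
  refine ⟨{-⌊t⌋, -⌊t⌋ - 1}, fun n hn => ?_, ?_⟩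
  · by_contra h
    have h1 := abs_lt.mp (abs_lt_one_of_tent_ne_zero h)
    have h2 := Int.floor_le t
    have h3 := Int.lt_floor_add_one t
    have h4 : ((⌊t⌋ + n : ℤ) : ℝ) < 1 := by push_cast; linarith
    have h5 : ((-2 : ℤ) : ℝ) < (⌊t⌋ + n : ℤ) := by push_cast; linarith
    have h6 : ⌊t⌋ + n < 1 := by exact_mod_cast h4
    have h7 : -2 < ⌊t⌋ + n := by exact_mod_cast h5
    simp only [Finset.mem_insert, Finset.mem_singleton, not_or] at hn
    omega
  · rw [Finset.sum_pair (by omega)]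
    have h2 := Int.floor_le t
    have h3 := Int.lt_floor_add_one t
    push_cast
    rw [tent, tent, abs_of_nonneg (by linarith), abs_of_nonpos (by linarith),
      max_eq_right (by linarith), max_eq_right (by linarith)]
    ring

theorem Finset.abs_prod_sub_prod_le_sum {ι : Type*} (s : Finset ι) (f g : ι → ℝ)
    (hf : ∀ i, 0 ≤ f i) (hf1 : ∀ i, f i ≤ 1) (hg : ∀ i, 0 ≤ g i) (hg1 : ∀ i, g i ≤ 1) :
    |∏ i ∈ s, f i - ∏ i ∈ s, g i| ≤ ∑ i ∈ s, |f i - g i| := by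
  classical
  induction s using Finset.induction_on with
  | empty => simp
  | insert a s ha ih =>
    rw [Finset.prod_insert ha, Finset.prod_insert ha, Finset.sum_insert ha]
    have h1 : f a * ∏ i ∈ s, f i - g a * ∏ i ∈ s, g i =
      (f a - g a) * ∏ i ∈ s, f i + g a * (∏ i ∈ s, f i - ∏ i ∈ s, g i) := by ring
    rw [h1]
    refine (abs_add_le _ _).trans ?_
    rw [abs_mul, abs_mul, abs_of_nonneg (hg a),
      abs_of_nonneg (Finset.prod_nonneg fun i _ => hf i)]
    have h2 : ∏ i ∈ s, f i ≤ 1 := Finset.prod_le_one (fun i _ => hf i) fun i _ => hf1 i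
    nlinarith [abs_nonneg (f a - g a), abs_nonneg (∏ i ∈ s, f i - ∏ i ∈ s, g i), hg1 a, hg a]

namespace NumberField.Units

variable (K : Type*) [Field K] [NumberField K]

open dirichletUnitTheorem
open scoped Classical

/-- A product of tent functions in the coordinates of a fundamental system of units. -/
def tentWeight (y : logSpace K) : ℝ :=
  ∏ i, tent (((basisUnitLattice K).ofZLatticeBasis ℝ (unitLattice K)).repr y i)

theorem tentWeight_nonneg (y : logSpace K) : 0 ≤ tentWeight K y :=
  Finset.prod_nonneg fun _ _ => tent_nonneg _

theorem tentWeight_le_one (y : logSpace K) : tentWeight K y ≤ 1 :=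
  Finset.prod_le_one (fun _ _ => tent_nonneg _) fun _ _ => tent_le_one _

theorem exists_norm_le_of_tentWeight_ne_zero :
    ∃ M : ℝ, 0 ≤ M ∧ ∀ y, tentWeight K y ≠ 0 → ‖y‖ ≤ M := by
  let b := (basisUnitLattice K).ofZLatticeBasis ℝ (unitLattice K)
  refine ⟨∑ i, ‖b i‖, by positivity, fun y hy => ?_⟩
  rw [← b.sum_repr y]
  refine (norm_sum_le _ _).trans (Finset.sum_le_sum fun i hi => ?_)
  rw [norm_smul]
  exact mul_le_of_le_one_left (norm_nonneg _)
    (abs_lt_one_of_tent_ne_zero (Finset.prod_ne_zero_iff.mp hy i hi)).le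

theorem exists_abs_tentWeight_sub_le :
    ∃ C : ℝ, 0 ≤ C ∧ ∀ y y', |tentWeight K y - tentWeight K y'| ≤ C * ‖y - y'‖ := by
  let b := (basisUnitLattice K).ofZLatticeBasis ℝ (unitLattice K)
  let f : Fin (rank K) → (logSpace K →L[ℝ] ℝ) := fun i => LinearMap.toContinuousLinearMap (b.coord i)
  refine ⟨∑ i, ‖f i‖, by positivity, fun y y' => ?_⟩
  refine (Finset.abs_prod_sub_prod_le_sum _ _ _ (fun _ => tent_nonneg _) (fun _ => tent_le_one _)
    (fun _ => tent_nonneg _) (fun _ => tent_le_one _)).trans ?_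
  rw [Finset.sum_mul]
  refine Finset.sum_le_sum fun i _ => (abs_tent_sub_tent_le _ _).trans ?_
  have := (f i).le_opNorm (y - y')
  rw [map_sub] at this
  exact this

theorem hasSum_tentWeight_logEmbedding_add (y : logSpace K) :
    HasSum (fun u : (𝓞 K)ˣ => tentWeight K (logEmbedding K (Additive.ofMul u) + y))
      (torsionOrder K) := by
  let b := (basisUnitLattice K).ofZLatticeBasis ℝ (unitLattice K)
  let φ : torsion K × (Fin (rank K) → ℤ) → (𝓞 K)ˣ :=
    fun ζe => ζe.1 * ∏ i, (fundSystem K i) ^ (ζe.2 i)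
  have hφ : Function.Bijective φ := by
    refine Function.bijective_iff_existsUnique _ |>.mpr fun x => ?_
    obtain ⟨a, ha, ha'⟩ := exist_unique_eq_mul_prod K x
    exact ⟨a, ha.symm, fun c hc => ha' c hc.symm⟩
  have hval : ∀ a, tentWeight K (logEmbedding K (Additive.ofMul (φ a)) + y) =
      ∏ i, tent (b.repr y i + a.2 i) := by
    intro a
    have h1 : logEmbedding K (Additive.ofMul (φ a)) = ∑ i, (a.2 i : ℝ) • b i := by
      have h2 : logEmbedding K (Additive.ofMul (a.1 : (𝓞 K)ˣ)) = 0 :=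
        logEmbedding_eq_zero_iff.mpr a.1.2
      rw [ofMul_mul, map_add, h2, zero_add, ofMul_prod, map_sum]
      refine Finset.sum_congr rfl fun i _ => ?_
      rw [ofMul_zpow, map_zsmul, logEmbedding_fundSystem, Int.cast_smul_eq_zsmul,
        Module.Basis.ofZLatticeBasis_apply]
    refine Finset.prod_congr rfl fun i _ => ?_
    have h5 := congrFun (b.repr_sum_self fun i => (a.2 i : ℝ)) i
    rw [h1, map_add, Finsupp.add_apply, add_comm]
    exact congrArg (fun t => tent (b.repr y i + t)) h5
  have : Fintype (torsion K) := Fintype.ofFinite _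
  choose S hS0 hS1 using exists_finset_sum_tent_eq_one
  rw [← (Equiv.ofBijective φ hφ).hasSum_iff]
  have h3 := hasSum_sum_of_ne_finset_zero
    (f := fun a : torsion K × (Fin (rank K) → ℤ) => ∏ i, tent (b.repr y i + a.2 i))
    (s := Finset.univ ×ˢ Fintype.piFinset fun i => S (b.repr y i)) (L := .unconditional _) (by
      rintro ⟨ζ, e⟩ he
      simp only [Finset.mem_product, Finset.mem_univ, true_and, Fintype.mem_piFinset,
        not_forall] at he
      obtain ⟨i, hi⟩ := he
      exact Finset.prod_eq_zero (Finset.mem_univ i) (hS0 _ _ hi))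
  rw [Finset.sum_product, Finset.sum_congr rfl fun ζ _ =>
    (Finset.prod_univ_sum (fun i => S (b.repr y i)) fun i n => tent (b.repr y i + n)).symm] at h3
  simp only [hS1, Finset.prod_const_one, Finset.sum_const, Finset.card_univ, nsmul_eq_mul,
    mul_one] at h3
  have h4 : (torsionOrder K : ℝ) = Fintype.card (torsion K) := by rw [torsionOrder, Nat.card_eq_fintype_card]
  rw [h4]
  refine h3.congr_fun fun a => ?_
  exact hval a

end NumberField.Units
end

noncomputable section
namespace NumberField.mixedEmbedding

open NumberField.Units dirichletUnitTheorem InfinitePlace Module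
open scoped Classical

variable (K : Type*) [Field K] [NumberField K]

variable {K} in
theorem normAtPlace_le_norm (w : InfinitePlace K) (v : mixedSpace K) : normAtPlace w v ≤ ‖v‖ := by
  rw [norm_eq_sup'_normAtPlace]
  exact Finset.le_sup' (fun w => normAtPlace w v) (Finset.mem_univ w)

variable {K} in
theorem exists_normAtPlace_eq_norm (v : mixedSpace K) : ∃ w, normAtPlace w v = ‖v‖ := by
  rw [norm_eq_sup'_normAtPlace]
  obtain ⟨w, -, hw⟩ := Finset.exists_mem_eq_sup' Finset.univ_nonempty (fun w => normAtPlace w v)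
  exact ⟨w, hw.symm⟩

variable {K} in
theorem abs_normAtPlace_sub_le (w : InfinitePlace K) (v v' : mixedSpace K) :
    |normAtPlace w v - normAtPlace w v'| ≤ ‖v - v'‖ := by
  rw [abs_le]
  have h1 := normAtPlace_add_le w (v - v') v'
  have h2 := normAtPlace_add_le w (v' - v) v
  have h3 := normAtPlace_le_norm w (v - v')
  have h4 := normAtPlace_le_norm w (v' - v)
  rw [norm_sub_rev] at h4
  simp only [sub_add_cancel] at h1 h2
  constructor <;> linarith

variable {K} in
theorem log_norm_eq {v : mixedSpace K} (hv : mixedEmbedding.norm v ≠ 0) :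
    Real.log (mixedEmbedding.norm v) = ∑ w, (mult w : ℝ) * Real.log (normAtPlace w v) := by
  rw [mixedEmbedding.norm_apply, Real.log_prod]
  · simp
  · exact fun w _ => pow_ne_zero _ (mixedEmbedding.norm_ne_zero_iff.mp hv w)

variable {K} in
theorem abs_log_normAtPlace_sub_le {v : mixedSpace K} (hv : mixedEmbedding.norm v ≠ 0)
    (w : InfinitePlace K) :
    |Real.log (normAtPlace w v) - Real.log (mixedEmbedding.norm v) * (finrank ℚ K : ℝ)⁻¹| ≤
      (Fintype.card (InfinitePlace K) + 1) * ‖logMap v‖ := by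
  set ν := Real.log (mixedEmbedding.norm v) * (finrank ℚ K : ℝ)⁻¹ with hν
  have hm : ∀ w : InfinitePlace K, (1 : ℝ) ≤ mult w := fun w => one_le_mult
  have hsum : ∑ w : InfinitePlace K, (mult w : ℝ) * (Real.log (normAtPlace w v) - ν) = 0 := by
    simp_rw [mul_sub, Finset.sum_sub_distrib, ← log_norm_eq hv, ← Finset.sum_mul]
    rw [← Nat.cast_sum, sum_mult_eq, hν]
    have : (finrank ℚ K : ℝ) ≠ 0 := Nat.cast_ne_zero.mpr finrank_pos.ne'
    field_simp
    ring
  have hle : ∀ w : InfinitePlace K, w ≠ w₀ →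
      |(mult w : ℝ) * (Real.log (normAtPlace w v) - ν)| ≤ ‖logMap v‖ := by
    intro w hw
    have := norm_le_pi_norm (logMap v) ⟨w, hw⟩
    rwa [logMap_apply, Real.norm_eq_abs] at this
  have habs : |(mult w : ℝ) * (Real.log (normAtPlace w v) - ν)| ≤
      (Fintype.card (InfinitePlace K) + 1) * ‖logMap v‖ := by
    by_cases hw : w = w₀
    · subst hw
      rw [← Finset.add_sum_erase _ _ (Finset.mem_univ w₀)] at hsum
      rw [eq_neg_of_add_eq_zero_left hsum, abs_neg]
      refine (Finset.abs_sum_le_sum_abs _ _).trans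
        ((Finset.sum_le_sum fun w hw => hle w (Finset.ne_of_mem_erase hw)).trans ?_)
      rw [Finset.sum_const, nsmul_eq_mul]
      gcongr
      have := Finset.card_le_univ (Finset.univ.erase (w₀ : InfinitePlace K))
      have h2 : ((Finset.univ.erase (w₀ : InfinitePlace K)).card : ℝ) ≤
        Fintype.card (InfinitePlace K) := by exact_mod_cast this
      linarith
    · refine (hle w hw).trans (le_mul_of_one_le_left (norm_nonneg _) ?_)
      have : (0 : ℝ) ≤ Fintype.card (InfinitePlace K) := Nat.cast_nonneg _
      linarith
  refine le_trans ?_ habs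
  rw [abs_mul]
  refine le_mul_of_one_le_left (abs_nonneg _) ?_
  rw [Nat.abs_cast]
  exact hm w

theorem exists_mul_norm_le_normAtPlace :
    ∃ c : ℝ, 0 < c ∧ c ≤ 1 ∧ ∀ v : mixedSpace K, mixedEmbedding.norm v ≠ 0 →
      tentWeight K (logMap v) ≠ 0 → ∀ w, c * ‖v‖ ≤ normAtPlace w v := by
  obtain ⟨M, hM, hM'⟩ := exists_norm_le_of_tentWeight_ne_zero K
  set B := ((Fintype.card (InfinitePlace K) : ℝ) + 1) * M with hB
  have hB0 : 0 ≤ B := by positivity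
  refine ⟨Real.exp (-(2 * B)), Real.exp_pos _, Real.exp_le_one_iff.mpr (by linarith),
    fun v hv hw w => ?_⟩
  obtain ⟨w', hw'⟩ := exists_normAtPlace_eq_norm v
  have hpos : ∀ w, 0 < normAtPlace w v := fun w =>
    (normAtPlace_nonneg w v).lt_of_ne' (mixedEmbedding.norm_ne_zero_iff.mp hv w)
  have h3 : ∀ w, |Real.log (normAtPlace w v) - Real.log (mixedEmbedding.norm v) *
      (finrank ℚ K : ℝ)⁻¹| ≤ B := fun w => (abs_log_normAtPlace_sub_le hv w).trans (by
    rw [hB]; gcongr; exact hM' _ hw)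
  have h1 := abs_le.mp (h3 w)
  have h2 := abs_le.mp (h3 w')
  rw [← hw', ← Real.log_le_log_iff (by have := hpos w'; positivity) (hpos w),
    Real.log_mul (Real.exp_ne_zero _) (hpos w').ne', Real.log_exp]
  linarith

theorem abs_log_sub_log_le {a b m : ℝ} (hm : 0 < m) (ha : m ≤ a) (hb : m ≤ b) :
    |Real.log a - Real.log b| ≤ |a - b| / m := by
  have key : ∀ a b : ℝ, m ≤ a → m ≤ b → Real.log a - Real.log b ≤ |a - b| / m := by
    intro a b ha hb
    have ha0 : 0 < a := hm.trans_le ha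
    have hb0 : 0 < b := hm.trans_le hb
    rw [← Real.log_div ha0.ne' hb0.ne']
    refine (Real.log_le_sub_one_of_pos (div_pos ha0 hb0)).trans ?_
    have : a / b - 1 = (a - b) / b := by field_simp
    rw [this]
    refine (div_le_div_of_nonneg_right (le_abs_self _) hb0.le).trans ?_
    gcongr
  rw [abs_le]
  constructor
  · have := key b a hb ha
    rw [abs_sub_comm] at this
    linarith
  · exact key a b ha hb

section
variable {K}
variable {v v' : mixedSpace K} {m : ℝ}

theorem norm_ne_zero_of_le_normAtPlace (hm : 0 < m) (hv : ∀ w, m ≤ normAtPlace w v) :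
    mixedEmbedding.norm v ≠ 0 :=
  mixedEmbedding.norm_ne_zero_iff.mpr fun w => (hm.trans_le (hv w)).ne'

theorem pow_le_norm_of_le_normAtPlace (hm : 0 < m) (hv : ∀ w, m ≤ normAtPlace w v) :
    m ^ finrank ℚ K ≤ mixedEmbedding.norm v := by
  rw [mixedEmbedding.norm_apply, ← sum_mult_eq, ← Finset.prod_pow_eq_pow_sum]
  exact Finset.prod_le_prod (fun _ _ => by positivity) fun w _ => by gcongr; exact hv w

theorem abs_log_norm_sub_log_norm_le (hm : 0 < m) (hv : ∀ w, m ≤ normAtPlace w v)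
    (hv' : ∀ w, m ≤ normAtPlace w v') :
    |Real.log (mixedEmbedding.norm v) - Real.log (mixedEmbedding.norm v')| ≤
      finrank ℚ K * (‖v - v'‖ / m) := by
  rw [log_norm_eq (norm_ne_zero_of_le_normAtPlace hm hv),
    log_norm_eq (norm_ne_zero_of_le_normAtPlace hm hv'), ← Finset.sum_sub_distrib, ← sum_mult_eq,
    Nat.cast_sum, Finset.sum_mul]
  refine (Finset.abs_sum_le_sum_abs _ _).trans (Finset.sum_le_sum fun w _ => ?_)
  rw [← mul_sub, abs_mul, Nat.abs_cast]
  gcongr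
  exact (abs_log_sub_log_le hm (hv w) (hv' w)).trans (by gcongr; exact abs_normAtPlace_sub_le w v v')

theorem norm_logMap_sub_logMap_le (hm : 0 < m) (hv : ∀ w, m ≤ normAtPlace w v)
    (hv' : ∀ w, m ≤ normAtPlace w v') :
    ‖logMap v - logMap v'‖ ≤ 4 * (‖v - v'‖ / m) := by
  refine (pi_norm_le_iff_of_nonneg (by positivity)).mpr fun w => ?_
  rw [Pi.sub_apply, logMap_apply, logMap_apply, ← mul_sub, Real.norm_eq_abs, abs_mul, Nat.abs_cast]
  have h1 := abs_log_norm_sub_log_norm_le hm hv hv'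
  have h2 := (abs_log_sub_log_le hm (hv w) (hv' w)).trans
    (by gcongr; exact abs_normAtPlace_sub_le w.1 v v' : _ ≤ ‖v - v'‖ / m)
  have hn : (0 : ℝ) < finrank ℚ K := Nat.cast_pos.mpr finrank_pos
  have h3 : |Real.log (mixedEmbedding.norm v) * (finrank ℚ K : ℝ)⁻¹ -
      Real.log (mixedEmbedding.norm v') * (finrank ℚ K : ℝ)⁻¹| ≤ ‖v - v'‖ / m := by
    rw [← sub_mul, abs_mul, abs_of_pos (inv_pos.mpr hn), ← div_eq_mul_inv, div_le_iff₀ hn, mul_comm]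
    exact h1
  have hmult : (mult w.1 : ℝ) ≤ 2 := by
    unfold mult; split_ifs <;> norm_num
  calc _ ≤ (2 : ℝ) * (‖v - v'‖ / m + ‖v - v'‖ / m) := by
        gcongr
        rw [sub_sub_sub_comm]
        exact (abs_sub _ _).trans (add_le_add h2 h3)
    _ = _ := by ring

end

/-- The summand `|N v| ^ (-s)`, weighted so that its sum over a unit orbit is
`torsionOrder K * |N v| ^ (-s)`. -/
def weightedNorm (s : ℝ) (v : mixedSpace K) : ℝ :=
  tentWeight K (logMap v) * mixedEmbedding.norm v ^ (-s)

theorem weightedNorm_nonneg (s : ℝ) (v : mixedSpace K) : 0 ≤ weightedNorm K s v :=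
  mul_nonneg (tentWeight_nonneg _ _) (Real.rpow_nonneg (mixedEmbedding.norm_nonneg v) _)

theorem weightedNorm_of_norm_eq_zero {s : ℝ} (hs : s ≠ 0) {v : mixedSpace K}
    (hv : mixedEmbedding.norm v = 0) : weightedNorm K s v = 0 := by
  rw [weightedNorm, hv, Real.zero_rpow (neg_ne_zero.mpr hs), mul_zero]

theorem weightedNorm_le_one {s : ℝ} (hs : 0 < s) {v : mixedSpace K}
    (hv : mixedEmbedding.norm v = 0 ∨ 1 ≤ mixedEmbedding.norm v) : weightedNorm K s v ≤ 1 := by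
  rcases hv with hv | hv
  · rw [weightedNorm_of_norm_eq_zero K hs.ne' hv]
    exact zero_le_one
  · exact mul_le_one₀ (tentWeight_le_one _ _) (Real.rpow_nonneg (mixedEmbedding.norm_nonneg v) _)
      (Real.rpow_le_one_of_one_le_of_nonpos hv (by linarith))

theorem exists_weightedNorm_le_norm_rpow :
    ∃ c : ℝ, 0 < c ∧ ∀ s : ℝ, 0 < s → ∀ v : mixedSpace K,
      weightedNorm K s v ≤ c ^ (-(finrank ℚ K * s)) * ‖v‖ ^ (-(finrank ℚ K * s)) := by
  obtain ⟨c, hc, -, hcv⟩ := exists_mul_norm_le_normAtPlace K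
  refine ⟨c, hc, fun s hs v => ?_⟩
  by_cases hv : mixedEmbedding.norm v = 0
  · rw [weightedNorm_of_norm_eq_zero K hs.ne' hv]
    positivity
  by_cases hw : tentWeight K (logMap v) = 0
  · rw [weightedNorm, hw, zero_mul]
    positivity
  have hv0 : 0 < ‖v‖ := norm_pos_iff.mpr fun h => hv (by rw [h, map_zero])
  have h1 := pow_le_norm_of_le_normAtPlace (mul_pos hc hv0) (hcv v hv hw)
  rw [← Real.mul_rpow hc.le hv0.le, ← mul_neg, Real.rpow_mul (by positivity), Real.rpow_natCast]
  refine (mul_le_of_le_one_left (Real.rpow_nonneg (mixedEmbedding.norm_nonneg v) _)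
    (tentWeight_le_one _ _)).trans ?_
  exact Real.rpow_le_rpow_of_nonpos (by positivity) h1 (by linarith)

theorem abs_exp_neg_sub_exp_neg_le {x y b : ℝ} (hx : b ≤ x) (hy : b ≤ y) :
    |Real.exp (-x) - Real.exp (-y)| ≤ Real.exp (-b) * |x - y| := by
  have key : ∀ x y : ℝ, b ≤ x → Real.exp (-x) - Real.exp (-y) ≤ Real.exp (-b) * |x - y| := by
    intro x y hx
    have h1 : Real.exp (-x) - Real.exp (-y) = Real.exp (-x) * (1 - Real.exp (x - y)) := by
      rw [mul_sub, mul_one, ← Real.exp_add]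
      ring_nf
    rw [h1]
    have h2 := Real.add_one_le_exp (x - y)
    have h3 := neg_abs_le (x - y)
    calc _ ≤ Real.exp (-x) * |x - y| := by gcongr; linarith
      _ ≤ _ := by gcongr
  rw [abs_le]
  constructor
  · have := key y x hy
    rw [abs_sub_comm] at this
    linarith
  · exact key x y hx

theorem exists_abs_weightedNorm_sub_le (T : ℝ) (hT : 0 ≤ T) :
    ∃ C : ℝ, 0 ≤ C ∧ ∀ s ∈ Set.Icc (1 : ℝ) 2, ∀ v v' : mixedSpace K,
      (mixedEmbedding.norm v = 0 ∨ 1 ≤ mixedEmbedding.norm v) →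
      (mixedEmbedding.norm v' = 0 ∨ 1 ≤ mixedEmbedding.norm v') → ‖v - v'‖ ≤ T →
      |weightedNorm K s v - weightedNorm K s v'| ≤ C * ((1 + ‖v'‖) ^ (finrank ℚ K + 1))⁻¹ := by
  obtain ⟨c, hc, hc1, hcv⟩ := exists_mul_norm_le_normAtPlace K
  obtain ⟨A, hA, hAy⟩ := exists_abs_tentWeight_sub_le K
  set n := finrank ℚ K with hn
  set R := 1 + 2 * (c + 1) * T / c with hR
  have hR0 : 0 ≤ R := by positivity
  set C₂ := (4 * A * T + 2 * n * T) * ((4 / c) ^ (n + 1)) with hC₂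
  have hC₂0 : 0 ≤ C₂ := by positivity
  refine ⟨(1 + R) ^ (n + 1) + C₂, by positivity, fun s hs v v' hv hv' hvv => ?_⟩
  have hs0 : 0 < s := by linarith [hs.1]
  have hpos : 0 < (1 + ‖v'‖) ^ (n + 1) := by positivity
  by_cases hb : ‖v'‖ ≤ R
  · have h1 : |weightedNorm K s v - weightedNorm K s v'| ≤ 1 := by
      rw [abs_le]
      constructor <;> linarith [weightedNorm_nonneg K s v, weightedNorm_nonneg K s v',
        weightedNorm_le_one K hs0 hv, weightedNorm_le_one K hs0 hv']
    refine h1.trans ?_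
    rw [← div_eq_mul_inv, one_le_div hpos]
    have : (1 + ‖v'‖) ^ (n + 1) ≤ (1 + R) ^ (n + 1) := by gcongr
    linarith
  push Not at hb
  by_cases hz : weightedNorm K s v = 0 ∧ weightedNorm K s v' = 0
  · rw [hz.1, hz.2, sub_zero, abs_zero]
    positivity
  set m := c / 4 * (1 + ‖v'‖) with hm
  have hm0 : 0 < m := by positivity
  have hb1 : 1 < ‖v'‖ := lt_of_le_of_lt (by rw [hR]; linarith [show 0 ≤ 2 * (c + 1) * T / c by positivity]) hb
  have hb2 : 2 * (c + 1) * T < c * ‖v'‖ := by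
    have : 2 * (c + 1) * T / c < ‖v'‖ := by linarith
    rwa [div_lt_iff₀ hc, mul_comm ‖v'‖] at this
  have hplaces : (∀ w, m ≤ normAtPlace w v) ∧ ∀ w, m ≤ normAtPlace w v' := by
    have hcl : ∀ w, |normAtPlace w v - normAtPlace w v'| ≤ T :=
      fun w => (abs_normAtPlace_sub_le w v v').trans hvv
    have hsupp : ∀ x : mixedSpace K, weightedNorm K s x ≠ 0 → ∀ w, c * ‖x‖ ≤ normAtPlace w x := by
      intro x hx
      refine hcv x (fun h => hx (weightedNorm_of_norm_eq_zero K hs0.ne' h)) fun h => hx ?_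
      rw [weightedNorm, h, zero_mul]
    have hmle : m ≤ c * (‖v'‖ - T) - T := by rw [hm]; nlinarith
    have hcT : 0 ≤ c * T := by positivity
    rw [not_and_or] at hz
    rcases hz with h | h
    · have h1 := hsupp v h
      have h2 : ‖v'‖ - T ≤ ‖v‖ := by
        have := norm_sub_norm_le v' v
        rw [norm_sub_rev] at this
        linarith
      have h3 : c * (‖v'‖ - T) ≤ c * ‖v‖ := by gcongr
      exact ⟨fun w => by linarith [h1 w],
        fun w => by linarith [h1 w, (abs_le.mp (hcl w)).2]⟩
    · have h1 := hsupp v' h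
      exact ⟨fun w => by nlinarith [h1 w, (abs_le.mp (hcl w)).1], fun w => by nlinarith [h1 w]⟩
  obtain ⟨hp, hp'⟩ := hplaces
  have hN := norm_ne_zero_of_le_normAtPlace hm0 hp
  have hN' := norm_ne_zero_of_le_normAtPlace hm0 hp'
  have hNm := pow_le_norm_of_le_normAtPlace hm0 hp
  have hNm' := pow_le_norm_of_le_normAtPlace hm0 hp'
  replace hv := hv.resolve_left hN
  replace hv' := hv'.resolve_left hN'
  have hle : ∀ x : mixedSpace K, 1 ≤ mixedEmbedding.norm x → m ^ n ≤ mixedEmbedding.norm x →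
      n * Real.log m ≤ s * Real.log (mixedEmbedding.norm x) := by
    intro x hx hxm
    have h1 : n * Real.log m ≤ Real.log (mixedEmbedding.norm x) := by
      rw [← Real.log_pow]
      exact Real.log_le_log (by positivity) hxm
    have h2 := Real.log_nonneg hx
    nlinarith [hs.1]
  have hexp : ∀ x : mixedSpace K, mixedEmbedding.norm x ≠ 0 →
      mixedEmbedding.norm x ^ (-s) = Real.exp (-(s * Real.log (mixedEmbedding.norm x))) := by
    intro x hx
    rw [Real.rpow_def_of_pos ((mixedEmbedding.norm_nonneg x).lt_of_ne' hx)]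
    ring_nf
  have hmn : Real.exp (-(n * Real.log m)) = (m ^ n)⁻¹ := by
    rw [Real.exp_neg, ← Real.log_pow, Real.exp_log (by positivity)]
  have hrp := abs_exp_neg_sub_exp_neg_le (hle v hv hNm) (hle v' hv' hNm')
  rw [← hexp v hN, ← hexp v' hN', hmn, ← mul_sub, abs_mul, abs_of_pos hs0] at hrp
  have hlog := abs_log_norm_sub_log_norm_le hm0 hp hp'
  have hwt := (hAy (logMap v) (logMap v')).trans
    (mul_le_mul_of_nonneg_left (norm_logMap_sub_logMap_le hm0 hp hp') hA)
  have hNs : mixedEmbedding.norm v ^ (-s) ≤ (m ^ n)⁻¹ := by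
    rw [hexp v hN, ← hmn]
    exact Real.exp_le_exp.mpr (neg_le_neg (hle v hv hNm))
  have hdecomp : weightedNorm K s v - weightedNorm K s v' =
      (tentWeight K (logMap v) - tentWeight K (logMap v')) * mixedEmbedding.norm v ^ (-s) +
      tentWeight K (logMap v') * (mixedEmbedding.norm v ^ (-s) - mixedEmbedding.norm v' ^ (-s)) := by
    unfold weightedNorm; ring
  rw [hdecomp]
  calc _ ≤ (A * (4 * (T / m))) * (m ^ n)⁻¹ + 1 * ((m ^ n)⁻¹ * (2 * (n * (T / m)))) := by
        refine (abs_add_le _ _).trans ?_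
        rw [abs_mul, abs_mul, abs_of_nonneg (tentWeight_nonneg K _),
          abs_of_nonneg (Real.rpow_nonneg (mixedEmbedding.norm_nonneg v) _)]
        refine add_le_add (mul_le_mul (hwt.trans (by gcongr)) hNs
          (Real.rpow_nonneg (mixedEmbedding.norm_nonneg v) _) (by positivity))
          (mul_le_mul (tentWeight_le_one K _) (hrp.trans ?_) (abs_nonneg _) zero_le_one)
        have h2 := hs.2
        have : |Real.log (mixedEmbedding.norm v) - Real.log (mixedEmbedding.norm v')| ≤
            n * (T / m) := hlog.trans (by gcongr)
        gcongr
    _ = C₂ * ((1 + ‖v'‖) ^ (n + 1))⁻¹ := by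
        have h1 : (4 / c) ^ (n + 1) * ((1 + ‖v'‖) ^ (n + 1))⁻¹ = (m ^ n)⁻¹ * m⁻¹ := by
          rw [← mul_inv, ← pow_succ, hm, mul_pow, mul_inv, ← inv_pow (c / 4), inv_div]
        rw [hC₂, mul_assoc (4 * A * T + 2 * n * T), h1]
        ring
    _ ≤ _ := by
        gcongr
        linarith [show 0 ≤ (1 + R) ^ (n + 1) by positivity]

end NumberField.mixedEmbedding
end

noncomputable section
namespace NumberField.mixedEmbedding

open NumberField.Units dirichletUnitTheorem InfinitePlace Module
open scoped Classical nonZeroDivisors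

variable (K : Type*) [Field K] [NumberField K]

theorem summable_norm_rpow_integers (r : ℝ) (hr : r < -finrank ℚ K) :
    Summable fun α : 𝓞 K => ‖mixedEmbedding K α‖ ^ r := by
  have h1 : Summable fun z : mixedEmbedding.integerLattice K => ‖(z : mixedSpace K)‖ ^ r :=
    ZLattice.summable_norm_rpow (mixedEmbedding.integerLattice K) r (by
      rw [ZLattice.rank ℝ, mixedEmbedding.finrank]
      exact hr)
  let f : 𝓞 K → mixedEmbedding.integerLattice K := fun α => ⟨mixedEmbedding K α, α, rfl⟩
  have hf : Function.Injective f := fun α β h =>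
    RingOfIntegers.coe_injective (mixedEmbedding_injective K (congrArg Subtype.val h))
  have h2 := h1.comp_injective hf
  exact h2

theorem summable_one_add_norm_pow_inv :
    Summable fun α : 𝓞 K => ((1 + ‖mixedEmbedding K α‖) ^ (finrank ℚ K + 1))⁻¹ := by
  have h1 := summable_norm_rpow_integers K (-((finrank ℚ K + 1 : ℕ) : ℝ)) (by push_cast; linarith)
  have h2 : Summable fun α : 𝓞 K => if α = 0 then (1 : ℝ) else 0 :=
    summable_of_ne_finset_zero (s := {0}) (by simp)
  refine Summable.of_nonneg_of_le (fun _ => by positivity) (fun α => ?_) (h1.add h2)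
  by_cases h : α = 0
  · simp [h, Real.zero_rpow (show -1 + -(finrank ℚ K : ℝ) ≠ 0 by
      have : (0 : ℝ) ≤ finrank ℚ K := Nat.cast_nonneg _
      linarith)]
  · rw [if_neg h, add_zero, Real.rpow_neg (norm_nonneg _), Real.rpow_natCast]
    have : 0 < ‖mixedEmbedding K (α : K)‖ := by
      rw [norm_pos_iff]
      exact fun h' => h (RingOfIntegers.coe_injective
        (mixedEmbedding_injective K (by rw [h', map_zero, map_zero])))
    gcongr
    linarith

theorem norm_mixedEmbedding_eq_absNorm (α : 𝓞 K) :
    mixedEmbedding.norm (mixedEmbedding K α) = Ideal.absNorm (Ideal.span {α}) := by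
  rw [norm_eq_norm, Ideal.absNorm_span_singleton, ← Algebra.coe_norm_int, Nat.cast_natAbs]
  simp

theorem norm_mixedEmbedding_eq_zero_or (α : 𝓞 K) :
    mixedEmbedding.norm (mixedEmbedding K α) = 0 ∨
      1 ≤ mixedEmbedding.norm (mixedEmbedding K α) := by
  rw [norm_mixedEmbedding_eq_absNorm, Nat.cast_eq_zero, Nat.one_le_cast]
  omega

/-- `weightedNorm` on algebraic integers. -/
def integerWeight (s : ℝ) (α : 𝓞 K) : ℝ := weightedNorm K s (mixedEmbedding K α)

theorem integerWeight_zero {s : ℝ} (hs : s ≠ 0) : integerWeight K s 0 = 0 :=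
  weightedNorm_of_norm_eq_zero K hs (by simp)

theorem summable_integerWeight {s : ℝ} (hs : 1 < s) : Summable (integerWeight K s) := by
  obtain ⟨c, hc, h⟩ := exists_weightedNorm_le_norm_rpow K
  refine Summable.of_nonneg_of_le (fun _ => weightedNorm_nonneg _ _ _)
    (fun α => h s (by linarith) _) (Summable.mul_left _ (summable_norm_rpow_integers K _ ?_))
  have : (0 : ℝ) < finrank ℚ K := Nat.cast_pos.mpr finrank_pos
  nlinarith

theorem hasSum_integerWeight_associated {s : ℝ} {α : 𝓞 K} (hα : α ≠ 0) :
    HasSum (fun β : (fun β : 𝓞 K => Ideal.span {β}) ⁻¹' {Ideal.span {α}} => integerWeight K s β)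
      (torsionOrder K * (Ideal.absNorm (Ideal.span {α}) : ℝ) ^ (-s)) := by
  let φ : (𝓞 K)ˣ → (fun β : 𝓞 K => Ideal.span {β}) ⁻¹' {Ideal.span {α}} := fun u =>
    ⟨u * α, by
      simp only [Set.mem_preimage, Set.mem_singleton_iff, Ideal.span_singleton_eq_span_singleton]
      exact associated_unit_mul_left _ _ u.isUnit⟩
  have hφ : Function.Bijective φ := by
    refine ⟨fun u v h => Units.ext (mul_right_cancel₀ hα (congrArg Subtype.val h)), ?_⟩
    rintro ⟨β, hβ⟩
    simp only [Set.mem_preimage, Set.mem_singleton_iff,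
      Ideal.span_singleton_eq_span_singleton] at hβ
    obtain ⟨u, hu⟩ := hβ.symm
    exact ⟨u, Subtype.ext ((mul_comm _ _).trans hu)⟩
  have hN : mixedEmbedding.norm (mixedEmbedding K α) ≠ 0 := by
    rw [norm_mixedEmbedding_eq_absNorm]
    simpa [Ideal.absNorm_eq_zero_iff] using hα
  rw [← (Equiv.ofBijective φ hφ).hasSum_iff]
  refine ((hasSum_tentWeight_logEmbedding_add K (logMap (mixedEmbedding K α))).mul_right
    ((Ideal.absNorm (Ideal.span {α}) : ℝ) ^ (-s))).congr_fun fun u => ?_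
  have h1 : mixedEmbedding K ((u * α : 𝓞 K) : K) = u • mixedEmbedding K (α : K) :=
    (unit_smul_eq_iff_mul_eq.mpr rfl).symm
  change weightedNorm K s (mixedEmbedding K ((u * α : 𝓞 K) : K)) = _
  rw [h1, weightedNorm, norm_unit_smul, logMap_unit_smul u hN, norm_mixedEmbedding_eq_absNorm]

theorem hasSum_absNorm_rpow_of_mk0_eq {s : ℝ} (hs : 1 < s) (J : (Ideal (𝓞 K))⁰) :
    HasSum (fun I : (Ideal (𝓞 K))⁰ => if ClassGroup.mk0 I = (ClassGroup.mk0 J)⁻¹ then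
        (Ideal.absNorm (I : Ideal (𝓞 K)) : ℝ) ^ (-s) else 0)
      ((Ideal.absNorm (J : Ideal (𝓞 K)) : ℝ) ^ s / torsionOrder K *
        ∑' α : (J : Ideal (𝓞 K)), integerWeight K s α) := by
  have hJ0 : (J : Ideal (𝓞 K)) ≠ 0 := nonZeroDivisors.ne_zero J.2
  have hsum := (summable_integerWeight K hs).indicator ((J : Ideal (𝓞 K)) : Set (𝓞 K))
  have h1 := hsum.hasSum.tsum_fiberwise fun β : 𝓞 K => Ideal.span {β}
  have hinj : Function.Injective fun I : (Ideal (𝓞 K))⁰ => (I * J : Ideal (𝓞 K)) :=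
    fun I I' h => Subtype.ext (mul_right_cancel₀ hJ0 h)
  rw [← hinj.hasSum_iff] at h1
  · have hJN : (0 : ℝ) < Ideal.absNorm (J : Ideal (𝓞 K)) := by
      rw [Nat.cast_pos, Nat.pos_iff_ne_zero]
      simpa [Ideal.absNorm_eq_zero_iff] using hJ0
    have hW : (torsionOrder K : ℝ) ≠ 0 := Nat.cast_ne_zero.mpr (torsionOrder_ne_zero K)
    rw [← tsum_subtype] at h1
    refine (h1.mul_left _).congr_fun fun I => ?_
    have hI0 : (I : Ideal (𝓞 K)) ≠ 0 := nonZeroDivisors.ne_zero I.2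
    simp only [Function.comp]
    split_ifs with hc
    · rw [eq_inv_iff_mul_eq_one, ← map_mul, ClassGroup.mk0_eq_one_iff] at hc
      obtain ⟨α, hα⟩ := hc
      replace hα : (I * J : Ideal (𝓞 K)) = Ideal.span {α} := hα
      have hα0 : α ≠ 0 := by
        rintro rfl
        rw [Ideal.span_singleton_eq_bot.mpr rfl] at hα
        exact mul_ne_zero hI0 hJ0 hα
      have hind : ∀ β : (fun β : 𝓞 K => Ideal.span {β}) ⁻¹' {Ideal.span {α}},
          ((J : Ideal (𝓞 K)) : Set (𝓞 K)).indicator (integerWeight K s) β =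
            integerWeight K s β := by
        rintro ⟨β, hβ⟩
        refine Set.indicator_of_mem ?_ _
        have : Ideal.span {β} ≤ J := by
          rw [show Ideal.span {β} = Ideal.span {α} from hβ, ← hα]
          exact Ideal.le_of_dvd (dvd_mul_left _ _)
        exact this (Ideal.mem_span_singleton_self β)
      rw [hα]
      simp_rw [hind]
      rw [(hasSum_integerWeight_associated K hα0).tsum_eq, ← hα, map_mul, Nat.cast_mul,
        Real.mul_rpow (Nat.cast_nonneg _) hJN.le, Real.rpow_neg hJN.le]
      have := (Real.rpow_pos_of_pos hJN s).ne'
      field_simp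
    · have : IsEmpty ((fun β : 𝓞 K => Ideal.span {β}) ⁻¹' {(I * J : Ideal (𝓞 K))}) := by
        refine ⟨fun β => hc ?_⟩
        rw [eq_inv_iff_mul_eq_one, ← map_mul, ClassGroup.mk0_eq_one_iff]
        exact ⟨β.1, (show Ideal.span {β.1} = (I * J : Ideal (𝓞 K)) from β.2).symm⟩
      rw [tsum_empty, mul_zero]
  · intro c hc
    refine (tsum_congr ?_).trans tsum_zero
    rintro ⟨β, rfl⟩
    by_cases hβ : β ∈ (J : Ideal (𝓞 K))
    · have : β = 0 := by
        by_contra h0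
        apply hc
        obtain ⟨I, hI⟩ := Ideal.dvd_span_singleton.mpr hβ
        refine ⟨⟨I, mem_nonZeroDivisors_iff_ne_zero.mpr ?_⟩, ?_⟩
        · rintro rfl
          exact h0 (by simpa using hI)
        · simp only
          rw [hI, mul_comm]
      rw [this]
      simp [Set.indicator, integerWeight_zero K (by linarith : s ≠ 0)]
    · exact Set.indicator_of_notMem hβ _

theorem exists_abs_tsum_integerWeight_sub_le (J : Ideal (𝓞 K)) (hJ : J ≠ ⊥) :
    ∃ C : ℝ, ∀ s ∈ Set.Ioc (1 : ℝ) 2,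
      |∑' α : 𝓞 K, integerWeight K s α - Ideal.absNorm J * ∑' α : J, integerWeight K s α| ≤ C := by
  have hfin : Finite (𝓞 K ⧸ J) := Ideal.finiteQuotientOfFreeOfNeBot J hJ
  have := Fintype.ofFinite (𝓞 K ⧸ J)
  let r : 𝓞 K ⧸ J → 𝓞 K := fun q => q.out
  have hr : ∀ q, Ideal.Quotient.mk J (r q) = q := fun q => Ideal.Quotient.mk_out q
  let φ : (𝓞 K ⧸ J) × J → 𝓞 K := fun p => r p.1 + p.2
  have hφ : Function.Bijective φ := by
    constructor
    · rintro ⟨q, j⟩ ⟨q', j'⟩ h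
      have h' : r q + j = r q' + j' := h
      have h1 : q = q' := by
        have := congrArg (Ideal.Quotient.mk J) h'
        rwa [map_add, map_add, hr, hr, Ideal.Quotient.eq_zero_iff_mem.mpr j.2,
          Ideal.Quotient.eq_zero_iff_mem.mpr j'.2, add_zero, add_zero] at this
      subst h1
      rw [Subtype.ext (add_left_cancel h')]
    · intro α
      refine ⟨⟨Ideal.Quotient.mk J α, α - r (Ideal.Quotient.mk J α), ?_⟩, ?_⟩
      · rw [← Ideal.Quotient.eq, hr]
      · simp [φ]
  obtain ⟨C, hC, hCs⟩ := exists_abs_weightedNorm_sub_le K (∑ q, ‖mixedEmbedding K (r q : K)‖)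
    (Finset.sum_nonneg fun _ _ => norm_nonneg _)
  have hh : Summable fun j : J => C * ((1 + ‖mixedEmbedding K ((j : 𝓞 K) : K)‖) ^
      (finrank ℚ K + 1))⁻¹ :=
    ((summable_one_add_norm_pow_inv K).comp_injective Subtype.val_injective).mul_left C
  refine ⟨∑ _q : 𝓞 K ⧸ J, ∑' j : J, C * ((1 + ‖mixedEmbedding K ((j : 𝓞 K) : K)‖) ^
      (finrank ℚ K + 1))⁻¹, fun s hs => ?_⟩
  have hw := summable_integerWeight K hs.1
  have hwφ : Summable fun p => integerWeight K s (φ p) := hw.comp_injective hφ.1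
  have hwJ : Summable fun j : J => integerWeight K s j := hw.comp_injective Subtype.val_injective
  have h1 : ∑' α : 𝓞 K, integerWeight K s α =
      ∑ q : 𝓞 K ⧸ J, ∑' j : J, integerWeight K s (r q + j) := by
    rw [← (Equiv.ofBijective φ hφ).tsum_eq (integerWeight K s), ← tsum_fintype (L := .unconditional _)]
    exact hwφ.tsum_prod
  have h2 : Ideal.absNorm J * ∑' α : J, integerWeight K s α =
      ∑ _q : 𝓞 K ⧸ J, ∑' j : J, integerWeight K s j := by
    rw [Finset.sum_const, nsmul_eq_mul, Ideal.absNorm_apply, Submodule.cardQuot_apply,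
      Finset.card_univ, Nat.card_eq_fintype_card]
  rw [h1, h2, ← Finset.sum_sub_distrib]
  refine (Finset.abs_sum_le_sum_abs _ _).trans (Finset.sum_le_sum fun q _ => ?_)
  have hq : Summable fun j : J => integerWeight K s (r q + j) :=
    hwφ.comp_injective (i := fun j => (q, j)) fun _ _ h => (Prod.ext_iff.mp h).2
  rw [← hq.tsum_sub hwJ, ← Real.norm_eq_abs]
  refine tsum_of_norm_bounded hh.hasSum fun j => ?_
  rw [Real.norm_eq_abs]
  refine hCs s ⟨hs.1.le, hs.2⟩ _ _ (norm_mixedEmbedding_eq_zero_or K _)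
    (norm_mixedEmbedding_eq_zero_or K _) ?_
  rw [← map_sub, show ((r q + j : 𝓞 K) : K) - ((j : 𝓞 K) : K) = (r q : K) by simp]
  exact Finset.single_le_sum (f := fun q => ‖mixedEmbedding K (r q : K)‖)
    (fun _ _ => norm_nonneg _) (Finset.mem_univ q)

end NumberField.mixedEmbedding
end

noncomputable section
namespace NumberField

open Filter Topology
open scoped Classical nonZeroDivisors

variable (K : Type*) [Field K] [NumberField K]

theorem summable_absNorm_rpow {s : ℝ} (hs : 1 < s) :
    Summable fun I : (Ideal (𝓞 K))⁰ => (Ideal.absNorm (I : Ideal (𝓞 K)) : ℝ) ^ (-s) := by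
  have h : ∀ c : ClassGroup (𝓞 K), Summable fun I : (Ideal (𝓞 K))⁰ =>
      if ClassGroup.mk0 I = c then (Ideal.absNorm (I : Ideal (𝓞 K)) : ℝ) ^ (-s) else 0 := by
    intro c
    obtain ⟨J, hJ⟩ := ClassGroup.mk0_surjective c⁻¹
    have := (mixedEmbedding.hasSum_absNorm_rpow_of_mk0_eq K hs J).summable
    rwa [hJ, inv_inv] at this
  have h1 := summable_sum (s := Finset.univ) fun c _ => h c
  refine h1.congr fun I => ?_
  simp

/-- The zeta function of an ideal class. -/
def classZeta (s : ℝ) (c : ClassGroup (𝓞 K)) : ℝ :=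
  ∑' I : (Ideal (𝓞 K))⁰,
    if ClassGroup.mk0 I = c then (Ideal.absNorm (I : Ideal (𝓞 K)) : ℝ) ^ (-s) else 0

/-- The Dedekind zeta function on the real axis, as a sum over ideals. -/
def idealZeta (s : ℝ) : ℝ :=
  ∑' I : (Ideal (𝓞 K))⁰, (Ideal.absNorm (I : Ideal (𝓞 K)) : ℝ) ^ (-s)

theorem classZeta_nonneg (s : ℝ) (c : ClassGroup (𝓞 K)) : 0 ≤ classZeta K s c :=
  tsum_nonneg fun I => by split_ifs <;> positivity

theorem summable_classZeta {s : ℝ} (hs : 1 < s) (c : ClassGroup (𝓞 K)) :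
    Summable fun I : (Ideal (𝓞 K))⁰ =>
      if ClassGroup.mk0 I = c then (Ideal.absNorm (I : Ideal (𝓞 K)) : ℝ) ^ (-s) else 0 :=
  (summable_absNorm_rpow K hs).of_nonneg_of_le (fun I => by split_ifs <;> positivity)
    fun I => by split_ifs <;> first | exact le_rfl | positivity

theorem classZeta_le_idealZeta {s : ℝ} (hs : 1 < s) (c : ClassGroup (𝓞 K)) :
    classZeta K s c ≤ idealZeta K s :=
  (summable_classZeta K hs c).tsum_le_tsum
    (fun I => by split_ifs <;> first | exact le_rfl | positivity) (summable_absNorm_rpow K hs)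

theorem absNorm_pos (I : (Ideal (𝓞 K))⁰) : 0 < Ideal.absNorm (I : Ideal (𝓞 K)) := by
  rw [Nat.pos_iff_ne_zero]
  simpa [Ideal.absNorm_eq_zero_iff] using nonZeroDivisors.ne_zero I.2

theorem dedekindZeta_eq_idealZeta {s : ℝ} (hs : 1 < s) :
    dedekindZeta K s = (idealZeta K s : ℂ) := by
  have h1 := (summable_absNorm_rpow K hs).hasSum.tsum_fiberwise
    fun I : (Ideal (𝓞 K))⁰ => Ideal.absNorm (I : Ideal (𝓞 K))
  rw [idealZeta, ← h1.tsum_eq, Complex.ofReal_tsum, dedekindZeta, LSeries]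
  refine tsum_congr fun n => ?_
  rcases Nat.eq_zero_or_pos n with rfl | hn
  · have : IsEmpty ((fun I : (Ideal (𝓞 K))⁰ => Ideal.absNorm (I : Ideal (𝓞 K))) ⁻¹' {0}) :=
      ⟨fun I => (absNorm_pos K I.1).ne' I.2⟩
    rw [tsum_empty, LSeries.term_zero, Complex.ofReal_zero]
  · have h2 : ∀ I : ((fun I : (Ideal (𝓞 K))⁰ => Ideal.absNorm (I : Ideal (𝓞 K))) ⁻¹' {n}),
        (Ideal.absNorm ((I : (Ideal (𝓞 K))⁰) : Ideal (𝓞 K)) : ℝ) ^ (-s) = (n : ℝ) ^ (-s) :=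
      fun I => by rw [show Ideal.absNorm ((I : (Ideal (𝓞 K))⁰) : Ideal (𝓞 K)) = n from I.2]
    have h3 : Nat.card ((fun I : (Ideal (𝓞 K))⁰ => Ideal.absNorm (I : Ideal (𝓞 K))) ⁻¹' {n}) =
        Nat.card {I : Ideal (𝓞 K) // Ideal.absNorm I = n} := by
      refine Nat.card_congr ⟨fun I => ⟨I.1, I.2⟩, fun I => ⟨⟨I.1, ?_⟩, I.2⟩, fun _ => rfl,
        fun _ => rfl⟩
      rw [mem_nonZeroDivisors_iff_ne_zero]
      intro h
      have := I.2
      rw [h] at this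
      simp at this
      omega
    simp_rw [h2]
    rw [tsum_const, h3, LSeries.term_of_ne_zero hn.ne', nsmul_eq_mul, Complex.ofReal_mul,
      Complex.ofReal_natCast, Complex.ofReal_cpow (Nat.cast_nonneg _), Complex.ofReal_neg,
      Complex.cpow_neg, div_eq_mul_inv, Complex.ofReal_natCast]

theorem tendsto_sub_one_mul_idealZeta :
    Tendsto (fun s : ℝ => (s - 1) * idealZeta K s) (𝓝[>] 1) (𝓝 (dedekindZeta_residue K)) := by
  have h := (Complex.continuous_re.tendsto _).comp (tendsto_sub_one_mul_dedekindZeta_nhdsGT K)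
  refine (h.congr' ?_)
  filter_upwards [self_mem_nhdsWithin] with s hs
  simp only [Function.comp]
  rw [dedekindZeta_eq_idealZeta K hs, ← Complex.ofReal_one, ← Complex.ofReal_sub,
    ← Complex.ofReal_mul, Complex.ofReal_re]

theorem exists_abs_classZeta_sub_le (c : ClassGroup (𝓞 K)) :
    ∃ M, ∀ᶠ s in 𝓝[>] (1 : ℝ), |classZeta K s c - classZeta K s 1| ≤ M := by
  obtain ⟨J, hJ⟩ := ClassGroup.mk0_surjective c⁻¹
  obtain ⟨B, hB⟩ := mixedEmbedding.exists_abs_tsum_integerWeight_sub_le K J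
    (nonZeroDivisors.ne_zero J.2)
  set ν : ℝ := ((Ideal.absNorm (J : Ideal (𝓞 K)) : ℕ) : ℝ) with hν
  have hν1 : 1 ≤ ν := Nat.one_le_cast.mpr (absNorm_pos K J)
  set w : ℝ := (Units.torsionOrder K : ℝ) with hw
  have hw0 : 0 < w := Nat.cast_pos.mpr (Units.torsionOrder_pos K)
  have hlim := (tendsto_sub_one_mul_idealZeta K).eventually
    (gt_mem_nhds (lt_add_one (dedekindZeta_residue K)))
  refine ⟨w⁻¹ * B + Real.log ν * (dedekindZeta_residue K + 1), ?_⟩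
  filter_upwards [self_mem_nhdsWithin, Ioc_mem_nhdsGT (show (1 : ℝ) < 2 by norm_num), hlim]
    with s hs1 hs2 hs3
  have hs1 : 1 < s := hs1
  have e1 : classZeta K s c = ν ^ s / w *
      ∑' α : (J : Ideal (𝓞 K)), mixedEmbedding.integerWeight K s α := by
    have := (mixedEmbedding.hasSum_absNorm_rpow_of_mk0_eq K hs1 J).tsum_eq
    rwa [hJ, inv_inv] at this
  have e2 : classZeta K s 1 = w⁻¹ * ∑' α : 𝓞 K, mixedEmbedding.integerWeight K s α := by
    have := (mixedEmbedding.hasSum_absNorm_rpow_of_mk0_eq K hs1 1).tsum_eq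
    rw [map_one, inv_one] at this
    rw [classZeta, this]
    simp only [OneMemClass.coe_one, map_one, Nat.cast_one, Real.one_rpow, one_div]
    congr 1
    exact Equiv.tsum_eq (Equiv.subtypeUnivEquiv (p := (· ∈ (1 : Ideal (𝓞 K))))
      (fun x => by rw [Ideal.one_eq_top]; exact Submodule.mem_top)) (mixedEmbedding.integerWeight K s)
  have hB := hB s hs2
  rw [abs_le] at hB ⊢
  have e3 : w⁻¹ * (ν * ∑' α : (J : Ideal (𝓞 K)), mixedEmbedding.integerWeight K s α) =
      ν ^ (1 - s) * classZeta K s c := by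
    rw [e1, Real.rpow_sub (by linarith), Real.rpow_one]
    have := (Real.rpow_pos_of_pos (by linarith : 0 < ν) s).ne'
    field_simp
  have hz := classZeta_nonneg K s c
  have hz2 : (s - 1) * classZeta K s c ≤ dedekindZeta_residue K + 1 :=
    (mul_le_mul_of_nonneg_left (classZeta_le_idealZeta K hs1 c) (by linarith)).trans hs3.le
  have hlog : 0 ≤ Real.log ν := Real.log_nonneg hν1
  have hp1 : ν ^ (1 - s) ≤ 1 := Real.rpow_le_one_of_one_le_of_nonpos hν1 (by linarith)
  have hp2 : 1 - (s - 1) * Real.log ν ≤ ν ^ (1 - s) := by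
    rw [Real.rpow_def_of_pos (by linarith)]
    have := Real.add_one_le_exp (Real.log ν * (1 - s))
    linarith
  have hwB := mul_le_mul_of_nonneg_left hB.1 (inv_pos.mpr hw0).le
  have hwB' := mul_le_mul_of_nonneg_left hB.2 (inv_pos.mpr hw0).le
  rw [mul_sub, e3, ← e2] at hwB hwB'
  have hA : (1 - ν ^ (1 - s)) * classZeta K s c ≤ Real.log ν * (dedekindZeta_residue K + 1) :=
    calc _ ≤ ((s - 1) * Real.log ν) * classZeta K s c :=
          mul_le_mul_of_nonneg_right (by linarith) hz
      _ = Real.log ν * ((s - 1) * classZeta K s c) := by ring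
      _ ≤ _ := mul_le_mul_of_nonneg_left hz2 hlog
  have hA' : 0 ≤ (1 - ν ^ (1 - s)) * classZeta K s c := mul_nonneg (by linarith) hz
  constructor <;> nlinarith

end NumberField
end

noncomputable section
namespace NumberField

open Filter Topology IsDedekindDomain
open scoped Classical nonZeroDivisors

variable (K : Type*) [Field K] [NumberField K]

/-- The nonzero ideal underlying a finite prime. -/
def primeIdeal (p : HeightOneSpectrum (𝓞 K)) : (Ideal (𝓞 K))⁰ :=
  ⟨p.asIdeal, mem_nonZeroDivisors_iff_ne_zero.mpr p.ne_bot⟩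

variable {K} in
theorem two_le_absNorm (p : HeightOneSpectrum (𝓞 K)) : 2 ≤ Ideal.absNorm p.asIdeal := by
  have h0 := absNorm_pos K (primeIdeal K p)
  have h1 : Ideal.absNorm p.asIdeal ≠ 1 := by
    rw [Ne, Ideal.absNorm_eq_one_iff]
    exact p.isPrime.ne_top
  change 0 < Ideal.absNorm p.asIdeal at h0
  omega

variable {K} in
/-- The completely multiplicative function `I ↦ χ([I]) N(I)⁻ˢ` on ideals. -/
def idealCharacter (χ : ClassGroup (𝓞 K) →* ℂˣ) (s : ℝ) : Ideal (𝓞 K) →*₀ ℂ where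
  toFun I := if h : I ∈ (Ideal (𝓞 K))⁰ then
    (χ (ClassGroup.mk0 ⟨I, h⟩) : ℂ) * ((Ideal.absNorm I : ℝ) ^ (-s) : ℝ) else 0
  map_zero' := by simp
  map_one' := by
    rw [dif_pos (one_mem _)]
    have : ClassGroup.mk0 (⟨1, one_mem _⟩ : (Ideal (𝓞 K))⁰) = 1 := map_one _
    rw [this]
    simp
  map_mul' I J := by
    by_cases hI : I ∈ (Ideal (𝓞 K))⁰
    · by_cases hJ : J ∈ (Ideal (𝓞 K))⁰
      · rw [dif_pos hI, dif_pos hJ, dif_pos (mul_mem hI hJ)]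
        have : ClassGroup.mk0 (⟨I * J, mul_mem hI hJ⟩ : (Ideal (𝓞 K))⁰) =
            ClassGroup.mk0 ⟨I, hI⟩ * ClassGroup.mk0 ⟨J, hJ⟩ := by rw [← map_mul]; rfl
        rw [this, map_mul, map_mul, Nat.cast_mul, Real.mul_rpow (Nat.cast_nonneg _)
          (Nat.cast_nonneg _)]
        push_cast
        ring
      · rw [dif_neg hJ, mul_zero, dif_neg fun h => hJ (mem_nonZeroDivisors_iff_ne_zero.mpr
          (right_ne_zero_of_mul (nonZeroDivisors.ne_zero h)))]
    · rw [dif_neg hI, zero_mul, dif_neg fun h => hI (mem_nonZeroDivisors_iff_ne_zero.mpr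
        (left_ne_zero_of_mul (nonZeroDivisors.ne_zero h)))]

variable {K} in
theorem idealCharacter_apply (χ : ClassGroup (𝓞 K) →* ℂˣ) (s : ℝ) (I : (Ideal (𝓞 K))⁰) :
    idealCharacter χ s I =
      (χ (ClassGroup.mk0 I) : ℂ) * ((Ideal.absNorm (I : Ideal (𝓞 K)) : ℝ) ^ (-s) : ℝ) :=
  dif_pos I.2

theorem norm_character_apply {G : Type*} [Group G] [Finite G] (χ : G →* ℂˣ) (c : G) :
    ‖(χ c : ℂ)‖ = 1 := by
  have h : (χ c : ℂ) ^ Nat.card G = 1 := by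
    rw [← Units.val_pow_eq_pow_val, ← map_pow, pow_card_eq_one', map_one, Units.val_one]
  exact Complex.norm_eq_one_of_pow_eq_one h Nat.card_pos.ne'

variable {K} in
theorem norm_idealCharacter_apply (χ : ClassGroup (𝓞 K) →* ℂˣ) (s : ℝ) (I : (Ideal (𝓞 K))⁰) :
    ‖idealCharacter χ s I‖ = (Ideal.absNorm (I : Ideal (𝓞 K)) : ℝ) ^ (-s) := by
  rw [idealCharacter_apply, norm_mul, norm_character_apply, one_mul, Complex.norm_real,
    Real.norm_of_nonneg (by positivity)]

variable {K} in
theorem tsum_idealCharacter_comp {E : Type*} [AddCommGroup E] [TopologicalSpace E]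
    (f : Ideal (𝓞 K) → E) (hf : f 0 = 0) :
    ∑' I : Ideal (𝓞 K), f I = ∑' I : (Ideal (𝓞 K))⁰, f I := by
  refine (tsum_subtype_eq_of_support_subset fun I hI => ?_).symm
  rw [SetLike.mem_coe, mem_nonZeroDivisors_iff_ne_zero]
  rintro rfl
  exact hI hf

variable {K} in
theorem summable_norm_idealCharacter (χ : ClassGroup (𝓞 K) →* ℂˣ) {s : ℝ} (hs : 1 < s) :
    Summable fun I => ‖idealCharacter χ s I‖ := by
  have h1 : Summable fun I : (Ideal (𝓞 K))⁰ => ‖idealCharacter χ s I‖ :=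
    (summable_absNorm_rpow K hs).congr fun I => (norm_idealCharacter_apply χ s I).symm
  refine (Function.Injective.summable_iff (g := ((↑) : (Ideal (𝓞 K))⁰ → Ideal (𝓞 K)))
    Subtype.val_injective ?_).mp h1
  intro I hI
  have : I = 0 := by
    by_contra h
    exact hI ⟨⟨I, mem_nonZeroDivisors_iff_ne_zero.mpr h⟩, rfl⟩
  rw [this, map_zero, norm_zero]

theorem primeIdeal_injective : Function.Injective (primeIdeal K) := fun _ _ h =>
  HeightOneSpectrum.ext (congrArg Subtype.val h)

theorem summable_prime_absNorm_rpow {s : ℝ} (hs : 1 < s) :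
    Summable fun p : HeightOneSpectrum (𝓞 K) => (Ideal.absNorm p.asIdeal : ℝ) ^ (-s) := by
  have h := (summable_absNorm_rpow K hs).comp_injective (primeIdeal_injective K)
  exact h

variable {K} in
theorem exists_abs_tsum_re_sub_log_le (χ : ClassGroup (𝓞 K) →* ℂˣ) :
    ∃ M, ∀ s : ℝ, 1 < s → (∑' I, idealCharacter χ s I) ≠ 0 ∧
      |∑' p : HeightOneSpectrum (𝓞 K), (χ (ClassGroup.mk0 (primeIdeal K p)) : ℂ).re *
        (Ideal.absNorm p.asIdeal : ℝ) ^ (-s) - Real.log ‖∑' I, idealCharacter χ s I‖| ≤ M := by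
  refine ⟨∑' p : HeightOneSpectrum (𝓞 K), (Ideal.absNorm p.asIdeal : ℝ) ^ (-2 : ℝ),
    fun s hs => ?_⟩
  have hN : ∀ p : HeightOneSpectrum (𝓞 K),
      ‖idealCharacter χ s p.asIdeal‖ = (Ideal.absNorm p.asIdeal : ℝ) ^ (-s) :=
    fun p => norm_idealCharacter_apply χ s (primeIdeal K p)
  have h2 : ∀ p : HeightOneSpectrum (𝓞 K), (2 : ℝ) ≤ Ideal.absNorm p.asIdeal := fun p =>
    by exact_mod_cast two_le_absNorm p
  have hle : ∀ p : HeightOneSpectrum (𝓞 K), (Ideal.absNorm p.asIdeal : ℝ) ^ (-s) ≤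
      (Ideal.absNorm p.asIdeal : ℝ) ^ (-1 : ℝ) := fun p =>
    Real.rpow_le_rpow_of_exponent_le (by linarith [h2 p]) (by linarith)
  obtain ⟨h3, h4⟩ := Ideal.abs_tsum_re_sub_log_norm_tsum_le (idealCharacter χ s)
    (summable_norm_idealCharacter χ hs) fun p => by
      rw [hN]
      refine (hle p).trans ?_
      rw [Real.rpow_neg_one, one_div]
      exact inv_anti₀ (by norm_num) (h2 p)
  refine ⟨h3, ?_⟩
  have h5 : ∀ p : HeightOneSpectrum (𝓞 K), (χ (ClassGroup.mk0 (primeIdeal K p)) : ℂ).re *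
      (Ideal.absNorm p.asIdeal : ℝ) ^ (-s) = (idealCharacter χ s p.asIdeal).re := fun p => by
    have := idealCharacter_apply χ s (primeIdeal K p)
    change idealCharacter χ s p.asIdeal = _ at this
    rw [this, Complex.re_mul_ofReal]
    rfl
  simp_rw [h5]
  have h6 : ∀ p : HeightOneSpectrum (𝓞 K), ‖idealCharacter χ s p.asIdeal‖ ^ 2 ≤
      (Ideal.absNorm p.asIdeal : ℝ) ^ (-2 : ℝ) := fun p => by
    rw [hN]
    refine (pow_le_pow_left₀ (by positivity) (hle p) 2).trans_eq ?_
    rw [← Real.rpow_mul_natCast (Nat.cast_nonneg _)]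
    norm_num
  have h7 := summable_prime_absNorm_rpow K (s := 2) (by norm_num)
  exact h4.trans ((h7.of_nonneg_of_le (fun _ => by positivity) h6).tsum_le_tsum h6 h7)

variable {K} in
theorem tsum_idealCharacter_eq (χ : ClassGroup (𝓞 K) →* ℂˣ) {s : ℝ} (hs : 1 < s) :
    ∑' I, idealCharacter χ s I = ∑ c, (χ c : ℂ) * (classZeta K s c : ℂ) := by
  rw [tsum_idealCharacter_comp _ (map_zero _)]
  have h := hasSum_sum (s := Finset.univ) fun c (_ : c ∈ Finset.univ) =>
    (Complex.hasSum_ofReal.mpr (summable_classZeta K hs c).hasSum).mul_left (χ c : ℂ)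
  rw [show (∑ c, (χ c : ℂ) * (classZeta K s c : ℂ)) = _ from h.tsum_eq.symm]
  refine tsum_congr fun I => ?_
  rw [idealCharacter_apply, Finset.sum_eq_single (ClassGroup.mk0 I)]
  · rw [if_pos rfl]
  · intro c _ hc
    rw [if_neg (Ne.symm hc), Complex.ofReal_zero, mul_zero]
  · simp

variable {K} in
/-- Boundedness near `1` of the prime sums attached to a nontrivial class group character. -/
theorem exists_tsum_character_re_le {χ : ClassGroup (𝓞 K) →* ℂˣ} (hχ : χ ≠ 1) :
    ∃ M, ∀ᶠ s in 𝓝[>] (1 : ℝ),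
      ∑' p : HeightOneSpectrum (𝓞 K), (χ (ClassGroup.mk0 (primeIdeal K p)) : ℂ).re *
        (Ideal.absNorm p.asIdeal : ℝ) ^ (-s) ≤ M := by
  obtain ⟨M, hM⟩ := exists_abs_tsum_re_sub_log_le χ
  choose B hB using exists_abs_classZeta_sub_le K
  refine ⟨M + Real.log (∑ c, B c), ?_⟩
  filter_upwards [self_mem_nhdsWithin, eventually_all.mpr hB] with s hs hBs
  obtain ⟨h0, h1⟩ := hM s hs
  have h2 : ‖∑' I, idealCharacter χ s I‖ ≤ ∑ c, B c := by
    have h3 : ∑ c, (χ c : ℂ) = 0 := by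
      refine sum_hom_units_eq_zero ((Units.coeHom ℂ).comp χ) fun h => hχ ?_
      ext c
      exact congrArg (fun f : ClassGroup (𝓞 K) →* ℂ => f c) h
    have h4 : ∑' I, idealCharacter χ s I =
        ∑ c, (χ c : ℂ) * ((classZeta K s c - classZeta K s 1 : ℝ) : ℂ) := by
      simp_rw [Complex.ofReal_sub, mul_sub]
      rw [Finset.sum_sub_distrib, ← Finset.sum_mul, h3, zero_mul, sub_zero,
        tsum_idealCharacter_eq χ hs]
    rw [h4]
    refine (norm_sum_le _ _).trans (Finset.sum_le_sum fun c _ => ?_)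
    rw [norm_mul, norm_character_apply, one_mul, Complex.norm_real]
    exact hBs c
  have h5 := Real.log_le_log (norm_pos_iff.mpr h0) h2
  linarith [(abs_le.mp h1).2]

theorem exists_abs_tsum_prime_add_log_le :
    ∃ M, ∀ᶠ s in 𝓝[>] (1 : ℝ),
      |∑' p : HeightOneSpectrum (𝓞 K), (Ideal.absNorm p.asIdeal : ℝ) ^ (-s) +
        Real.log (s - 1)| ≤ M := by
  obtain ⟨M, hM⟩ := exists_abs_tsum_re_sub_log_le (1 : ClassGroup (𝓞 K) →* ℂˣ)
  have h1 := (Real.continuousAt_log (dedekindZeta_residue_ne_zero K)).tendsto.comp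
    (tendsto_sub_one_mul_idealZeta K)
  have h2 := h1.eventually (Metric.ball_mem_nhds _ one_pos)
  refine ⟨M + 1 + |Real.log (dedekindZeta_residue K)|, ?_⟩
  filter_upwards [self_mem_nhdsWithin, h2] with s hs h3
  obtain ⟨h4, h5⟩ := hM s hs
  have h6 : ∑' I, idealCharacter (1 : ClassGroup (𝓞 K) →* ℂˣ) s I = (idealZeta K s : ℂ) := by
    rw [tsum_idealCharacter_comp _ (map_zero _), idealZeta, Complex.ofReal_tsum]
    refine tsum_congr fun I => ?_
    rw [idealCharacter_apply]
    simp
  have h7 : idealZeta K s ≠ 0 := by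
    intro h
    rw [h6, h] at h4
    simp at h4
  have hs : 1 < s := hs
  simp only [MonoidHom.one_apply, Units.val_one, Complex.one_re, one_mul] at h5
  rw [h6, Complex.norm_real, Real.norm_eq_abs, Real.log_abs] at h5
  simp only [Function.comp, Real.dist_eq] at h3
  rw [Real.log_mul (by linarith) h7] at h3
  have h8 := abs_le.mp h5
  have h9 := abs_le.mp h3.le
  have h10 := le_abs_self (Real.log (dedekindZeta_residue K))
  have h11 := neg_abs_le (Real.log (dedekindZeta_residue K))
  rw [abs_le]
  constructor <;> linarith

variable {K} in
/-- Primes whose class lies in a subgroup `H` of the class group have upper density at most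
`1 / [Cl(K) : H]`, in the sense of Dirichlet. -/
theorem exists_index_mul_tsum_prime_le (H : Subgroup (ClassGroup (𝓞 K))) :
    ∃ M, ∀ᶠ s in 𝓝[>] (1 : ℝ),
      (H.index : ℝ) * ∑' p : HeightOneSpectrum (𝓞 K),
        (if ClassGroup.mk0 (primeIdeal K p) ∈ H then (Ideal.absNorm p.asIdeal : ℝ) ^ (-s) else 0) ≤
        -Real.log (s - 1) + M := by
  let D := (ClassGroup (𝓞 K) ⧸ H) →* ℂˣ
  have hfin : Finite D :=
    Nat.finite_of_card_ne_zero (by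
      rw [CommGroup.card_monoidHom_of_hasEnoughRootsOfUnity]
      exact Nat.card_pos.ne')
  have : Fintype D := Fintype.ofFinite D
  let f : D → (ClassGroup (𝓞 K) →* ℂˣ) := fun χ => χ.comp (QuotientGroup.mk' H)
  have hbd : ∀ χ : D, ∃ M, ∀ᶠ s in 𝓝[>] (1 : ℝ),
      ∑' p : HeightOneSpectrum (𝓞 K), (f χ (ClassGroup.mk0 (primeIdeal K p)) : ℂ).re *
        (Ideal.absNorm p.asIdeal : ℝ) ^ (-s) ≤ (if χ = 1 then -Real.log (s - 1) else 0) + M := by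
    intro χ
    split_ifs with hχ
    · obtain ⟨M, hM⟩ := exists_abs_tsum_prime_add_log_le K
      refine ⟨M, ?_⟩
      filter_upwards [hM] with s hs
      have : ∀ c, ((f χ c : ℂˣ) : ℂ).re = 1 := by simp [f, hχ]
      simp_rw [this, one_mul]
      linarith [(abs_le.mp hs).2]
    · obtain ⟨M, hM⟩ := exists_tsum_character_re_le (χ := f χ) fun h => hχ (by
        refine MonoidHom.ext fun x => ?_
        obtain ⟨c, rfl⟩ := QuotientGroup.mk_surjective x
        exact congrArg (fun g : ClassGroup (𝓞 K) →* ℂˣ => g c) h)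
      refine ⟨M, ?_⟩
      filter_upwards [hM] with s hs
      rwa [zero_add]
  choose M hM using hbd
  refine ⟨∑ χ, M χ, ?_⟩
  filter_upwards [self_mem_nhdsWithin, eventually_all.mpr hM] with s hs hMs
  have hsum : ∀ c, ∑ χ : D, ((f χ c : ℂˣ) : ℂ).re = if c ∈ H then (H.index : ℝ) else 0 := by
    intro c
    rw [← Complex.re_sum]
    let ev : D →* ℂ := (Units.coeHom ℂ).comp (MonoidHom.eval (c : ClassGroup (𝓞 K) ⧸ H))
    have hev : ∑ χ : D, ((f χ c : ℂˣ) : ℂ) = ∑ χ : D, ev χ := rfl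
    rw [hev]
    split_ifs with hc
    · have h1 : ∀ χ, ev χ = 1 := fun χ => by
        change ((χ (c : ClassGroup (𝓞 K) ⧸ H) : ℂˣ) : ℂ) = 1
        rw [(QuotientGroup.eq_one_iff c).mpr hc, map_one, Units.val_one]
      simp_rw [h1]
      rw [Finset.sum_const, nsmul_one, Finset.card_univ, ← Nat.card_eq_fintype_card,
        CommGroup.card_monoidHom_of_hasEnoughRootsOfUnity, Complex.natCast_re]
      rfl
    · rw [sum_hom_units_eq_zero ev, Complex.zero_re]
      intro h
      obtain ⟨χ, hχ⟩ := CommGroup.exists_apply_ne_one_of_hasEnoughRootsOfUnity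
        (ClassGroup (𝓞 K) ⧸ H) ℂ (a := c) (by rwa [Ne, QuotientGroup.eq_one_iff])
      exact hχ (Units.ext (congrArg (fun g : D →* ℂ => g χ) h))
  have hsm : ∀ χ : D, Summable fun p : HeightOneSpectrum (𝓞 K) =>
      (f χ (ClassGroup.mk0 (primeIdeal K p)) : ℂ).re * (Ideal.absNorm p.asIdeal : ℝ) ^ (-s) := by
    intro χ
    refine (summable_prime_absNorm_rpow K hs).of_norm_bounded fun p => ?_
    rw [norm_mul, Real.norm_of_nonneg (by positivity : 0 ≤ (Ideal.absNorm p.asIdeal : ℝ) ^ (-s))]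
    refine mul_le_of_le_one_left (by positivity) ?_
    rw [Real.norm_eq_abs]
    exact (Complex.abs_re_le_norm _).trans (norm_character_apply _ _).le
  rw [← tsum_mul_left]
  have h2 : ∀ p : HeightOneSpectrum (𝓞 K), (H.index : ℝ) *
      (if ClassGroup.mk0 (primeIdeal K p) ∈ H then (Ideal.absNorm p.asIdeal : ℝ) ^ (-s) else 0) =
      ∑ χ : D, (f χ (ClassGroup.mk0 (primeIdeal K p)) : ℂ).re *
        (Ideal.absNorm p.asIdeal : ℝ) ^ (-s) := by
    intro p
    rw [← Finset.sum_mul, hsum]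
    split_ifs <;> simp
  simp_rw [h2]
  rw [Summable.tsum_finsetSum fun χ _ => hsm χ]
  refine (Finset.sum_le_sum fun χ _ => hMs χ).trans_eq ?_
  rw [Finset.sum_add_distrib, Finset.sum_ite_eq' Finset.univ (1 : D), if_pos (Finset.mem_univ _)]

end NumberField
end

noncomputable section
namespace NumberField

open Filter Topology IsDedekindDomain
open scoped Classical nonZeroDivisors

variable (k L : Type*) [Field k] [NumberField k] [Field L] [NumberField L] [Algebra k L]

theorem card_primesOver_le (p : Ideal (𝓞 k)) [p.IsMaximal] :
    Nat.card (p.primesOver (𝓞 L)) ≤ Module.finrank (𝓞 k) (𝓞 L) := by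
  rw [← Ideal.sum_ramification_inertia_eq_finrank p (𝓞 L), Nat.card_eq_fintype_card,
    ← Finset.card_univ, Finset.card_eq_sum_ones]
  refine Finset.sum_le_sum fun q _ => ?_
  have := q.2.1
  exact Nat.mul_pos (Ideal.ramificationIdx_pos q.1 _) (Ideal.inertiaDeg_pos q.1 _)

variable {k L} in
theorem absNorm_rpow_le {H : Subgroup (ClassGroup (𝓞 k))}
    (hH : ∀ (J : (Ideal (𝓞 L))⁰) (I : (Ideal (𝓞 k))⁰),
      Ideal.relNorm (𝓞 k) (J : Ideal (𝓞 L)) = I → ClassGroup.mk0 I ∈ H)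
    (P : HeightOneSpectrum (𝓞 L)) {s : ℝ} (hs : 1 < s) :
    (Ideal.absNorm P.asIdeal : ℝ) ^ (-s) ≤
      (if ClassGroup.mk0 (primeIdeal k (P.under (𝓞 k))) ∈ H then
        (Ideal.absNorm (P.under (𝓞 k)).asIdeal : ℝ) ^ (-s) else 0) +
      (Ideal.absNorm (P.under (𝓞 k)).asIdeal : ℝ) ^ (-2 : ℝ) := by
  set p := P.under (𝓞 k) with hp
  have : P.asIdeal.LiesOver p.asIdeal := ⟨rfl⟩
  have : P.asIdeal.IsMaximal := P.isMaximal
  have : p.asIdeal.IsMaximal := p.isMaximal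
  have h1 := Ideal.relNorm_eq_pow_of_isMaximal P.asIdeal p.asIdeal
  have h2 : Ideal.absNorm P.asIdeal = Ideal.absNorm p.asIdeal ^ P.asIdeal.inertiaDeg (𝓞 k) := by
    rw [← Ideal.absNorm_relNorm (𝓞 k), h1, map_pow]
  have h3 := Ideal.inertiaDeg_pos P.asIdeal (𝓞 k)
  have h4 : (2 : ℝ) ≤ Ideal.absNorm p.asIdeal := by exact_mod_cast two_le_absNorm p
  have h5 : 0 ≤ (Ideal.absNorm p.asIdeal : ℝ) ^ (-2 : ℝ) := by positivity
  rcases (show P.asIdeal.inertiaDeg (𝓞 k) = 1 ∨ 2 ≤ P.asIdeal.inertiaDeg (𝓞 k) by omega) with hf | hf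
  · rw [if_pos (hH (primeIdeal L P) _ (by rw [hf, pow_one] at h1; exact h1)), h2, hf, pow_one]
    linarith
  · have h6 : (Ideal.absNorm P.asIdeal : ℝ) ^ (-s) ≤ (Ideal.absNorm p.asIdeal : ℝ) ^ (-2 : ℝ) := by
      rw [h2, Nat.cast_pow, ← Real.rpow_natCast, ← Real.rpow_mul (by linarith)]
      refine Real.rpow_le_rpow_of_exponent_le (by linarith) ?_
      have : (2 : ℝ) ≤ P.asIdeal.inertiaDeg (𝓞 k) := by exact_mod_cast hf
      nlinarith
    split_ifs
    · have : 0 ≤ (Ideal.absNorm p.asIdeal : ℝ) ^ (-s) := by positivity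
      linarith
    · linarith

variable {k L} in
theorem tsum_prime_absNorm_le {H : Subgroup (ClassGroup (𝓞 k))}
    (hH : ∀ (J : (Ideal (𝓞 L))⁰) (I : (Ideal (𝓞 k))⁰),
      Ideal.relNorm (𝓞 k) (J : Ideal (𝓞 L)) = I → ClassGroup.mk0 I ∈ H) {s : ℝ} (hs : 1 < s) :
    ∑' P : HeightOneSpectrum (𝓞 L), (Ideal.absNorm P.asIdeal : ℝ) ^ (-s) ≤
      Module.finrank (𝓞 k) (𝓞 L) * (∑' p : HeightOneSpectrum (𝓞 k),
        (if ClassGroup.mk0 (primeIdeal k p) ∈ H then (Ideal.absNorm p.asIdeal : ℝ) ^ (-s) else 0) +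
        ∑' p : HeightOneSpectrum (𝓞 k), (Ideal.absNorm p.asIdeal : ℝ) ^ (-2 : ℝ)) := by
  have hsk := summable_prime_absNorm_rpow k hs
  have h1 : Summable fun p : HeightOneSpectrum (𝓞 k) =>
      if ClassGroup.mk0 (primeIdeal k p) ∈ H then (Ideal.absNorm p.asIdeal : ℝ) ^ (-s) else 0 :=
    hsk.of_nonneg_of_le (fun p => by split_ifs <;> positivity)
      fun p => by split_ifs <;> first | exact le_rfl | positivity
  have h2 := summable_prime_absNorm_rpow k (s := 2) (by norm_num)
  have h3 := (summable_prime_absNorm_rpow L hs).hasSum.tsum_fiberwise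
    fun P : HeightOneSpectrum (𝓞 L) => P.under (𝓞 k)
  rw [← h3.tsum_eq, ← h1.tsum_add h2, ← tsum_mul_left]
  refine h3.summable.tsum_le_tsum (fun p => ?_) ((h1.add h2).mul_left _)
  have : p.asIdeal.IsMaximal := p.isMaximal
  let ι : ((fun P : HeightOneSpectrum (𝓞 L) => P.under (𝓞 k)) ⁻¹' {p}) →
      p.asIdeal.primesOver (𝓞 L) := fun P =>
    ⟨P.1.asIdeal, P.1.isPrime, ⟨(congrArg HeightOneSpectrum.asIdeal P.2).symm⟩⟩
  have hι : Function.Injective ι := fun P Q h =>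
    Subtype.ext (HeightOneSpectrum.ext (congrArg Subtype.val h))
  have hfin : Finite ((fun P : HeightOneSpectrum (𝓞 L) => P.under (𝓞 k)) ⁻¹' {p}) :=
    Finite.of_injective ι hι
  have := Fintype.ofFinite ((fun P : HeightOneSpectrum (𝓞 L) => P.under (𝓞 k)) ⁻¹' {p})
  have hcard : Fintype.card ((fun P : HeightOneSpectrum (𝓞 L) => P.under (𝓞 k)) ⁻¹' {p}) ≤
      Module.finrank (𝓞 k) (𝓞 L) := by
    rw [← Nat.card_eq_fintype_card]
    exact (Nat.card_le_card_of_injective ι hι).trans (card_primesOver_le k L p.asIdeal)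
  rw [tsum_fintype]
  refine (Finset.sum_le_card_nsmul _ _ ((if ClassGroup.mk0 (primeIdeal k p) ∈ H then
    (Ideal.absNorm p.asIdeal : ℝ) ^ (-s) else 0) + (Ideal.absNorm p.asIdeal : ℝ) ^ (-2 : ℝ))
    fun P _ => ?_).trans ?_
  · have hP : P.1.under (𝓞 k) = p := P.2
    have := absNorm_rpow_le hH P.1 hs
    rwa [hP] at this
  · rw [nsmul_eq_mul, Finset.card_univ]
    refine mul_le_mul_of_nonneg_right (Nat.cast_le.mpr hcard) ?_
    split_ifs <;> positivity

/-- A subgroup of the class group containing all norms from an extension `L / k` has index at most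
`[L : k]`. -/
theorem index_le_finrank_of_relNorm_mem (H : Subgroup (ClassGroup (𝓞 k)))
    (hH : ∀ (J : (Ideal (𝓞 L))⁰) (I : (Ideal (𝓞 k))⁰),
      Ideal.relNorm (𝓞 k) (J : Ideal (𝓞 L)) = I → ClassGroup.mk0 I ∈ H) :
    H.index ≤ Module.finrank (𝓞 k) (𝓞 L) := by
  by_contra! hlt
  obtain ⟨M, hM⟩ := exists_index_mul_tsum_prime_le H
  obtain ⟨M', hM'⟩ := exists_abs_tsum_prime_add_log_le L
  set n : ℝ := (Module.finrank (𝓞 k) (𝓞 L) : ℝ)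
  set B : ℝ := ∑' p : HeightOneSpectrum (𝓞 k), (Ideal.absNorm p.asIdeal : ℝ) ^ (-2 : ℝ)
  have hn : 0 ≤ n := Nat.cast_nonneg _
  have hlim : Tendsto (fun s : ℝ => -Real.log (s - 1)) (𝓝[>] 1) atTop := by
    refine tendsto_neg_atBot_atTop.comp (Real.tendsto_log_nhdsGT_zero.comp ?_)
    refine tendsto_nhdsWithin_iff.mpr ⟨?_, ?_⟩
    · refine (Continuous.tendsto' (by fun_prop) _ _ (by norm_num)).mono_left nhdsWithin_le_nhds
    · filter_upwards [self_mem_nhdsWithin] with s hs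
      exact sub_pos.mpr (show (1 : ℝ) < s from hs)
  have hgt : ∀ᶠ s in 𝓝[>] (1 : ℝ), 1 < s := self_mem_nhdsWithin
  obtain ⟨s, hs, h1, h2, h3, h0⟩ := (hgt.and (hM.and (hM'.and ((hlim.eventually_gt_atTop
    (n * M + H.index * (M' + n * B))).and (hlim.eventually_ge_atTop 0))))).exists
  have h4 := tsum_prime_absNorm_le hH hs
  set A : ℝ := ∑' p : HeightOneSpectrum (𝓞 k),
    (if ClassGroup.mk0 (primeIdeal k p) ∈ H then (Ideal.absNorm p.asIdeal : ℝ) ^ (-s) else 0)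
  have h5 := (abs_le.mp h2).1
  have h6 : (n + 1 : ℝ) ≤ H.index := by
    change ((Module.finrank (𝓞 k) (𝓞 L) : ℕ) : ℝ) + 1 ≤ H.index
    exact_mod_cast hlt
  have h7 := mul_le_mul_of_nonneg_left h1 hn
  have h8 : (H.index : ℝ) * (-Real.log (s - 1) - M') ≤ H.index * (n * (A + B)) :=
    mul_le_mul_of_nonneg_left (by linarith) (Nat.cast_nonneg _)
  have h9 := mul_le_mul_of_nonneg_right h6 h0
  linarith

end NumberField
end

noncomputable section
namespace NumberField

open scoped nonZeroDivisors Pointwise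

theorem _root_.Ideal.eq_of_le_of_absNorm_eq {S : Type*} [CommRing S] [IsDedekindDomain S]
    [Module.Free ℤ S] {I J : Ideal S} (hle : I ≤ J) (h : Ideal.absNorm I = Ideal.absNorm J)
    (hJ : Ideal.absNorm J ≠ 0) : I = J := by
  obtain ⟨M, rfl⟩ := Ideal.dvd_iff_le.mpr hle
  rw [map_mul, Nat.mul_eq_left hJ, Ideal.absNorm_eq_one_iff] at h
  rw [h, Ideal.mul_top]

variable {F L : Type*} [Field F] [NumberField F] [Field L] [NumberField L] [Algebra F L]

instance : SMulCommClass Gal(L/F) (𝓞 F) (𝓞 L) where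
  smul_comm g a x := by
    apply RingOfIntegers.coe_injective
    rw [Algebra.smul_def, Algebra.smul_def, smul_mul']
    congr 2
    apply RingOfIntegers.coe_injective
    exact g.commutes (a : F)

theorem absNorm_smul_eq (g : Gal(L/F)) (I : Ideal (𝓞 L)) :
    Ideal.absNorm (g • I) = Ideal.absNorm I := by
  rw [← Ideal.absNorm_relNorm (𝓞 F), Ideal.relNorm_smul, Ideal.absNorm_relNorm]

theorem finrank_ringOfIntegers_eq : Module.finrank (𝓞 F) (𝓞 L) = Module.finrank F L :=
  (IsFractionRing.finrank_eq (𝓞 F) F (𝓞 L) L).symm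

theorem algebraMap_intNorm_eq_prod [IsGalois F L] (x : 𝓞 L) :
    algebraMap (𝓞 F) (𝓞 L) (Algebra.intNorm (𝓞 F) (𝓞 L) x) = ∏ g : Gal(L/F), g • x := by
  apply RingOfIntegers.coe_injective
  have h : algebraMap (𝓞 F) F (Algebra.intNorm (𝓞 F) (𝓞 L) x) = Algebra.norm F (x : L) :=
    Algebra.algebraMap_intNorm (A := 𝓞 F) (K := F) (L := L) (B := 𝓞 L) x
  rw [← IsScalarTower.algebraMap_apply, IsScalarTower.algebraMap_apply (𝓞 F) F L, h,
    Algebra.norm_eq_prod_automorphisms, map_prod]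
  rfl

/-- The relative norm of an ideal, extended back to a Galois extension, is the product of the
conjugates of the ideal. -/
theorem map_relNorm_eq_prod [IsGalois F L] (I : Ideal (𝓞 L)) :
    (Ideal.relNorm (𝓞 F) I).map (algebraMap (𝓞 F) (𝓞 L)) = ∏ g : Gal(L/F), g • I := by
  by_cases hI : I = ⊥
  · subst hI
    rw [Ideal.relNorm_bot, Ideal.map_bot]
    symm
    refine Finset.prod_eq_zero (Finset.mem_univ 1) ?_
    rw [one_smul]
    rfl
  have hN : Ideal.absNorm (∏ g : Gal(L/F), g • I) = Ideal.absNorm I ^ Module.finrank F L := by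
    rw [map_prod, Finset.prod_congr rfl fun g _ => absNorm_smul_eq g I, Finset.prod_const,
      Finset.card_univ, ← Nat.card_eq_fintype_card, IsGalois.card_aut_eq_finrank]
  refine Ideal.eq_of_le_of_absNorm_eq ?_ ?_ ?_
  · rw [Ideal.map_relNorm, Ideal.span_le]
    rintro _ ⟨x, hx, rfl⟩
    simp only [Function.comp]
    rw [algebraMap_intNorm_eq_prod]
    exact Ideal.prod_mem_prod fun g _ => Ideal.smul_mem_pointwise_smul g x I hx
  · rw [hN, Ideal.absNorm_algebraMap, Ideal.absNorm_relNorm, finrank_ringOfIntegers_eq]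
  · rw [hN]
    refine pow_ne_zero _ ?_
    rwa [Ne, Ideal.absNorm_eq_zero_iff]

theorem map_algebraMap_injective :
    Function.Injective (Ideal.map (algebraMap (𝓞 F) (𝓞 L))) := by
  intro I J h
  have h1 := congrArg (Ideal.relNorm (𝓞 F)) h
  rw [Ideal.relNorm_algebraMap, Ideal.relNorm_algebraMap] at h1
  exact pow_left_injective (by rw [finrank_ringOfIntegers_eq]; exact Module.finrank_pos.ne') h1

end NumberField

section ClassHom

open scoped nonZeroDivisors

variable {A B C : Type*} [CommRing A] [IsDedekindDomain A] [CommRing B] [IsDedekindDomain B]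
  [CommRing C] [IsDedekindDomain C]

/-- A multiplicative map on ideals preserving nonzero ideals and principal ideals. -/
structure ClassCompatible (Φ : Ideal A →* Ideal B) : Prop where
  ne_zero : ∀ I, I ≠ 0 → Φ I ≠ 0
  principal : ∀ x, ∃ y, Φ (Ideal.span {x}) = Ideal.span {y}

namespace ClassCompatible

variable {Φ : Ideal A →* Ideal B} (h : ClassCompatible Φ)

/-- The image of a nonzero ideal. -/
def nonzero (I : (Ideal A)⁰) : (Ideal B)⁰ :=
  ⟨Φ I, mem_nonZeroDivisors_iff_ne_zero.mpr (h.ne_zero _ (nonZeroDivisors.ne_zero I.2))⟩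

theorem mk0_eq_mk0 {I J : (Ideal A)⁰} (hIJ : ClassGroup.mk0 I = ClassGroup.mk0 J) :
    ClassGroup.mk0 (h.nonzero I) = ClassGroup.mk0 (h.nonzero J) := by
  rw [ClassGroup.mk0_eq_mk0_iff] at hIJ ⊢
  obtain ⟨x, y, hx, hy, hxy⟩ := hIJ
  obtain ⟨x', hx'⟩ := h.principal x
  obtain ⟨y', hy'⟩ := h.principal y
  refine ⟨x', y', ?_, ?_, ?_⟩
  · rintro rfl
    refine h.ne_zero (Ideal.span {x}) ?_ ?_
    · rwa [Ne, Ideal.zero_eq_bot, Ideal.span_singleton_eq_bot]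
    · rw [hx', Ideal.zero_eq_bot, Ideal.span_singleton_eq_bot]
  · rintro rfl
    refine h.ne_zero (Ideal.span {y}) ?_ ?_
    · rwa [Ne, Ideal.zero_eq_bot, Ideal.span_singleton_eq_bot]
    · rw [hy', Ideal.zero_eq_bot, Ideal.span_singleton_eq_bot]
  · rw [← hx', ← hy']
    change Φ _ * Φ _ = Φ _ * Φ _
    rw [← map_mul, ← map_mul, hxy]

/-- The induced homomorphism of class groups. -/
def classHom : ClassGroup A →* ClassGroup B where
  toFun c := ClassGroup.mk0 (h.nonzero (ClassGroup.mk0_surjective c).choose)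
  map_one' := by
    have h1 : ClassGroup.mk0 (h.nonzero 1) = 1 := by
      rw [← map_one ClassGroup.mk0]
      congr 1
      exact Subtype.ext (map_one Φ)
    rw [← h1]
    apply h.mk0_eq_mk0
    rw [(ClassGroup.mk0_surjective 1).choose_spec, map_one]
  map_mul' c d := by
    rw [← map_mul]
    have h1 : ∀ I J, h.nonzero I * h.nonzero J = h.nonzero (I * J) := fun I J =>
      Subtype.ext (map_mul Φ _ _).symm
    rw [h1]
    apply h.mk0_eq_mk0
    rw [(ClassGroup.mk0_surjective _).choose_spec, map_mul,
      (ClassGroup.mk0_surjective c).choose_spec, (ClassGroup.mk0_surjective d).choose_spec]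

theorem classHom_mk0 (I : (Ideal A)⁰) :
    h.classHom (ClassGroup.mk0 I) = ClassGroup.mk0 (h.nonzero I) :=
  h.mk0_eq_mk0 (ClassGroup.mk0_surjective _).choose_spec

end ClassCompatible
end ClassHom

namespace NumberField

open scoped nonZeroDivisors Pointwise

variable {G F L : Type*} [Field F] [NumberField F] [Field L] [NumberField L] [Algebra F L]

theorem classCompatible_smul [Group G] [MulSemiringAction G L] (g : G) :
    ClassCompatible (MulDistribMulAction.toMonoidHom (Ideal (𝓞 L)) g) where
  ne_zero I hI h := hI (by
    change g • I = 0 at h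
    rw [← inv_smul_smul g I, h, smul_zero])
  principal x := ⟨g • x, by
    change g • Ideal.span {x} = _
    rw [Ideal.pointwise_smul_def, Ideal.map_span, Set.image_singleton]
    rfl⟩

variable (F L) in
theorem classCompatible_map :
    ClassCompatible (Ideal.mapHom (algebraMap (𝓞 F) (𝓞 L)) : Ideal (𝓞 F) →* Ideal (𝓞 L)) where
  ne_zero I hI h := hI (map_algebraMap_injective (L := L) (by
    change I.map _ = 0 at h
    rw [h, Ideal.zero_eq_bot, Ideal.zero_eq_bot, Ideal.map_bot]))
  principal x := ⟨algebraMap (𝓞 F) (𝓞 L) x, by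
    change Ideal.map _ _ = _
    rw [Ideal.map_span, Set.image_singleton]⟩

variable (F L) in
theorem classCompatible_relNorm :
    ClassCompatible ((Ideal.relNorm (𝓞 F) : Ideal (𝓞 L) →*₀ Ideal (𝓞 F)) :
      Ideal (𝓞 L) →* Ideal (𝓞 F)) where
  ne_zero I hI h := hI (by
    change Ideal.relNorm (𝓞 F) I = 0 at h
    rwa [Ideal.zero_eq_bot, Ideal.relNorm_eq_bot_iff] at h)
  principal x := ⟨Algebra.intNorm (𝓞 F) (𝓞 L) x, Ideal.relNorm_singleton (𝓞 F) x⟩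

end NumberField
end

noncomputable section
namespace NumberField

open scoped nonZeroDivisors Pointwise

theorem _root_.Finset.prod_univ_of_card_eq_three {G M : Type*} [Group G] [Fintype G] [CommMonoid M]
    (h : Nat.card G = 3) {σ : G} (hσ : σ ≠ 1) (f : G → M) :
    ∏ g, f g = f 1 * f σ * f (σ ^ 2) := by
  classical
  have ho : orderOf σ = 3 := by
    have := orderOf_dvd_natCard σ
    rw [h, Nat.dvd_prime Nat.prime_three, orderOf_eq_one_iff] at this
    tauto
  have h3 : σ ^ 3 = 1 := ho ▸ pow_orderOf_eq_one σ
  have h2 : σ ^ 2 ≠ 1 := pow_ne_one_of_lt_orderOf (by norm_num) (by omega)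
  have h21 : σ ^ 2 ≠ σ := by
    rw [pow_two]
    simpa using hσ
  have hu : (Finset.univ : Finset G) = {1, σ, σ ^ 2} := by
    symm
    apply Finset.eq_univ_of_card
    rw [← Nat.card_eq_fintype_card, h]
    rw [Finset.card_insert_of_notMem, Finset.card_pair h21.symm]
    simp [hσ.symm, h2.symm]
  rw [hu, Finset.prod_insert, Finset.prod_pair h21.symm, mul_assoc]
  simp [hσ.symm, h2.symm]

theorem _root_.Finset.prod_univ_of_card_eq_two {G M : Type*} [Group G] [Fintype G] [CommMonoid M]
    (h : Nat.card G = 2) {τ : G} (hτ : τ ≠ 1) (f : G → M) :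
    ∏ g, f g = f 1 * f τ := by
  classical
  have hu : (Finset.univ : Finset G) = {1, τ} := by
    symm
    apply Finset.eq_univ_of_card
    rw [← Nat.card_eq_fintype_card, h, Finset.card_pair hτ.symm]
  rw [hu, Finset.prod_pair hτ.symm]

variable {F L : Type*} [Field F] [NumberField F] [Field L] [NumberField L] [Algebra F L]

/-- The action of an automorphism on the class group. -/
def classSMul (g : Gal(L/F)) : ClassGroup (𝓞 L) →* ClassGroup (𝓞 L) :=
  (classCompatible_smul g).classHom

variable (F L) in
/-- Extension of ideal classes. -/
def classMap : ClassGroup (𝓞 F) →* ClassGroup (𝓞 L) := (classCompatible_map F L).classHom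

variable (F L) in
/-- The norm of ideal classes. -/
def classNorm : ClassGroup (𝓞 L) →* ClassGroup (𝓞 F) := (classCompatible_relNorm F L).classHom

theorem classSMul_mk0 (g : Gal(L/F)) (I : (Ideal (𝓞 L))⁰) :
    classSMul g (ClassGroup.mk0 I) = ClassGroup.mk0 ((classCompatible_smul g).nonzero I) :=
  ClassCompatible.classHom_mk0 _ I

theorem classMap_mk0 (I : (Ideal (𝓞 F))⁰) :
    classMap F L (ClassGroup.mk0 I) = ClassGroup.mk0 ((classCompatible_map F L).nonzero I) :=
  ClassCompatible.classHom_mk0 _ I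

theorem classNorm_mk0 (I : (Ideal (𝓞 L))⁰) :
    classNorm F L (ClassGroup.mk0 I) = ClassGroup.mk0 ((classCompatible_relNorm F L).nonzero I) :=
  ClassCompatible.classHom_mk0 _ I

theorem classSMul_mul (g h : Gal(L/F)) (x : ClassGroup (𝓞 L)) :
    classSMul (g * h) x = classSMul g (classSMul h x) := by
  obtain ⟨I, rfl⟩ := ClassGroup.mk0_surjective x
  simp only [classSMul_mk0]
  congr 1
  exact Subtype.ext (mul_smul g h (I : Ideal (𝓞 L)))

theorem classSMul_one (x : ClassGroup (𝓞 L)) : classSMul (1 : Gal(L/F)) x = x := by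
  obtain ⟨I, rfl⟩ := ClassGroup.mk0_surjective x
  simp only [classSMul_mk0]
  congr 1
  exact Subtype.ext (one_smul _ (I : Ideal (𝓞 L)))

theorem classNorm_classMap (y : ClassGroup (𝓞 F)) :
    classNorm F L (classMap F L y) = y ^ Module.finrank F L := by
  obtain ⟨I, rfl⟩ := ClassGroup.mk0_surjective y
  rw [classMap_mk0, classNorm_mk0, ← map_pow]
  congr 1
  apply Subtype.ext
  rw [← finrank_ringOfIntegers_eq]
  exact Ideal.relNorm_algebraMap (𝓞 L) (I : Ideal (𝓞 F))

theorem classNorm_classSMul (g : Gal(L/F)) (x : ClassGroup (𝓞 L)) :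
    classNorm F L (classSMul g x) = classNorm F L x := by
  obtain ⟨I, rfl⟩ := ClassGroup.mk0_surjective x
  rw [classSMul_mk0, classNorm_mk0, classNorm_mk0]
  congr 1
  apply Subtype.ext
  have := Ideal.relNorm_smul (𝓞 F) g (I : Ideal (𝓞 L))
  exact this

theorem classSMul_classMap (g : Gal(L/F)) (y : ClassGroup (𝓞 F)) :
    classSMul g (classMap F L y) = classMap F L y := by
  obtain ⟨I, rfl⟩ := ClassGroup.mk0_surjective y
  rw [classMap_mk0, classSMul_mk0]
  congr 1
  apply Subtype.ext
  change Ideal.map _ (Ideal.map _ _) = Ideal.map _ _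
  rw [Ideal.map_map]
  congr 1
  refine RingHom.ext fun a => RingOfIntegers.coe_injective ?_
  exact g.commutes (a : F)

theorem classMap_classNorm [IsGalois F L] (x : ClassGroup (𝓞 L)) :
    classMap F L (classNorm F L x) = ∏ g : Gal(L/F), classSMul g x := by
  obtain ⟨I, rfl⟩ := ClassGroup.mk0_surjective x
  simp only [classNorm_mk0, classMap_mk0, classSMul_mk0]
  rw [← map_prod]
  congr 1
  apply Subtype.ext
  rw [Submonoid.coe_finsetProd]
  exact map_relNorm_eq_prod (I : Ideal (𝓞 L))

theorem classGroup_rat (y : ClassGroup (𝓞 ℚ)) : y = 1 := by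
  have h : classNumber ℚ = 1 := Rat.classNumber_eq
  rw [classNumber, Fintype.card_eq_one_iff] at h
  obtain ⟨z, hz⟩ := h
  rw [hz y, hz 1]

end NumberField
end

noncomputable section
namespace NumberField

open scoped nonZeroDivisors Pointwise

theorem classSMul_eq_inv_of_quadratic {k : Type*} [Field k] [NumberField k] [IsGalois ℚ k]
    (hk : Module.finrank ℚ k = 2) {c : Gal(k/ℚ)} (hc : c ≠ 1) (y : ClassGroup (𝓞 k)) :
    classSMul c y = y⁻¹ := by
  have h := classMap_classNorm (F := ℚ) y
  rw [classGroup_rat (classNorm ℚ k y), map_one,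
    Finset.prod_univ_of_card_eq_two (by rw [IsGalois.card_aut_eq_finrank, hk]) hc,
    classSMul_one] at h
  exact (inv_eq_of_mul_eq_one_right h.symm).symm

variable {F F' k L : Type*} [Field F] [NumberField F] [Field F'] [NumberField F']
  [Field k] [NumberField k] [Field L] [NumberField L] [Algebra F L] [Algebra F' L] [Algebra k L]

/-- Compatible automorphisms act compatibly with extension of ideals. -/
theorem smul_map_eq {A : Type*} [Field A] [NumberField A] [Algebra A k] (τ : Gal(L/F))
    (c : Gal(k/A)) (h : ∀ a, τ (algebraMap k L a) = algebraMap k L (c a)) (I : Ideal (𝓞 k)) :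
    τ • I.map (algebraMap (𝓞 k) (𝓞 L)) = (c • I).map (algebraMap (𝓞 k) (𝓞 L)) := by
  rw [Ideal.pointwise_smul_def, Ideal.pointwise_smul_def, Ideal.map_map, Ideal.map_map]
  congr 1
  refine RingHom.ext fun a => RingOfIntegers.coe_injective ?_
  exact h (a : k)

theorem smul_smul_eq_of_comm (τ : Gal(L/F)) (σ ρ : Gal(L/F'))
    (h : ∀ a, τ (σ a) = ρ (τ a)) (I : Ideal (𝓞 L)) : τ • σ • I = ρ • τ • I := by
  simp only [Ideal.pointwise_smul_def, Ideal.map_map]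
  congr 1
  refine RingHom.ext fun a => RingOfIntegers.coe_injective ?_
  exact h (a : L)

theorem classSMul_classSMul_of_comm (τ : Gal(L/F)) (σ ρ : Gal(L/F'))
    (h : ∀ a, τ (σ a) = ρ (τ a)) (x : ClassGroup (𝓞 L)) :
    classSMul τ (classSMul σ x) = classSMul ρ (classSMul τ x) := by
  obtain ⟨I, rfl⟩ := ClassGroup.mk0_surjective x
  simp only [classSMul_mk0]
  congr 1
  exact Subtype.ext (smul_smul_eq_of_comm τ σ ρ h I)

theorem classSMul_classMap_of_comm {A : Type*} [Field A] [NumberField A] [Algebra A k]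
    (τ : Gal(L/F)) (c : Gal(k/A)) (h : ∀ a, τ (algebraMap k L a) = algebraMap k L (c a))
    (y : ClassGroup (𝓞 k)) :
    classSMul τ (classMap k L y) = classMap k L (classSMul c y) := by
  obtain ⟨I, rfl⟩ := ClassGroup.mk0_surjective y
  rw [classSMul_mk0, classMap_mk0, classMap_mk0, classSMul_mk0]
  congr 1
  exact Subtype.ext (smul_map_eq τ c h I)

theorem relNorm_smul_of_comm {A : Type*} [Field A] [NumberField A] [Algebra A k] [IsGalois k L]
    (h3 : Module.finrank k L = 3) {σ : Gal(L/k)} (hσ : σ ≠ 1)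
    (τ : Gal(L/F)) (c : Gal(k/A)) (h : ∀ a, τ (algebraMap k L a) = algebraMap k L (c a))
    (hτσ : ∀ a, τ (σ a) = (σ ^ 2) (τ a)) (I : Ideal (𝓞 L)) :
    Ideal.relNorm (𝓞 k) (τ • I) = c • Ideal.relNorm (𝓞 k) I := by
  apply map_algebraMap_injective (L := L)
  have hcard : Nat.card Gal(L/k) = 3 := by rw [IsGalois.card_aut_eq_finrank, h3]
  have hσ3 : σ ^ 3 = 1 := by rw [← hcard, pow_card_eq_one']
  have hσ4 : σ ^ 2 * σ ^ 2 = σ := by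
    rw [← pow_add, show 2 + 2 = 3 + 1 from rfl, pow_succ, hσ3, one_mul]
  have hτσ2 : ∀ a, τ ((σ ^ 2) a) = σ (τ a) := by
    intro a
    rw [pow_two, AlgEquiv.mul_apply, hτσ, hτσ, ← AlgEquiv.mul_apply, hσ4]
  rw [← smul_map_eq τ c h, map_relNorm_eq_prod, map_relNorm_eq_prod,
    Finset.prod_univ_of_card_eq_three hcard hσ, Finset.prod_univ_of_card_eq_three hcard hσ,
    smul_mul', smul_mul', smul_smul_eq_of_comm τ σ _ hτσ, smul_smul_eq_of_comm τ _ σ hτσ2,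
    one_smul, one_smul, mul_right_comm]

theorem classNorm_classSMul_of_comm {A : Type*} [Field A] [NumberField A] [Algebra A k]
    [IsGalois k L] (h3 : Module.finrank k L = 3) {σ : Gal(L/k)} (hσ : σ ≠ 1)
    (τ : Gal(L/F)) (c : Gal(k/A)) (h : ∀ a, τ (algebraMap k L a) = algebraMap k L (c a))
    (hτσ : ∀ a, τ (σ a) = (σ ^ 2) (τ a)) (x : ClassGroup (𝓞 L)) :
    classNorm k L (classSMul τ x) = classSMul c (classNorm k L x) := by
  obtain ⟨I, rfl⟩ := ClassGroup.mk0_surjective x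
  rw [classSMul_mk0, classNorm_mk0, classNorm_mk0, classSMul_mk0]
  congr 1
  exact Subtype.ext (relNorm_smul_of_comm h3 hσ τ c h hτσ I)

theorem classNorm_range_index_le : (classNorm F L).range.index ≤ Module.finrank F L := by
  rw [← finrank_ringOfIntegers_eq]
  refine index_le_finrank_of_relNorm_mem F L _ fun J I hJI => ⟨ClassGroup.mk0 J, ?_⟩
  rw [classNorm_mk0]
  congr 1
  exact Subtype.ext hJI

/-- Comparison of 3-torsion in the class groups of a cubic field and its quadratic resolvent in
terms of the group of ambiguous classes. -/
theorem card_torsion_le_of_resolvent {K : Type*} [Field K] [NumberField K] [Algebra K L]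
    [IsGalois ℚ k] [IsGalois k L] [IsGalois K L] (hk : Module.finrank ℚ k = 2)
    (h3 : Module.finrank k L = 3) (h2 : Module.finrank K L = 2)
    {σ : Gal(L/k)} (hσ : σ ≠ 1) {τ : Gal(L/K)} (hτ : τ ≠ 1) {c : Gal(k/ℚ)} (hc : c ≠ 1)
    (h : ∀ a, τ (algebraMap k L a) = algebraMap k L (c a))
    (hτσ : ∀ a, τ (σ a) = (σ ^ 2) (τ a)) {B : ℕ}
    (hB : (classMap k L).range.relIndex
      ((classSMul σ).eqLocus (MonoidHom.id (ClassGroup (𝓞 L)))) ≤ B) :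
    Nat.card {z : ClassGroup (𝓞 K) // z ^ 3 = 1} ≤
        B ^ 2 * Nat.card {y : ClassGroup (𝓞 k) // y ^ 3 = 1} ∧
      Nat.card {y : ClassGroup (𝓞 k) // y ^ 3 = 1} ≤
        3 * (B * Nat.card {z : ClassGroup (𝓞 K) // z ^ 3 = 1}) := by
  have hcard : Nat.card Gal(L/k) = 3 := by rw [IsGalois.card_aut_eq_finrank, h3]
  have hcard2 : Nat.card Gal(L/K) = 2 := by rw [IsGalois.card_aut_eq_finrank, h2]
  have hσ3 : σ ^ 3 = 1 := by rw [← hcard, pow_card_eq_one']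
  have hτ2 : τ * τ = 1 := by rw [← pow_two, ← hcard2, pow_card_eq_one']
  have e1 : ∀ x, classSMul σ (classSMul σ (classSMul σ x)) = x := fun x => by
    rw [← classSMul_mul, ← classSMul_mul, ← pow_two, ← pow_succ, hσ3, classSMul_one]
  have e2 : ∀ x, classSMul τ (classSMul τ x) = x := fun x => by
    rw [← classSMul_mul, hτ2, classSMul_one]
  have e3 : ∀ y, classNorm k L (classMap k L y) = y ^ 3 := fun y => by
    rw [classNorm_classMap, h3]
  have e4 : ∀ x, classMap k L (classNorm k L x) =
      x * classSMul σ x * classSMul σ (classSMul σ x) := fun x => by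
    rw [classMap_classNorm, Finset.prod_univ_of_card_eq_three hcard hσ, classSMul_one, pow_two,
      classSMul_mul]
  have e5 : ∀ x, classNorm k L (classSMul τ x) = (classNorm k L x)⁻¹ := fun x => by
    rw [classNorm_classSMul_of_comm h3 hσ τ c h hτσ, classSMul_eq_inv_of_quadratic hk hc]
  have e6 : ∀ y, classSMul τ (classMap k L y) = (classMap k L y)⁻¹ := fun y => by
    rw [classSMul_classMap_of_comm τ c h, classSMul_eq_inv_of_quadratic hk hc, map_inv]
  have e7 : ∀ x, classSMul τ (classSMul σ x) = classSMul σ (classSMul σ (classSMul τ x)) :=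
    fun x => by rw [classSMul_classSMul_of_comm τ σ (σ ^ 2) hτσ, pow_two, classSMul_mul]
  have e8 : Nat.card {z : ClassGroup (𝓞 K) // z ^ 3 = 1} =
      Nat.card {x : ClassGroup (𝓞 L) // x ^ 3 = 1 ∧ classSMul τ x = x} := by
    refine card_torsion_eq_invariant (classSMul τ) (classMap K L) (classNorm K L) (fun z => ?_)
      (fun x => ?_) (fun z => classSMul_classMap τ z)
    · rw [classNorm_classMap, h2]
    · rw [classMap_classNorm, Finset.prod_univ_of_card_eq_two hcard2 hτ, classSMul_one]
  rw [e8]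
  constructor
  · refine (card_invariant_torsion_le (classSMul σ) (classSMul τ) (classMap k L) (classNorm k L)
      e1 e3 (classNorm_classSMul σ) e4 e5 e6).trans ?_
    gcongr
  · refine (card_torsion_le_invariant (classSMul σ) (classSMul τ) (classMap k L) (classNorm k L)
      e1 e2 e7 e3 e5).trans ?_
    gcongr
    exact classNorm_range_index_le.trans h3.le

end NumberField
end

noncomputable section
namespace NumberField

open scoped nonZeroDivisors Pointwise Classical
open UniqueFactorizationMonoid

theorem _root_.Ideal.eq_pow_of_forall_dvd_count {A : Type*} [CommRing A] [IsDedekindDomain A]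
    {M : Ideal A} (hM : M ≠ 0) {n : ℕ}
    (h : ∀ p : Ideal A, p.IsPrime → n ∣ (normalizedFactors M).count p) : ∃ J, M = J ^ n := by
  obtain ⟨u, hu⟩ := Multiset.exists_smul_of_dvd_count (normalizedFactors M) fun p hp =>
    h p (Ideal.isPrime_of_prime (prime_of_normalized_factor p hp))
  refine ⟨u.prod, ?_⟩
  rw [← Multiset.prod_nsmul, ← hu, Ideal.prod_normalizedFactors_eq_self hM]

theorem _root_.Ideal.dvd_count_of_ne_bot {A : Type*} [CommRing A] [IsDedekindDomain A]
    {M p : Ideal A} {n : ℕ}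
    (h : p ≠ ⊥ → n ∣ (normalizedFactors M).count p) : n ∣ (normalizedFactors M).count p := by
  by_cases h0 : p = ⊥
  · rw [Multiset.count_eq_zero_of_notMem]
    · exact dvd_zero n
    · intro hp
      exact (prime_of_normalized_factor p hp).ne_zero h0
  · exact h h0

section
variable {A B : Type*} [CommRing A] [IsDedekindDomain A] [CommRing B] [IsDedekindDomain B]
  [Algebra A B] [Module.IsTorsionFree A B]

theorem _root_.Ideal.count_normalizedFactors_map (P : Ideal B) (hP : P.IsPrime) (hP0 : P ≠ ⊥)
    {M : Ideal A} (hM : M ≠ 0) :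
    (normalizedFactors (M.map (algebraMap A B))).count P =
      P.ramificationIdx A * (normalizedFactors M).count (P.under A) := by
  have hPp := Ideal.prime_of_isPrime hP0 hP
  have hmap : ∀ {I : Ideal A}, I ≠ 0 → I.map (algebraMap A B) ≠ 0 := fun hI =>
    Ideal.map_ne_bot_of_ne_bot hI
  induction M using UniqueFactorizationMonoid.induction_on_prime with
  | h₁ => exact absurd rfl hM
  | h₂ x hx =>
    rw [Ideal.isUnit_iff] at hx
    rw [hx, Ideal.map_top, ← Ideal.one_eq_top, ← Ideal.one_eq_top, normalizedFactors_one,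
      normalizedFactors_one, Multiset.count_zero, Multiset.count_zero, mul_zero]
  | h₃ a p ha hp ih =>
    rw [Ideal.map_mul, normalizedFactors_mul (hmap hp.ne_zero) (hmap ha),
      normalizedFactors_mul hp.ne_zero ha, Multiset.count_add, Multiset.count_add, ih ha, mul_add,
      normalizedFactors_irreducible hp.irreducible, normalize_eq]
    congr 1
    by_cases h : p = P.under A
    · have : P.LiesOver p := ⟨h⟩
      rw [← Ideal.IsDedekindDomain.ramificationIdx_eq_normalizedFactors_count p P (hmap hp.ne_zero),
        ← h, Multiset.count_singleton_self, mul_one]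
    · rw [Multiset.count_singleton, if_neg (Ne.symm h), mul_zero, Multiset.count_eq_zero]
      intro hmem
      have hle := Ideal.dvd_iff_le.mp (dvd_of_mem_normalizedFactors hmem)
      have hpm := (Ideal.isPrime_of_prime hp).isMaximal hp.ne_zero
      refine h (hpm.eq_of_le ?_ (Ideal.map_le_iff_le_comap.mp hle))
      exact Ideal.IsPrime.ne_top (Ideal.IsPrime.under A P)

end

/-- The primes `p` of `F` all of whose prime divisors in `L` have ramification index divisible
by 3. -/
def cubicRamified (F L : Type*) [Field F] [Field L] [Algebra F L] : Set (Ideal (𝓞 F)) :=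
  {p | p.IsPrime ∧ p ≠ ⊥ ∧ ∀ P : Ideal (𝓞 L), P.IsPrime → P.under (𝓞 F) = p →
    3 ∣ P.ramificationIdx (𝓞 F)}

theorem _root_.Subgroup.relIndex_le_card_of_forall {G α : Type*} [Group G] [Finite α]
    {H K : Subgroup G} (f : K → α) (h : ∀ a b : K, f a = f b → (a : G)⁻¹ * b ∈ H) :
    H.relIndex K ≠ 0 ∧ H.relIndex K ≤ Nat.card α := by
  have hinj : Function.Injective fun q : K ⧸ H.subgroupOf K => f q.out := by
    intro q r hqr
    rw [← q.out_eq, ← r.out_eq]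
    exact Quotient.sound (QuotientGroup.leftRel_apply.mpr (h _ _ hqr))
  have := Finite.of_injective _ hinj
  exact ⟨Nat.card_ne_zero.mpr ⟨inferInstance, this⟩, Nat.card_le_card_of_injective _ hinj⟩

variable {k L : Type*} [Field k] [NumberField k] [Field L] [NumberField L] [Algebra k L]

theorem mem_range_classMap_of_map_eq {I : (Ideal (𝓞 L))⁰} {J : Ideal (𝓞 k)} (hJ : J ≠ 0)
    (h : J.map (algebraMap (𝓞 k) (𝓞 L)) = I) : ClassGroup.mk0 I ∈ (classMap k L).range := by
  refine ⟨ClassGroup.mk0 ⟨J, mem_nonZeroDivisors_iff_ne_zero.mpr hJ⟩, ?_⟩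
  rw [classMap_mk0]
  congr 1
  exact Subtype.ext h

variable [IsGalois k L]

theorem pow_three_eq_map_relNorm (h3 : Module.finrank k L = 3) {I : Ideal (𝓞 L)}
    (h : ∀ g : Gal(L/k), g • I = I) : I ^ 3 = (Ideal.relNorm (𝓞 k) I).map (algebraMap _ _) := by
  rw [map_relNorm_eq_prod, Finset.prod_congr rfl fun g _ => h g, Finset.prod_const,
    Finset.card_univ, ← Nat.card_eq_fintype_card, IsGalois.card_aut_eq_finrank, h3]

theorem dvd_count_relNorm_of_notMem (h3 : Module.finrank k L = 3) {I : Ideal (𝓞 L)} (hI : I ≠ 0)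
    (h : ∀ g : Gal(L/k), g • I = I) {p : Ideal (𝓞 k)} (hp : p.IsPrime)
    (hpT : p ∉ cubicRamified k L) :
    3 ∣ (normalizedFactors (Ideal.relNorm (𝓞 k) I)).count p := by
  refine Ideal.dvd_count_of_ne_bot fun hp0 => ?_
  have : ∃ P : Ideal (𝓞 L), P.IsPrime ∧ P.under (𝓞 k) = p ∧ ¬ 3 ∣ P.ramificationIdx (𝓞 k) := by
    by_contra! hcon
    exact hpT ⟨hp, hp0, hcon⟩
  obtain ⟨P, hP, rfl, hP3⟩ := this
  have hP0 : P ≠ ⊥ := by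
    rintro rfl
    exact hp0 (Ideal.under_bot ..)
  have hN : Ideal.relNorm (𝓞 k) I ≠ 0 := fun h0 => hI (Ideal.relNorm_eq_bot_iff.mp h0)
  have := Ideal.count_normalizedFactors_map P hP hP0 hN
  rw [← pow_three_eq_map_relNorm h3 h, normalizedFactors_pow, Multiset.count_nsmul] at this
  exact (Nat.Coprime.dvd_of_dvd_mul_left ((Nat.Prime.coprime_iff_not_dvd Nat.prime_three).mpr hP3))
    ⟨_, this.symm⟩

theorem exists_map_eq_of_invariant (h3 : Module.finrank k L = 3) {I : Ideal (𝓞 L)} (hI : I ≠ 0)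
    (h : ∀ g : Gal(L/k), g • I = I)
    (hT : ∀ p ∈ cubicRamified k L, 3 ∣ (normalizedFactors (Ideal.relNorm (𝓞 k) I)).count p) :
    ∃ J : Ideal (𝓞 k), J ≠ 0 ∧ J.map (algebraMap (𝓞 k) (𝓞 L)) = I := by
  have hN : Ideal.relNorm (𝓞 k) I ≠ 0 := fun h0 => hI (Ideal.relNorm_eq_bot_iff.mp h0)
  obtain ⟨J, hJ⟩ := Ideal.eq_pow_of_forall_dvd_count hN (n := 3) fun p hp => by
    by_cases hpT : p ∈ cubicRamified k L
    · exact hT p hpT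
    · exact dvd_count_relNorm_of_notMem h3 hI h hp hpT
  refine ⟨J, ?_, ?_⟩
  · rintro rfl
    rw [zero_pow (by norm_num)] at hJ
    exact hN hJ
  · refine pow_left_injective (n := 3) (by norm_num) ?_
    change _ ^ 3 = _ ^ 3
    rw [← Ideal.map_pow, ← hJ, pow_three_eq_map_relNorm h3 h]

/-- The classes of invariant ideals. -/
def stronglyAmbiguous (k L : Type*) [Field k] [Field L] [NumberField L] [Algebra k L] :
    Subgroup (ClassGroup (𝓞 L)) where
  carrier := {c | ∃ I : (Ideal (𝓞 L))⁰, ClassGroup.mk0 I = c ∧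
    ∀ g : Gal(L/k), g • (I : Ideal (𝓞 L)) = I}
  one_mem' := ⟨1, map_one _, fun g => smul_one g⟩
  mul_mem' := by
    rintro _ _ ⟨I, rfl, hI⟩ ⟨J, rfl, hJ⟩
    refine ⟨I * J, map_mul _ _ _, fun g => ?_⟩
    rw [Submonoid.coe_mul, smul_mul', hI, hJ]
  inv_mem' := by
    rintro _ ⟨I, rfl, hI⟩
    refine ⟨I ^ (Nat.card (ClassGroup (𝓞 L)) - 1), ?_, fun g => ?_⟩
    · rw [map_pow, eq_inv_iff_mul_eq_one, ← pow_succ, Nat.sub_add_cancel Nat.card_pos,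
        pow_card_eq_one']
    · rw [SubmonoidClass.coe_pow, smul_pow', hI]

theorem relIndex_stronglyAmbiguous_le (h3 : Module.finrank k L = 3)
    (hfin : (cubicRamified k L).Finite) :
    (classMap k L).range.relIndex (stronglyAmbiguous k L) ≤ 3 ^ (cubicRamified k L).ncard := by
  have := hfin.to_subtype
  have hα : Nat.card (cubicRamified k L → ZMod 3) = 3 ^ (cubicRamified k L).ncard := by
    rw [Nat.card_fun, Nat.card_zmod, Nat.card_coe_set_eq]
  rw [← hα]
  choose I hI hinv using fun c : stronglyAmbiguous k L => c.2
  refine (Subgroup.relIndex_le_card_of_forall (fun c p =>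
    (((normalizedFactors (Ideal.relNorm (𝓞 k) (I c : Ideal (𝓞 L)))).count p.1 : ℕ) : ZMod 3))
    fun a b hab => ?_).2
  have hI0 : ∀ c, (I c : Ideal (𝓞 L)) ≠ 0 := fun c => nonZeroDivisors.ne_zero (I c).2
  have hN : ∀ c, Ideal.relNorm (𝓞 k) (I c : Ideal (𝓞 L)) ≠ 0 := fun c h0 =>
    hI0 c (Ideal.relNorm_eq_bot_iff.mp h0)
  have hinv' : ∀ g : Gal(L/k), g • ((I a ^ 2 * I b : (Ideal (𝓞 L))⁰) : Ideal (𝓞 L)) =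
      ((I a ^ 2 * I b : (Ideal (𝓞 L))⁰) : Ideal (𝓞 L)) := fun g => by
    rw [Submonoid.coe_mul, SubmonoidClass.coe_pow, smul_mul', smul_pow', hinv, hinv]
  obtain ⟨J, hJ0, hJ⟩ := exists_map_eq_of_invariant h3
    (nonZeroDivisors.ne_zero (I a ^ 2 * I b).2) hinv' fun p hp => by
      have := congrFun hab ⟨p, hp⟩
      rw [Submonoid.coe_mul, SubmonoidClass.coe_pow, map_mul, map_pow,
        normalizedFactors_mul (pow_ne_zero _ (hN a)) (hN b), normalizedFactors_pow,
        Multiset.count_add, Multiset.count_nsmul, ← ZMod.natCast_eq_zero_iff]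
      push_cast
      simp only at this
      rw [this, ← add_one_mul]
      exact mul_eq_zero_of_left (by decide) _
  have h1 := mem_range_classMap_of_map_eq hJ0 hJ
  have hinva : ∀ g : Gal(L/k), g • ((I a : (Ideal (𝓞 L))⁰) : Ideal (𝓞 L)) =
      ((I a : (Ideal (𝓞 L))⁰) : Ideal (𝓞 L)) := hinv a
  have h2 : ClassGroup.mk0 (I a ^ 3) ∈ (classMap k L).range :=
    mem_range_classMap_of_map_eq (hN a) (pow_three_eq_map_relNorm h3 hinva).symm
  rw [map_mul, map_pow, hI, hI] at h1
  rw [map_pow, hI] at h2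
  have h4 := Subgroup.mul_mem _ (Subgroup.inv_mem _ h2) h1
  convert h4 using 1
  group

end NumberField
end

noncomputable section
namespace NumberField

open scoped nonZeroDivisors Pointwise

variable {k L : Type*} [Field k] [NumberField k] [Field L] [NumberField L] [Algebra k L]

theorem Units.index_range_pow_le (n : ℕ) [NeZero n] :
    (powMonoidHom n : (𝓞 k)ˣ →* (𝓞 k)ˣ).range.index ≠ 0 ∧
      (powMonoidHom n : (𝓞 k)ˣ →* (𝓞 k)ˣ).range.index ≤ n ^ (Units.rank k + 1) := by
  obtain ⟨ζ, hζ⟩ := IsCyclic.exists_generator (α := Units.torsion k)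
  have key : ∀ x : (𝓞 k)ˣ, ∃ (m : ℤ) (e : Fin (Units.rank k) → ℤ),
      x = (ζ : (𝓞 k)ˣ) ^ m * ∏ i, Units.fundSystem k i ^ e i := by
    intro x
    obtain ⟨⟨z, e⟩, hze, -⟩ := Units.exist_unique_eq_mul_prod k x
    obtain ⟨m, rfl⟩ := Subgroup.mem_zpowers_iff.mp (hζ z)
    exact ⟨m, e, hze⟩
  choose m e hme using key
  have hα : Nat.card (ZMod n × (Fin (Units.rank k) → ZMod n)) = n ^ (Units.rank k + 1) := by
    rw [Nat.card_prod, Nat.card_fun, Nat.card_zmod, Nat.card_eq_fintype_card, Fintype.card_fin,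
      pow_succ, mul_comm]
  rw [← hα, ← Subgroup.relIndex_top_right]
  refine Subgroup.relIndex_le_card_of_forall
    (fun x => ((m x.1 : ZMod n), fun i => (e x.1 i : ZMod n))) fun a b hab => ?_
  rw [Prod.mk.injEq] at hab
  have h1 := (ZMod.intCast_eq_intCast_iff_dvd_sub _ _ _).mp hab.1
  have h2 := fun i => (ZMod.intCast_eq_intCast_iff_dvd_sub _ _ _).mp (congrFun hab.2 i)
  obtain ⟨q, hq⟩ := h1
  choose r hr using h2
  refine ⟨(ζ : (𝓞 k)ˣ) ^ q * ∏ i, Units.fundSystem k i ^ r i, ?_⟩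
  rw [powMonoidHom_apply, hme a.1, hme b.1, mul_pow, ← Finset.prod_pow]
  simp only [← zpow_natCast, ← zpow_mul]
  rw [mul_comm q, ← hq]
  simp only [mul_comm (r _), ← hr]
  rw [zpow_sub]
  simp only [zpow_sub]
  rw [Finset.prod_mul_distrib, Finset.prod_inv_distrib, mul_inv]
  rw [mul_mul_mul_comm, mul_comm]

theorem Units.rank_add_one_le_finrank : Units.rank k + 1 ≤ Module.finrank ℚ k := by
  classical
  have h := InfinitePlace.card_add_two_mul_card_eq_rank k
  have h2 := InfinitePlace.card_eq_nrRealPlaces_add_nrComplexPlaces k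
  have h3 : 0 < Fintype.card (InfinitePlace k) := Fintype.card_pos
  rw [Units.rank]
  omega

theorem range_classMap_le_stronglyAmbiguous :
    (classMap k L).range ≤ stronglyAmbiguous k L := by
  rintro _ ⟨y, rfl⟩
  obtain ⟨I, rfl⟩ := ClassGroup.mk0_surjective y
  refine ⟨(classCompatible_map k L).nonzero I, (classMap_mk0 I).symm, fun g => ?_⟩
  exact (smul_map_eq g (1 : Gal(k/ℚ)) (fun a => g.commutes a) I).trans (by rw [one_smul]; rfl)

variable {k L : Type} [Field k] [NumberField k] [Field L] [NumberField L] [Algebra k L]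
  [IsGalois k L]

theorem mk0_mem_stronglyAmbiguous (h3 : Module.finrank k L = 3) {σ : Gal(L/k)}
    (hσ : ∀ g, g ∈ Subgroup.zpowers σ) (I : (Ideal (𝓞 L))⁰) {x y : 𝓞 L} (hx : x ≠ 0)
    (hxy : Ideal.span {x} * σ • (I : Ideal (𝓞 L)) = Ideal.span {y} * I) {w : (𝓞 k)ˣ}
    (hw : Algebra.intNorm (𝓞 k) (𝓞 L) y = w ^ 3 * Algebra.intNorm (𝓞 k) (𝓞 L) x) :
    ClassGroup.mk0 I ∈ stronglyAmbiguous k L := by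
  have hN : ∀ x : 𝓞 L, ((Algebra.intNorm (𝓞 k) (𝓞 L) x : 𝓞 k) : k) = Algebra.norm k (x : L) :=
    fun x => Algebra.algebraMap_intNorm (A := 𝓞 k) (K := k) (L := L) (B := 𝓞 L) x
  have hx' : (x : L) ≠ 0 := RingOfIntegers.coe_ne_zero_iff.mpr hx
  have hnx : Algebra.norm k (x : L) ≠ 0 := Algebra.norm_ne_zero_iff.mpr hx'
  set u : 𝓞 k := ((w⁻¹ : (𝓞 k)ˣ) : 𝓞 k) with hu
  have hwu : (u : k) * ((w : 𝓞 k) : k) = 1 := by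
    rw [← map_mul, hu, Units.inv_mul, map_one]
  have hnorm : Algebra.norm k ((y : L) * algebraMap k L u / x) = 1 := by
    refine mul_right_cancel₀ hnx ?_
    rw [← map_mul, div_mul_cancel₀ _ hx', one_mul, map_mul, Algebra.norm_algebraMap, h3, ← hN,
      ← hN, hw]
    have e : (((w : 𝓞 k) ^ 3 * Algebra.intNorm (𝓞 k) (𝓞 L) x : 𝓞 k) : k) =
      ((w : 𝓞 k) : k) ^ 3 * (Algebra.intNorm (𝓞 k) (𝓞 L) x : 𝓞 k) := by simp
    rw [e, mul_comm, ← mul_assoc, ← mul_pow, hwu, one_pow, one_mul]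
  have : IsCyclic Gal(L/k) := ⟨σ, hσ⟩
  obtain ⟨β, hβ⟩ := groupCohomology.exists_div_of_norm_eq_one hσ hnorm
  obtain ⟨n, hn, hint⟩ := IsAlgebraic.exists_integral_multiple
    ((IsFractionRing.isAlgebraic_iff ℤ ℚ L).mpr
      (Algebra.IsAlgebraic.isAlgebraic (R := ℚ) (β : L)))
  let a : 𝓞 L := ⟨n • (β : L), hint⟩
  have ha : a ≠ 0 := by
    rw [← RingOfIntegers.coe_ne_zero_iff]
    exact smul_ne_zero hn β.ne_zero
  have hax : a * x = y * algebraMap (𝓞 k) (𝓞 L) u * (σ • a) := by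
    apply RingOfIntegers.coe_injective
    change (n • (β : L)) * x = y * algebraMap k L u * σ (n • (β : L))
    rw [eq_div_iff hx', div_mul_eq_mul_div, div_eq_iff (by simp)] at hβ
    rw [map_zsmul, smul_mul_assoc, mul_smul_comm, hβ]
  have huu : IsUnit (algebraMap (𝓞 k) (𝓞 L) u) := (Units.isUnit w⁻¹).map _
  have hspan : Ideal.span {a} ∈ (Ideal (𝓞 L))⁰ := by
    rwa [mem_nonZeroDivisors_iff_ne_zero, Ne, Ideal.zero_eq_bot, Ideal.span_singleton_eq_bot]
  have hsmul : σ • Ideal.span {a} = Ideal.span {σ • a} := by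
    rw [Ideal.pointwise_smul_def, Ideal.map_span, Set.image_singleton]
    rfl
  have hinv : σ • (Ideal.span {a} * (I : Ideal (𝓞 L))) = Ideal.span {a} * (I : Ideal (𝓞 L)) := by
    have hx0 : Ideal.span {x} ≠ (0 : Ideal (𝓞 L)) := by
      rwa [Ne, Ideal.zero_eq_bot, Ideal.span_singleton_eq_bot]
    refine mul_left_cancel₀ hx0 ?_
    rw [smul_mul', hsmul, mul_left_comm, hxy, ← mul_assoc, ← mul_assoc,
      Ideal.span_singleton_mul_span_singleton, Ideal.span_singleton_mul_span_singleton,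
      mul_comm x a, hax, mul_right_comm, Ideal.span_singleton_mul_right_unit huu,
      mul_comm y]
  refine ⟨⟨_, hspan⟩ * I, ?_, fun g => ?_⟩
  · rw [map_mul, mul_eq_right, ClassGroup.mk0_eq_one_iff]
    exact ⟨a, rfl⟩
  · have hle : Subgroup.zpowers σ ≤
        MulAction.stabilizer Gal(L/k) (Ideal.span {a} * (I : Ideal (𝓞 L))) := by
      rw [Subgroup.zpowers_le]
      exact hinv
    exact hle (hσ g)

theorem relIndex_eqLocus_le (h3 : Module.finrank k L = 3) {σ : Gal(L/k)} (hσ : σ ≠ 1) :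
    (stronglyAmbiguous k L).relIndex
      ((classSMul σ).eqLocus (MonoidHom.id (ClassGroup (𝓞 L)))) ≤ 3 ^ Module.finrank ℚ k := by
  have hc : Nat.card Gal(L/k) = 3 := by rw [IsGalois.card_aut_eq_finrank, h3]
  have : Fact (Nat.Prime 3) := ⟨Nat.prime_three⟩
  let V := (powMonoidHom 3 : (𝓞 k)ˣ →* (𝓞 k)ˣ).range
  have hV : V.index ≤ 3 ^ Module.finrank ℚ k :=
    (Units.index_range_pow_le 3).2.trans (Nat.pow_le_pow_right (by norm_num)
      Units.rank_add_one_le_finrank)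
  have : V.FiniteIndex := ⟨(Units.index_range_pow_le 3).1⟩
  refine le_trans ?_ hV
  have key : ∀ c : (classSMul σ).eqLocus (MonoidHom.id (ClassGroup (𝓞 L))),
      ∃ (I : (Ideal (𝓞 L))⁰) (x y : 𝓞 L) (ν : (𝓞 k)ˣ), ClassGroup.mk0 I = c ∧ x ≠ 0 ∧
        Ideal.span {x} * σ • (I : Ideal (𝓞 L)) = Ideal.span {y} * I ∧
        Algebra.intNorm (𝓞 k) (𝓞 L) y = ν * Algebra.intNorm (𝓞 k) (𝓞 L) x := by
    rintro ⟨c, hc⟩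
    obtain ⟨I, rfl⟩ := ClassGroup.mk0_surjective c
    have hc' : classSMul σ (ClassGroup.mk0 I) = ClassGroup.mk0 I := hc
    rw [classSMul_mk0, ClassGroup.mk0_eq_mk0_iff] at hc'
    obtain ⟨x, y, hx, hy, hxy⟩ := hc'
    have hxy' : Ideal.span {x} * σ • (I : Ideal (𝓞 L)) = Ideal.span {y} * I := hxy
    have h1 := congrArg (Ideal.relNorm (𝓞 k)) hxy'
    rw [map_mul, map_mul, Ideal.relNorm_smul, Ideal.relNorm_singleton,
      Ideal.relNorm_singleton] at h1
    have hI0 : Ideal.relNorm (𝓞 k) (I : Ideal (𝓞 L)) ≠ 0 := fun h0 =>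
      nonZeroDivisors.ne_zero I.2 (Ideal.relNorm_eq_bot_iff.mp h0)
    obtain ⟨ν, hν⟩ := Ideal.span_singleton_eq_span_singleton.mp (mul_right_cancel₀ hI0 h1)
    exact ⟨I, x, y, ν, rfl, hx, hxy', by rw [← hν, mul_comm]⟩
  choose I x y ν hI hx hxy hν using key
  refine (Subgroup.relIndex_le_card_of_forall (fun c => (ν c : (𝓞 k)ˣ ⧸ V))
    fun a b hab => ?_).2
  obtain ⟨w, hw⟩ := QuotientGroup.eq.mp hab
  rw [powMonoidHom_apply, eq_inv_mul_iff_mul_eq] at hw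
  have hmem := mk0_mem_stronglyAmbiguous h3
    (fun _ => mem_zpowers_of_prime_card hc hσ) (I a ^ 2 * I b) (x := x a ^ 2 * x b)
    (y := y a ^ 2 * y b) (w := ν a * w) (mul_ne_zero (pow_ne_zero _ (hx a)) (hx b)) (by
      rw [← Ideal.span_singleton_mul_span_singleton, ← Ideal.span_singleton_mul_span_singleton,
        ← Ideal.span_singleton_pow, ← Ideal.span_singleton_pow, Submonoid.coe_mul,
        SubmonoidClass.coe_pow, smul_mul', smul_pow', mul_mul_mul_comm, ← mul_pow, hxy, hxy,
        mul_pow, mul_mul_mul_comm]) (by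
      rw [map_mul, map_mul, map_pow, map_pow, hν, hν, ← hw]
      push_cast
      ring)
  have hcube : ClassGroup.mk0 (I a) ^ 3 ∈ stronglyAmbiguous k L := by
    refine range_classMap_le_stronglyAmbiguous ⟨classNorm k L (ClassGroup.mk0 (I a)), ?_⟩
    have ha : classSMul σ (ClassGroup.mk0 (I a)) = ClassGroup.mk0 (I a) := by
      rw [hI]
      exact a.2
    rw [classMap_classNorm, Finset.prod_univ_of_card_eq_three hc hσ, classSMul_one, pow_two,
      classSMul_mul, ha, ha, pow_three']
  rw [map_mul, map_pow, hI, hI] at hmem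
  rw [hI] at hcube
  have h4 := Subgroup.mul_mem _ (Subgroup.inv_mem _ hcube) hmem
  convert h4 using 1
  group

/-- The bound for ambiguous classes in a cyclic cubic extension. -/
theorem relIndex_range_classMap_le (h3 : Module.finrank k L = 3) {σ : Gal(L/k)} (hσ : σ ≠ 1)
    (hfin : (cubicRamified k L).Finite) :
    (classMap k L).range.relIndex
      ((classSMul σ).eqLocus (MonoidHom.id (ClassGroup (𝓞 L)))) ≤
        3 ^ (cubicRamified k L).ncard * 3 ^ Module.finrank ℚ k := by
  have hle : stronglyAmbiguous k L ≤ (classSMul σ).eqLocus (MonoidHom.id _) := by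
    rintro _ ⟨I, rfl, hI⟩
    change classSMul σ (ClassGroup.mk0 I) = ClassGroup.mk0 I
    rw [classSMul_mk0]
    congr 1
    exact Subtype.ext (hI σ)
  rw [← Subgroup.relIndex_mul_relIndex _ _ _ range_classMap_le_stronglyAmbiguous hle]
  exact Nat.mul_le_mul (relIndex_stronglyAmbiguous_le h3 hfin) (relIndex_eqLocus_le h3 hσ)

end NumberField
end

noncomputable section
namespace NumberField

open scoped nonZeroDivisors Pointwise Classical
open UniqueFactorizationMonoid

section
variable {A B : Type*} [CommRing A] [IsDedekindDomain A] [CommRing B] [IsDedekindDomain B]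
  [Algebra A B] [Module.IsTorsionFree A B] [Module.Finite A B]

theorem _root_.Ideal.ramificationIdx_le_finrank_of_ne_bot (P : Ideal B) [hP : P.IsPrime] (hP0 : P ≠ ⊥) :
    P.ramificationIdx A ≤ Module.finrank A B := by
  have hp0 : P.under A ≠ ⊥ := Ideal.IsIntegral.comap_ne_bot (R := A) hP0
  have hm : (P.under A).IsMaximal := (Ideal.IsPrime.under A P).isMaximal hp0
  have : Fintype ((P.under A).primesOver B) :=
    (IsDedekindDomain.primesOver_finite (P.under A) B).fintype
  rw [← Ideal.sum_ramification_inertia_eq_finrank (P.under A) B]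
  have hle := Finset.single_le_sum
    (f := fun q : (P.under A).primesOver B => q.1.ramificationIdx A * q.1.inertiaDeg A)
    (fun _ _ => Nat.zero_le _) (Finset.mem_univ ⟨P, hP, ⟨rfl⟩⟩)
  exact (Nat.le_mul_of_pos_right _ (Ideal.inertiaDeg_pos P A)).trans hle

theorem _root_.Ideal.ncard_primesOver_le_finrank (p : Ideal A) [p.IsMaximal] :
    (p.primesOver B).ncard ≤ Module.finrank A B := by
  have : Fintype (p.primesOver B) := (IsDedekindDomain.primesOver_finite p B).fintype
  rw [← Ideal.sum_ramification_inertia_eq_finrank p B, ← Nat.card_coe_set_eq,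
    Nat.card_eq_fintype_card, ← Finset.card_univ, Finset.card_eq_sum_ones]
  refine Finset.sum_le_sum fun q _ => ?_
  have := q.2.1
  exact Nat.mul_pos (Ideal.ramificationIdx_pos q.1 _) (Ideal.inertiaDeg_pos q.1 _)

end

theorem discr_mem_of_two_le_ramificationIdx {K : Type*} [Field K] [NumberField K]
    (P : Ideal (𝓞 K)) [P.IsPrime] (hP0 : P ≠ ⊥) (h : 2 ≤ P.ramificationIdx ℤ) :
    ((discr K : ℤ) : 𝓞 K) ∈ P := by
  have hp0 : P.under ℤ ≠ ⊥ := Ideal.IsIntegral.comap_ne_bot (R := ℤ) hP0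
  have hm : (P.under ℤ).IsMaximal := (Ideal.IsPrime.under ℤ P).isMaximal hp0
  have hmap : (P.under ℤ).map (algebraMap ℤ (𝓞 K)) ≠ ⊥ := Ideal.map_ne_bot_of_ne_bot hp0
  have hdvd : P ^ 2 ∣ (P.under ℤ).map (algebraMap ℤ (𝓞 K)) := by
    rw [Ideal.IsDedekindDomain.ramificationIdx_eq_normalizedFactors_count (P.under ℤ) P hmap] at h
    refine (pow_dvd_pow P h).trans ?_
    have hle := Multiset.le_count_iff_replicate_le.mp (le_refl ((normalizedFactors ((P.under ℤ).map (algebraMap ℤ (𝓞 K)))).count P))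
    have := Multiset.prod_dvd_prod_of_le hle
    rwa [Multiset.prod_replicate, Ideal.prod_normalizedFactors_eq_self hmap] at this
  have h1 := pow_sub_one_dvd_differentIdeal ℤ P 2 hp0 hdvd
  rw [pow_one] at h1
  exact Ideal.le_of_dvd h1 (discr_mem_differentIdeal K (𝓞 K))

variable {K k L : Type*} [Field K] [NumberField K] [Field k] [NumberField k] [Field L]
  [NumberField L] [Algebra K L] [Algebra k L]

theorem cubicRamified_subset (hKL : Module.finrank K L = 2) :
    cubicRamified k L ⊆ ⋃ q ∈ (discr K).natAbs.primeFactors,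
      (Ideal.span {(q : ℤ)}).primesOver (𝓞 k) := by
  rintro p ⟨hp, hp0, hpT⟩
  obtain ⟨P, hP, hPp⟩ := Ideal.nonempty_primesOver (S := 𝓞 L) p
  have hP0 : P ≠ ⊥ := by
    rintro rfl
    exact hp0 (hPp.over.trans (Ideal.under_bot ..))
  have h3 := hpT P hP hPp.over.symm
  set Q := P.under (𝓞 K) with hQ
  have hQP : P.LiesOver Q := ⟨rfl⟩
  have hQp : Q.IsPrime := Ideal.IsPrime.under _ P
  have hQ0 : Q ≠ ⊥ := Ideal.IsIntegral.comap_ne_bot (R := 𝓞 K) hP0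
  have e1 := Ideal.ramificationIdx_tower (R := ℤ) p P
  have e2 := Ideal.ramificationIdx_tower (R := ℤ) Q P
  have h2 : P.ramificationIdx (𝓞 K) ≤ 2 := by
    rw [← hKL, ← finrank_ringOfIntegers_eq]
    exact Ideal.ramificationIdx_le_finrank_of_ne_bot P hP0
  have hpos := Ideal.ramificationIdx_pos P (𝓞 K)
  have hpos' := Ideal.ramificationIdx_pos Q ℤ
  have h3' : 3 ∣ Q.ramificationIdx ℤ := by
    have hd : 3 ∣ Q.ramificationIdx ℤ * P.ramificationIdx (𝓞 K) := by
      rw [← e2, e1]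
      exact dvd_mul_of_dvd_right h3 _
    refine Nat.Coprime.dvd_of_dvd_mul_right ?_ hd
    interval_cases P.ramificationIdx (𝓞 K) <;> decide
  have hmem := discr_mem_of_two_le_ramificationIdx Q hQ0 (by
    have := Nat.le_of_dvd hpos' h3'
    omega)
  have hZ : p.under ℤ = Q.under ℤ := by
    rw [hPp.over, hQ, Ideal.under_under, Ideal.under_under]
  have hZ0 : p.under ℤ ≠ ⊥ := Ideal.IsIntegral.comap_ne_bot (R := ℤ) hp0
  have hZp : (p.under ℤ).IsPrime := Ideal.IsPrime.under _ p
  obtain ⟨q, hq, hqs⟩ : ∃ q : ℕ, q.Prime ∧ p.under ℤ = Ideal.span {(q : ℤ)} := by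
    obtain ⟨n, hn⟩ := (IsPrincipalIdealRing.principal (p.under ℤ)).principal
    have hn' : p.under ℤ = Ideal.span {n} := hn
    rw [hn'] at hZ0 hZp
    have hn0 : n ≠ 0 := by simpa using hZ0
    refine ⟨n.natAbs, Int.prime_iff_natAbs_prime.mp ((Ideal.span_singleton_prime hn0).mp hZp), ?_⟩
    rw [hn', Int.span_natAbs]
  refine Set.mem_biUnion (x := q) ?_ ⟨hp, ⟨hqs.symm⟩⟩
  rw [Finset.mem_coe, Nat.mem_primeFactors]
  refine ⟨hq, ?_, Int.natAbs_ne_zero.mpr (discr_ne_zero K)⟩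
  have : discr K ∈ Q.under ℤ := by
    rw [Ideal.mem_comap]
    simpa using hmem
  rw [← hZ, hqs, Ideal.mem_span_singleton] at this
  exact Int.natCast_dvd.mp this

theorem cubicRamified_finite_and_ncard_le (hKL : Module.finrank K L = 2) :
    (cubicRamified k L).Finite ∧ (cubicRamified k L).ncard ≤
      (discr K).natAbs.primeFactors.card * Module.finrank ℚ k := by
  have hsub := cubicRamified_subset (k := k) hKL
  have hm : ∀ q ∈ (discr K).natAbs.primeFactors, (Ideal.span {(q : ℤ)}).IsMaximal := by
    intro q hq
    have hq' := Nat.prime_iff_prime_int.mp (Nat.prime_of_mem_primeFactors hq)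
    exact ((Ideal.span_singleton_prime hq'.ne_zero).mpr hq').isMaximal (by simpa using hq'.ne_zero)
  have hf : ∀ q ∈ (discr K).natAbs.primeFactors,
      ((Ideal.span {(q : ℤ)}).primesOver (𝓞 k)).Finite := fun q hq =>
    have := hm q hq
    IsDedekindDomain.primesOver_finite _ _
  have hfin := Set.Finite.biUnion (Finset.finite_toSet _) hf
  refine ⟨hfin.subset hsub, (Set.ncard_le_ncard hsub hfin).trans ?_⟩
  refine (Finset.set_ncard_biUnion_le _ _).trans ?_
  rw [← smul_eq_mul]
  refine Finset.sum_le_card_nsmul _ _ _ fun q hq => ?_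
  have := hm q hq
  rw [← RingOfIntegers.rank k]
  exact Ideal.ncard_primesOver_le_finrank _

end NumberField
end

noncomputable section
namespace NumberField

open scoped nonZeroDivisors Pointwise Classical

section
variable {F K L : Type*} [Field F] [Field K] [Field L] [Algebra F K] [Algebra F L]
  [IsGalois F L]

theorem finrank_le_factorial_of_normalClosure_eq_top [FiniteDimensional F K]
    [FiniteDimensional F L]
    (h : IntermediateField.normalClosure F K L = ⊤) :
    Module.finrank F L ≤ (Module.finrank F K).factorial := by
  let φ : Gal(L/F) →* Equiv.Perm (K →ₐ[F] L) :=
    { toFun := fun g =>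
        { toFun := fun f => (g : L →ₐ[F] L).comp f
          invFun := fun f => ((g⁻¹ : Gal(L/F)) : L →ₐ[F] L).comp f
          left_inv := fun f => by ext x; exact g.symm_apply_apply _
          right_inv := fun f => by ext x; exact g.apply_symm_apply _ }
      map_one' := by ext; rfl
      map_mul' := fun _ _ => by ext; rfl }
  have hφ : Function.Injective φ := by
    rw [injective_iff_map_eq_one]
    intro g hg
    have hle : IntermediateField.normalClosure F K L ≤
        IntermediateField.fixedField (Subgroup.zpowers g) := by
      rw [IntermediateField.normalClosure]
      refine iSup_le fun f => ?_
      rintro _ ⟨x, rfl⟩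
      rw [IntermediateField.mem_fixedField_iff]
      have hx : g (f x) = f x := DFunLike.congr_fun (Equiv.congr_fun hg f) x
      intro s hs
      have hst : Subgroup.zpowers g ≤ MulAction.stabilizer Gal(L/F) (f x) := by
        rw [Subgroup.zpowers_le]
        exact hx
      exact hst hs
    ext x
    have hx : x ∈ IntermediateField.fixedField (Subgroup.zpowers g) := by
      rw [h] at hle
      exact hle IntermediateField.mem_top
    exact (IntermediateField.mem_fixedField_iff _ _).mp hx g (Subgroup.mem_zpowers g)
  rw [← IsGalois.card_aut_eq_finrank]
  refine (Nat.card_le_card_of_injective φ hφ).trans ?_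
  rw [Nat.card_perm]
  exact Nat.factorial_le (card_algHom_le_finrank F K L)

theorem isGalois_of_fieldRange_eq_fixedField (f : K →ₐ[F] L) (H : Subgroup Gal(L/F)) [H.Normal]
    (h : IntermediateField.fixedField H = f.fieldRange) : IsGalois F K := by
  have : IsGalois F f.fieldRange := h ▸ IsGalois.of_fixedField_normal_subgroup H
  have e : f.fieldRange ≃ₐ[F] K := (AlgEquiv.ofInjectiveField f).symm
  exact IsGalois.of_algEquiv e

end

theorem _root_.Group.eq_of_card_three {G : Type*} [Group G] (h : Nat.card G = 3) {σ : G}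
    (hσ : σ ≠ 1) (ρ : G) : ρ = 1 ∨ ρ = σ ∨ ρ = σ ^ 2 := by
  have : Fact (Nat.Prime 3) := ⟨Nat.prime_three⟩
  have : Finite G := Nat.finite_of_card_ne_zero (by omega)
  have ho : orderOf σ = 3 := orderOf_eq_prime (h ▸ pow_card_eq_one') hσ
  have hm := mem_zpowers_of_prime_card h hσ (g' := ρ)
  rw [mem_zpowers_iff_mem_range_orderOf, ho] at hm
  simp only [Finset.mem_image, Finset.mem_range] at hm
  obtain ⟨i, hi, rfl⟩ := hm
  interval_cases i <;> simp

variable {K k L : Type*} [Field K] [NumberField K] [Field k] [NumberField k] [Field L]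
  [NumberField L] [Algebra K L] [Algebra k L]

theorem not_commute_of_not_isGalois [IsGalois ℚ L] [IsGalois K L]
    (hK : ¬ IsGalois ℚ K) (h6 : Module.finrank ℚ L = 6) (h3 : Module.finrank k L = 3)
    (h2 : Module.finrank K L = 2) {σ : Gal(L/k)} (hσ : σ ≠ 1) {τ : Gal(L/K)} (hτ : τ ≠ 1)
    (h : ∀ a, τ (σ a) = σ (τ a)) (hk : IsGalois k L) : False := by
  set σ' : Gal(L/ℚ) := AlgEquiv.restrictScalarsHom ℚ σ
  set τ' : Gal(L/ℚ) := AlgEquiv.restrictScalarsHom ℚ τ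
  have cσ : Nat.card Gal(L/k) = 3 := (IsGalois.card_aut_eq_finrank k L).trans h3
  have cτ : Nat.card Gal(L/K) = 2 := (IsGalois.card_aut_eq_finrank K L).trans h2
  have : Fact (Nat.Prime 3) := ⟨Nat.prime_three⟩
  have : Fact (Nat.Prime 2) := ⟨Nat.prime_two⟩
  have oσ : orderOf σ' = 3 := by
    rw [orderOf_injective _ (AlgEquiv.restrictScalars_injective ℚ)]
    exact orderOf_eq_prime (cσ ▸ pow_card_eq_one') hσ
  have oτ : orderOf τ' = 2 := by
    rw [orderOf_injective _ (AlgEquiv.restrictScalars_injective ℚ)]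
    exact orderOf_eq_prime (cτ ▸ pow_card_eq_one') hτ
  have hcomm : τ' * σ' = σ' * τ' := by
    ext a
    exact h a
  have hσC : σ' ∈ Subgroup.centralizer {τ'} := by
    rw [Subgroup.mem_centralizer_singleton_iff]
    exact hcomm.symm
  have hτC : τ' ∈ Subgroup.centralizer {τ'} := by
    rw [Subgroup.mem_centralizer_singleton_iff]
  have h6' : Nat.card Gal(L/ℚ) = 6 := (IsGalois.card_aut_eq_finrank ℚ L).trans h6
  have htop : Subgroup.centralizer {τ'} = ⊤ := by
    refine Subgroup.eq_top_of_card_eq _ (Nat.dvd_antisymm (Subgroup.card_subgroup_dvd_card _) ?_)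
    rw [h6']
    have d3 := Subgroup.orderOf_dvd_natCard _ hσC
    have d2 := Subgroup.orderOf_dvd_natCard _ hτC
    rw [oσ] at d3
    rw [oτ] at d2
    omega
  have hn : (Subgroup.zpowers τ').Normal := by
    have hτZ : τ' ∈ Subgroup.center Gal(L/ℚ) := by
      rw [Subgroup.mem_center_iff]
      intro g
      have : g ∈ Subgroup.centralizer {τ'} := htop ▸ Subgroup.mem_top g
      exact Subgroup.mem_centralizer_singleton_iff.mp this
    refine ⟨fun n hn g => ?_⟩
    have : n ∈ Subgroup.center Gal(L/ℚ) := (Subgroup.zpowers_le.mpr hτZ) hn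
    rwa [(Subgroup.mem_center_iff.mp this g), mul_inv_cancel_right]
  refine hK (isGalois_of_fieldRange_eq_fixedField (Algebra.algHom ℚ K L)
    (Subgroup.zpowers τ') ?_)
  · ext x
    have hx : x ∈ (Algebra.algHom ℚ K L).fieldRange ↔ τ x = x := by
      have : x ∈ (Algebra.algHom ℚ K L).fieldRange ↔ x ∈ Set.range (algebraMap K L) := Iff.rfl
      rw [this, IsGalois.mem_range_algebraMap_iff_fixed]
      refine ⟨fun h => h τ, fun h g => ?_⟩
      have hg := mem_zpowers_of_prime_card cτ hτ (g' := g)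
      have hst : Subgroup.zpowers τ ≤ MulAction.stabilizer Gal(L/K) x := by
        rw [Subgroup.zpowers_le]
        exact h
      exact hst hg
    rw [hx, IntermediateField.mem_fixedField_iff]
    refine ⟨fun h => h τ' (Subgroup.mem_zpowers τ'), fun h g hg => ?_⟩
    have hst : Subgroup.zpowers τ' ≤ MulAction.stabilizer Gal(L/ℚ) x := by
      rw [Subgroup.zpowers_le]
      exact h
    exact hst hg

theorem exists_dihedral_generators [IsGalois ℚ L] (hK3 : Module.finrank ℚ K = 3)
    (hK : ¬ IsGalois ℚ K) (hn : IntermediateField.normalClosure ℚ K L = ⊤)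
    (hk : Module.finrank ℚ k = 2) [IsGalois ℚ k] [IsGalois k L] [IsGalois K L] :
    Module.finrank k L = 3 ∧ Module.finrank K L = 2 ∧
      ∃ σ : Gal(L/k), σ ≠ 1 ∧ ∃ τ : Gal(L/K), τ ≠ 1 ∧ ∃ c : Gal(k/ℚ), c ≠ 1 ∧
        (∀ a, τ (algebraMap k L a) = algebraMap k L (c a)) ∧
        ∀ a, τ (σ a) = (σ ^ 2) (τ a) := by
  have hle := finrank_le_factorial_of_normalClosure_eq_top hn
  rw [hK3] at hle
  have hle : Module.finrank ℚ L ≤ 6 := hle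
  have t1 := Module.finrank_mul_finrank ℚ K L
  have t2 := Module.finrank_mul_finrank ℚ k L
  have hpos : 0 < Module.finrank ℚ L := Module.finrank_pos
  rw [hK3] at t1
  rw [hk] at t2
  have h3 : Module.finrank k L = 3 := by omega
  have h2 : Module.finrank K L = 2 := by omega
  have h6 : Module.finrank ℚ L = 6 := by omega
  have cσ : Nat.card Gal(L/k) = 3 := (IsGalois.card_aut_eq_finrank k L).trans h3
  have cτ : Nat.card Gal(L/K) = 2 := (IsGalois.card_aut_eq_finrank K L).trans h2
  have : Nontrivial Gal(L/k) := Finite.one_lt_card_iff_nontrivial.mp (by omega)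
  have : Nontrivial Gal(L/K) := Finite.one_lt_card_iff_nontrivial.mp (by omega)
  obtain ⟨σ, hσ⟩ := exists_ne (1 : Gal(L/k))
  obtain ⟨τ, hτ⟩ := exists_ne (1 : Gal(L/K))
  have hτ2 : τ ^ 2 = 1 := cτ ▸ pow_card_eq_one'
  have hττ : ∀ a, τ (τ a) = a := fun a => by
    have := DFunLike.congr_fun hτ2 a
    rwa [pow_two] at this
  set c : Gal(k/ℚ) := (AlgEquiv.restrictScalars ℚ τ).restrictNormal k with hc
  have hcτ : ∀ a, τ (algebraMap k L a) = algebraMap k L (c a) := fun a =>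
    ((AlgEquiv.restrictScalars ℚ τ).restrictNormal_commutes k a).symm
  refine ⟨h3, h2, σ, hσ, τ, hτ, c, ?_, hcτ, ?_⟩
  · intro h1
    have hτk : ∀ a, τ (algebraMap k L a) = algebraMap k L a := fun a => by
      rw [hcτ, h1]
      rfl
    let ρ : Gal(L/k) := AlgEquiv.ofRingEquiv (f := τ.toRingEquiv) hτk
    have hρ2 : ρ ^ 2 = 1 := by
      ext a
      exact hττ a
    have hρ3 : ρ ^ 3 = 1 := cσ ▸ pow_card_eq_one'
    have hρ : ρ = 1 := by
      rw [pow_succ, hρ2, one_mul] at hρ3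
      exact hρ3
    refine hτ ?_
    ext a
    exact DFunLike.congr_fun hρ a
  · have hρk : ∀ a, τ (σ (τ (algebraMap k L a))) = algebraMap k L a := fun a => by
      rw [hcτ, σ.commutes, ← hcτ, hττ]
    let ρ : Gal(L/k) := AlgEquiv.ofRingEquiv
      (f := (τ.toRingEquiv.trans σ.toRingEquiv).trans τ.toRingEquiv) hρk
    have hρa : ∀ a, ρ a = τ (σ (τ a)) := fun _ => rfl
    rcases Group.eq_of_card_three cσ hσ ρ with h | h | h
    · refine absurd ?_ hσ
      ext a
      have := hρa (τ a)
      rw [h, hττ] at this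
      have h' := congrArg τ this
      rw [hττ] at h'
      have h'' : τ (τ a) = σ a := h'
      rw [hττ] at h''
      exact h''.symm
    · refine (not_commute_of_not_isGalois hK h6 h3 h2 hσ hτ (fun a => ?_) inferInstance).elim
      have := hρa (τ a)
      rw [h, hττ] at this
      exact this.symm
    · intro a
      have := hρa (τ a)
      rw [h, hττ] at this
      exact this.symm

theorem card_three_torsion_le_of_resolvent {K k L : Type} [Field K] [NumberField K] [Field k]
    [NumberField k] [Field L] [NumberField L] [IsGalois ℚ L]
    (hK3 : Module.finrank ℚ K = 3) (hK : ¬ IsGalois ℚ K) (f : K →ₐ[ℚ] L)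
    (hn : IntermediateField.normalClosure ℚ K L = ⊤) (g : k →ₐ[ℚ] L)
    (hk : Module.finrank ℚ k = 2) :
    let ω := (discr K).natAbs.primeFactors.card
    Nat.card {z : ClassGroup (𝓞 K) // z ^ 3 = 1} ≤
        81 * 81 ^ ω * Nat.card {y : ClassGroup (𝓞 k) // y ^ 3 = 1} ∧
      Nat.card {y : ClassGroup (𝓞 k) // y ^ 3 = 1} ≤
        81 * 81 ^ ω * Nat.card {z : ClassGroup (𝓞 K) // z ^ 3 = 1} := by
  intro ω
  let : Algebra K L := f.toRingHom.toAlgebra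
  let : Algebra k L := g.toRingHom.toAlgebra
  have : IsGalois K L := IsGalois.tower_top_of_isGalois ℚ K L
  have : IsGalois k L := IsGalois.tower_top_of_isGalois ℚ k L
  have : Algebra.IsQuadraticExtension ℚ k := ⟨hk⟩
  obtain ⟨h3, h2, σ, hσ, τ, hτ, c, hc, h, hτσ⟩ := exists_dihedral_generators hK3 hK hn hk
  obtain ⟨hfin, hcard⟩ := cubicRamified_finite_and_ncard_le (K := K) (k := k) h2
  rw [hk] at hcard
  have hB : (classMap k L).range.relIndex
      ((classSMul σ).eqLocus (MonoidHom.id (ClassGroup (𝓞 L)))) ≤ 9 * 9 ^ ω := by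
    refine (relIndex_range_classMap_le h3 hσ hfin).trans ?_
    rw [hk, mul_comm]
    refine Nat.mul_le_mul (by norm_num) ?_
    calc 3 ^ (cubicRamified k L).ncard ≤ 3 ^ (2 * ω) :=
          Nat.pow_le_pow_right (by norm_num) (by omega)
      _ = 9 ^ ω := by rw [pow_mul]; norm_num
  obtain ⟨hz, hy⟩ := card_torsion_le_of_resolvent hk h3 h2 hσ hτ hc h hτσ hB
  refine ⟨hz.trans_eq ?_, hy.trans ?_⟩
  · rw [mul_pow, ← pow_mul, mul_comm ω 2, pow_mul]
    norm_num
  · rw [← mul_assoc, ← mul_assoc]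
    refine Nat.mul_le_mul_right _ (Nat.mul_le_mul (by norm_num) ?_)
    exact Nat.pow_le_pow_left (by norm_num) _

theorem card_three_torsion_pos (F : Type*) [Field F] [NumberField F] :
    0 < Nat.card {y : ClassGroup (𝓞 F) // y ^ 3 = 1} :=
  have : Nonempty {y : ClassGroup (𝓞 F) // y ^ 3 = 1} := ⟨⟨1, one_pow 3⟩⟩
  Nat.card_pos

end NumberField
end

/-- Gerth's transfer principle (recovered in Section 6): for a non-Galois cubic field `K`
with Galois closure `L` and quadratic resolvent `k ⊆ L`, the 3-torsion of the class groups
of `K` and of `k` agree up to a factor `O_ε(|D_K|^ε)`. -/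
theorem cubic_resolvent_three_torsion_transfer (ε : ℝ) (hε : 0 < ε) :
    ∃ C : ℝ, 1 ≤ C ∧
      ∀ (K L k : Type) [Field K] [Field L] [Field k]
        [NumberField K] [NumberField L] [NumberField k],
        Module.finrank ℚ K = 3 →
        ¬ IsGalois ℚ K →
        IsGalois ℚ L →
        (K →ₐ[ℚ] L) →
        IntermediateField.normalClosure ℚ K L = ⊤ →
        (k →ₐ[ℚ] L) →
        Module.finrank ℚ k = 2 →
        C⁻¹ * |(NumberField.discr K : ℝ)| ^ (-ε)
            ≤ (Nat.card {c : ClassGroup (𝓞 K) // c ^ 3 = 1} : ℝ)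
              / (Nat.card {c : ClassGroup (𝓞 k) // c ^ 3 = 1} : ℝ) ∧
          (Nat.card {c : ClassGroup (𝓞 K) // c ^ 3 = 1} : ℝ)
              / (Nat.card {c : ClassGroup (𝓞 k) // c ^ 3 = 1} : ℝ)
            ≤ C * |(NumberField.discr K : ℝ)| ^ ε := by
  obtain ⟨C, hC, hω⟩ := Nat.exists_pow_card_primeFactors_le 81 (by norm_num) ε hε
  refine ⟨81 * C, by linarith, ?_⟩
  intro K L k _ _ _ _ _ _ hK3 hK hL f hn g hk
  obtain ⟨hz, hy⟩ := card_three_torsion_le_of_resolvent hK3 hK f hn g hk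
  have hD := hω (discr K).natAbs (Int.natAbs_ne_zero.mpr (discr_ne_zero K))
  rw [Nat.cast_natAbs, Int.cast_abs] at hD
  have hz0 : (0 : ℝ) < Nat.card {c : ClassGroup (𝓞 K) // c ^ 3 = 1} := by
    exact_mod_cast card_three_torsion_pos K
  have hy0 : (0 : ℝ) < Nat.card {c : ClassGroup (𝓞 k) // c ^ 3 = 1} := by
    exact_mod_cast card_three_torsion_pos k
  have hD0 : 0 < |(discr K : ℝ)| := abs_pos.mpr (by exact_mod_cast discr_ne_zero K)
  have hP : 0 < |(discr K : ℝ)| ^ ε := Real.rpow_pos_of_pos hD0 ε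
  have hle : (81 : ℝ) * 81 ^ (discr K).natAbs.primeFactors.card ≤
      81 * C * |(discr K : ℝ)| ^ ε := by
    rw [mul_assoc]
    exact mul_le_mul_of_nonneg_left hD (by norm_num)
  have hz' := (Nat.cast_le (α := ℝ)).mpr hz
  have hy' := (Nat.cast_le (α := ℝ)).mpr hy
  push_cast at hz' hy'
  constructor
  · rw [Real.rpow_neg hD0.le, ← mul_inv, le_div_iff₀ hy0, inv_mul_le_iff₀ (by positivity)]
    exact hy'.trans (mul_le_mul_of_nonneg_right hle hz0.le)
  · rw [div_le_iff₀ hy0]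
    exact hz'.trans (mul_le_mul_of_nonneg_right hle hy0.le)
end
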